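/- Let Γ be an n-dimensional Bieberbach group. Then d(Γ) ≤ 2n. -/

import Mathlib

/-- `minGenerators G` is the minimal number of generators of the group `G`. -/
noncomputable def minGenerators (G : Type*) [Group G] : ℕ :=
  sInf {k | ∃ S : Finset G, S.card = k ∧ Subgroup.closure (S : Set G) = ⊤}

namespace BieberbachRank

/-- `GenBy G t` says that the group `G` is generated by a tuple of `t` elements. -/
def GenBy (G : Type*) [Group G] (t : ℕ) : Prop :=
  ∃ x : Fin t → G, Subgroup.closure (Set.range x) = ⊤

theorem GenBy.sup {G : Type*} [Group G] {s r : ℕ} {H : Subgroup G} (hH : GenBy H s)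
    (y : Fin r → G) (hy : H ⊔ Subgroup.closure (Set.range y) = ⊤) : GenBy G (s + r) := by
  obtain ⟨x, hx⟩ := hH
  refine ⟨Fin.append (fun i => (x i : G)) y, ?_⟩
  have h1 : Subgroup.closure (Set.range fun i => (x i : G)) = H := by
    have := congrArg (Subgroup.map H.subtype) hx
    rw [MonoidHom.map_closure, ← MonoidHom.range_eq_map, H.range_subtype, ← Set.range_comp] at this
    exact this
  have h2 : Set.range (Fin.append (fun i => (x i : G)) y) =
      Set.range (fun i => (x i : G)) ∪ Set.range y := by
    ext g
    constructor
    · rintro ⟨i, rfl⟩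
      refine Fin.addCases (fun i => ?_) (fun i => ?_) i
      · left; exact ⟨i, by simp⟩
      · right; exact ⟨i, by simp⟩
    · rintro (⟨i, rfl⟩ | ⟨i, rfl⟩)
      · exact ⟨Fin.castAdd _ i, by simp⟩
      · exact ⟨Fin.natAdd _ i, by simp⟩
  rw [h2, Subgroup.closure_union, h1, hy]

theorem GenBy.map {G H : Type*} [Group G] [Group H] {t : ℕ} (h : GenBy G t) (f : G →* H)
    (hf : Function.Surjective f) : GenBy H t := by
  obtain ⟨x, hx⟩ := h
  refine ⟨f ∘ x, ?_⟩
  rw [Set.range_comp, ← MonoidHom.map_closure, hx, ← MonoidHom.range_eq_map,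
    MonoidHom.range_eq_top.mpr hf]

theorem GenBy.mono {G : Type*} [Group G] {s t : ℕ} (h : GenBy G s) (hst : s ≤ t) :
    GenBy G t := by
  obtain ⟨r, rfl⟩ := Nat.exists_eq_add_of_le hst
  have h' : GenBy (⊤ : Subgroup G) s :=
    h.map (Subgroup.topEquiv.symm : G ≃* (⊤ : Subgroup G)).toMonoidHom
      (MulEquiv.surjective (Subgroup.topEquiv.symm : G ≃* (⊤ : Subgroup G)))
  exact h'.sup (fun _ => 1) (by simp)

theorem genBy_of_subsingleton {G : Type*} [Group G] [Subsingleton G] (t : ℕ) : GenBy G t :=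
  ⟨fun _ => 1, Subsingleton.elim _ _⟩

theorem GenBy.minGenerators_le {G : Type*} [Group G] {t : ℕ} (h : GenBy G t) :
    minGenerators G ≤ t := by
  classical
  obtain ⟨x, hx⟩ := h
  have : (Finset.univ.image x).card ≤ t := by
    simpa using Finset.card_image_le (s := Finset.univ) (f := x)
  refine le_trans (Nat.sInf_le ⟨Finset.univ.image x, rfl, ?_⟩) this
  simpa using hx

/-- The orbits of a subgroup coarsen as the subgroup grows. -/
theorem card_orbits_sup_zpowers_lt {G Ω : Type*} [Group G] [MulAction G Ω] [Finite Ω]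
    (K : Subgroup G) (g : G) (ω : Ω) (h : g • ω ∉ MulAction.orbit K ω) :
    Nat.card (MulAction.orbitRel.Quotient (K ⊔ Subgroup.zpowers g : Subgroup G) Ω) <
      Nat.card (MulAction.orbitRel.Quotient K Ω) := by
  let K' : Subgroup G := K ⊔ Subgroup.zpowers g
  have hK : K ≤ K' := le_sup_left
  have hg : g ∈ K' := (le_sup_right : _ ≤ K') (Subgroup.mem_zpowers g)
  let F : MulAction.orbitRel.Quotient K Ω → MulAction.orbitRel.Quotient K' Ω :=
    Quotient.map' id (by
      rintro a b hab
      obtain ⟨k, hk⟩ := MulAction.orbitRel_apply.mp hab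
      exact MulAction.orbitRel_apply.mpr ⟨⟨k, hK k.2⟩, hk⟩)
  have hF : Function.Surjective F := by
    intro q
    induction q using Quotient.inductionOn' with
    | h a => exact ⟨Quotient.mk'' a, rfl⟩
  have : Finite (MulAction.orbitRel.Quotient K Ω) := Quotient.finite _
  have : Finite (MulAction.orbitRel.Quotient K' Ω) := Quotient.finite _
  refine lt_of_le_of_ne (Nat.card_le_card_of_surjective F hF) fun hcard => h ?_
  have hinj : Function.Injective F :=
    ((Nat.bijective_iff_surjective_and_card F).mpr ⟨hF, hcard.symm⟩).1
  have : (Quotient.mk'' (g • ω) : MulAction.orbitRel.Quotient K Ω) = Quotient.mk'' ω := by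
    apply hinj
    exact Quotient.sound' (MulAction.orbitRel_apply.mpr ⟨⟨g, hg⟩, rfl⟩)
  exact MulAction.orbitRel_apply.mp (Quotient.exact' this)

theorem exists_tuple_sup_eq_top {G Ω : Type*} [Group G] [MulAction G Ω] [Finite Ω] (ω : Ω)
    (K : Subgroup G) (hK : MulAction.stabilizer G ω ≤ K) :
    ∃ (r : ℕ) (y : Fin r → G), K ⊔ Subgroup.closure (Set.range y) = ⊤ ∧
      r + Nat.card (MulAction.orbitRel.Quotient (⊤ : Subgroup G) Ω) ≤
        Nat.card (MulAction.orbitRel.Quotient K Ω) := by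
  induction hc : Nat.card (MulAction.orbitRel.Quotient K Ω) using Nat.strong_induction_on
    generalizing K with
  | _ c ih =>
    by_cases hKt : K = ⊤
    · subst hKt
      exact ⟨0, Fin.elim0, by simp, by omega⟩
    · obtain ⟨g, hg⟩ : ∃ g : G, g • ω ∉ MulAction.orbit K ω := by
        by_contra! hall
        apply hKt
        rw [eq_top_iff]
        intro g _
        obtain ⟨k, hk⟩ := hall g
        have : (k : G)⁻¹ * g ∈ MulAction.stabilizer G ω := by
          rw [MulAction.mem_stabilizer_iff, mul_smul, inv_smul_eq_iff]
          exact hk.symm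
        simpa using K.mul_mem k.2 (hK this)
      have hlt := card_orbits_sup_zpowers_lt K g ω hg
      obtain ⟨r, y, hy, hr⟩ := ih _ (hc ▸ hlt) (K ⊔ Subgroup.zpowers g) (hK.trans le_sup_left) rfl
      refine ⟨r + 1, Fin.cons g y, ?_, by omega⟩
      rw [Fin.range_cons, Set.insert_eq, Subgroup.closure_union, ← Subgroup.zpowers_eq_closure,
        ← sup_assoc, hy]

/-- A faithful permutation group on a finite set `Ω` can be generated by at most
`|Ω|` minus the number of orbits elements. -/
theorem exists_genBy_add_card_orbits_le {G Ω : Type*} [Group G] [MulAction G Ω] [Finite Ω]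
    [Finite G] [FaithfulSMul G Ω] : ∃ t, GenBy G t ∧
      t + Nat.card (MulAction.orbitRel.Quotient (⊤ : Subgroup G) Ω) ≤ Nat.card Ω := by
  induction hc : Nat.card G using Nat.strong_induction_on generalizing G with
  | _ c ih =>
    by_cases htriv : ∀ (ω : Ω) (g : G), g • ω = ω
    · have : Subsingleton G := ⟨fun a b => by
        apply FaithfulSMul.eq_of_smul_eq_smul (α := Ω)
        intro ω
        rw [htriv, htriv]⟩
      refine ⟨0, genBy_of_subsingleton 0, ?_⟩
      rw [zero_add]
      exact Nat.card_le_card_of_surjective _ Quotient.mk''_surjective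
    · push Not at htriv
      obtain ⟨ω, g, hg⟩ := htriv
      let H := MulAction.stabilizer G ω
      have hlt : Nat.card H < Nat.card G := by
        refine lt_of_le_of_ne (Subgroup.card_le_card_group H) fun h => hg ?_
        have := Subgroup.eq_top_of_card_eq H h
        have hgH : g ∈ H := this ▸ Subgroup.mem_top g
        exact hgH
      obtain ⟨s, hs, hs'⟩ := ih _ (hc ▸ hlt) (G := H) rfl
      obtain ⟨r, y, hy, hr⟩ := exists_tuple_sup_eq_top ω H le_rfl
      refine ⟨s + r, hs.sup y hy, ?_⟩
      have : Nat.card (MulAction.orbitRel.Quotient H Ω) ≤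
          Nat.card (MulAction.orbitRel.Quotient (⊤ : Subgroup H) Ω) := by
        let F : MulAction.orbitRel.Quotient (⊤ : Subgroup H) Ω → MulAction.orbitRel.Quotient H Ω :=
          Quotient.map' id (by
            rintro a b hab
            obtain ⟨k, hk⟩ := MulAction.orbitRel_apply.mp hab
            exact MulAction.orbitRel_apply.mpr ⟨k.1, hk⟩)
        have : Finite (MulAction.orbitRel.Quotient (⊤ : Subgroup H) Ω) := Quotient.finite _
        refine Nat.card_le_card_of_surjective F fun q => ?_
        induction q using Quotient.inductionOn' with
        | h a => exact ⟨Quotient.mk'' a, rfl⟩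
      omega

theorem genBy_card_sub_one {G Ω : Type*} [Group G] [MulAction G Ω] [Finite Ω] [Nonempty Ω]
    [Finite G] [FaithfulSMul G Ω] : GenBy G (Nat.card Ω - 1) := by
  obtain ⟨t, ht, hle⟩ := exists_genBy_add_card_orbits_le (G := G) (Ω := Ω)
  refine ht.mono ?_
  have : Finite (MulAction.orbitRel.Quotient (⊤ : Subgroup G) Ω) := Quotient.finite _
  have : Nonempty (MulAction.orbitRel.Quotient (⊤ : Subgroup G) Ω) :=
    ‹Nonempty Ω›.map Quotient.mk''
  have h1 : 0 < Nat.card (MulAction.orbitRel.Quotient (⊤ : Subgroup G) Ω) := Nat.card_pos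
  omega

/-- A finite group with a core-free subgroup of index `m` is generated by `m - 1` elements. -/
theorem genBy_index_sub_one {G : Type*} [Group G] [Finite G] (M : Subgroup G)
    (hM : M.normalCore = ⊥) : GenBy G (M.index - 1) := by
  have : FaithfulSMul G (G ⧸ M) := by
    constructor
    intro a b hab
    have : (MulAction.toPermHom G (G ⧸ M)) a = MulAction.toPermHom G (G ⧸ M) b :=
      Equiv.ext hab
    have h2 : Function.Injective (MulAction.toPermHom G (G ⧸ M)) := by
      rw [← MonoidHom.ker_eq_bot_iff, ← M.normalCore_eq_ker, hM]
    exact h2 this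
  exact genBy_card_sub_one (Ω := G ⧸ M)

/-- The tuples lifting `g` along `f` that generate the subgroup `K`. -/
def genLifts {H Q ι : Type*} [Group H] [Group Q] (f : H →* Q) (K : Subgroup H) (g : ι → Q) :
    Set (ι → H) :=
  {x | (∀ i, f (x i) = g i) ∧ Subgroup.closure (Set.range x) = K}

theorem card_lifts_eq {H Q ι : Type*} [Group H] [Group Q]
    (f : H →* Q) (K : Subgroup H) (hK : K.map f = ⊤) (g g' : ι → Q) :
    Nat.card {x : ι → H | (∀ i, f (x i) = g i) ∧ ∀ i, x i ∈ K} =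
      Nat.card {x : ι → H | (∀ i, f (x i) = g' i) ∧ ∀ i, x i ∈ K} := by
  have key : ∀ q : Q, ∃ k ∈ K, f k = q := fun q => by
    have : q ∈ K.map f := hK ▸ Subgroup.mem_top q
    simpa using this
  choose a haK hfa using key
  refine Nat.card_congr
    { toFun := fun x => ⟨fun i => x.1 i * (a (g i))⁻¹ * a (g' i), fun i => ?_, fun i => ?_⟩
      invFun := fun x => ⟨fun i => x.1 i * (a (g' i))⁻¹ * a (g i), fun i => ?_, fun i => ?_⟩
      left_inv := fun x => ?_
      right_inv := fun x => ?_ }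
  · simp [hfa, x.2.1 i]
  · exact K.mul_mem (K.mul_mem (x.2.2 i) (K.inv_mem (haK _))) (haK _)
  · simp [hfa, x.2.1 i]
  · exact K.mul_mem (K.mul_mem (x.2.2 i) (K.inv_mem (haK _))) (haK _)
  · ext i; simp
  · ext i; simp

/-- **Gaschütz's lemma** (counting form): the number of generating lifts of a generating tuple
does not depend on the tuple. -/
theorem card_genLifts_eq {H Q ι : Type*} [Group H] [Group Q] [Finite H] [Finite ι]
    (f : H →* Q) (g g' : ι → Q)
    (hg : Subgroup.closure (Set.range g) = ⊤) (hg' : Subgroup.closure (Set.range g') = ⊤)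
    (K : Subgroup H) : Nat.card (genLifts f K g) = Nat.card (genLifts f K g') := by
  classical
  have : Fintype (Subgroup H) := Fintype.ofFinite _
  induction K using WellFoundedLT.induction with
  | ind K ih =>
    by_cases hK : K.map f = ⊤
    · have hsum : ∀ q : ι → Q,
          Nat.card {x : ι → H | (∀ i, f (x i) = q i) ∧ ∀ i, x i ∈ K} =
            ∑ J ∈ Finset.univ.filter (· < K), Nat.card (genLifts f J q) +
              Nat.card (genLifts f K q) := by
        intro q
        have hu : {x : ι → H | (∀ i, f (x i) = q i) ∧ ∀ i, x i ∈ K} =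
            ⋃ J ∈ (Finset.univ.filter (· ≤ K) : Finset (Subgroup H)), genLifts f J q := by
          ext x
          simp only [Set.mem_ofPred_eq, Finset.mem_filter, Finset.mem_univ, true_and,
            Set.mem_iUnion, genLifts, exists_prop]
          constructor
          · rintro ⟨h1, h2⟩
            refine ⟨_, ?_, h1, rfl⟩
            rw [Subgroup.closure_le]
            rintro _ ⟨i, rfl⟩
            exact h2 i
          · rintro ⟨J, hJ, h1, h2⟩
            exact ⟨h1, fun i => hJ (h2 ▸ Subgroup.subset_closure ⟨i, rfl⟩)⟩
        rw [Nat.card_coe_set_eq, hu, Set.ncard_eq_toFinset_card _ (Set.toFinite _)]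
        have h3 : (Set.toFinite (⋃ J ∈ (Finset.univ.filter (· ≤ K) : Finset (Subgroup H)),
            genLifts f J q)).toFinset = (Finset.univ.filter (· ≤ K)).biUnion
              fun J => (Set.toFinite (genLifts f J q)).toFinset := by
          ext x; simp
        rw [h3, Finset.card_biUnion]
        · have h4 : (Finset.univ.filter (· ≤ K) : Finset (Subgroup H)) =
              insert K (Finset.univ.filter (· < K)) := by
            ext J; simp [le_iff_eq_or_lt]
          rw [h4, Finset.sum_insert (by simp), add_comm]
          simp only [Nat.card_coe_set_eq, Set.ncard_eq_toFinset_card _ (Set.toFinite _)]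
        · intro J _ J' _ hne
          rw [Function.onFun, Finset.disjoint_left]
          intro x hx hx'
          simp only [Set.Finite.mem_toFinset] at hx hx'
          exact hne (hx.2.symm.trans hx'.2)
      have e := card_lifts_eq f K hK g g'
      rw [hsum, hsum, Finset.sum_congr rfl fun J hJ => ih J (by simpa using hJ)] at e
      omega
    · have h0 : ∀ q : ι → Q, Subgroup.closure (Set.range q) = ⊤ → genLifts f K q = ∅ := by
        intro q hq
        rw [Set.eq_empty_iff_forall_notMem]
        rintro x ⟨h1, h2⟩
        apply hK
        rw [← h2, MonoidHom.map_closure, ← Set.range_comp, ← hq]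
        congr 2
        exact funext h1
      rw [h0 g hg, h0 g' hg']

theorem _root_.IsPGroup.exists_tuple_sup_eq_top {S : Type*} [Group S] [Finite S] {p : ℕ}
    [Fact p.Prime] (hS : IsPGroup p S) (r : ℕ) (K : Subgroup S) (hK : K.index ≤ p ^ r) :
    ∃ y : Fin r → S, K ⊔ Subgroup.closure (Set.range y) = ⊤ := by
  induction r generalizing K with
  | zero =>
    refine ⟨Fin.elim0, ?_⟩
    have : K.index ≠ 0 := Subgroup.index_ne_zero_of_finite
    have : K = ⊤ := Subgroup.index_eq_one.mp (by simp at hK; omega)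
    simp [this]
  | succ r ih =>
    by_cases hKt : K = ⊤
    · exact ⟨fun _ => 1, by simp [hKt]⟩
    · obtain ⟨x, hx⟩ : ∃ x, x ∉ K := by
        by_contra! h
        exact hKt (eq_top_iff.mpr fun x _ => h x)
      let K' := K ⊔ Subgroup.zpowers x
      have hxK' : x ∈ K' := (le_sup_right : _ ≤ K') (Subgroup.mem_zpowers x)
      have hmul : K.relIndex K' * K'.index = K.index := Subgroup.relIndex_mul_index le_sup_left
      have hne : K.relIndex K' ≠ 1 := fun h => hx (Subgroup.relIndex_eq_one.mp h hxK')
      obtain ⟨a, ha⟩ := IsPGroup.index hS K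
      obtain ⟨b, hb, hb'⟩ := (Nat.dvd_prime_pow Fact.out).mp (ha ▸ Dvd.intro _ hmul :
        K.relIndex K' ∣ p ^ a)
      have hple : p ≤ K.relIndex K' := by
        rw [hb']
        exact Nat.le_self_pow (fun h0 => hne (by rw [hb', h0, pow_zero])) p
      have hp : 0 < p := (Fact.out : p.Prime).pos
      have hle : K'.index ≤ p ^ r := by
        refine Nat.le_of_mul_le_mul_left (c := p) ?_ hp
        calc p * K'.index ≤ K.relIndex K' * K'.index := Nat.mul_le_mul_right _ hple
          _ ≤ p ^ (r + 1) := hmul.trans_le hK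
          _ = p * p ^ r := by ring
      obtain ⟨y, hy⟩ := ih K' hle
      refine ⟨Fin.cons x y, ?_⟩
      rw [Fin.range_cons, Set.insert_eq, Subgroup.closure_union, ← Subgroup.zpowers_eq_closure,
        ← sup_assoc, hy]

theorem _root_.IsPGroup.commutator_mem_and_pow_mem_of_isCoatom {S : Type*} [Group S] [Finite S]
    {p : ℕ} [Fact p.Prime] (hS : IsPGroup p S) (M : Subgroup S) (hM : IsCoatom M) :
    (∀ x y : S, x * y * x⁻¹ * y⁻¹ ∈ M) ∧ ∀ x : S, x ^ p ∈ M := by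
  have hnil : Group.IsNilpotent S := hS.isNilpotent
  have hnor : M.Normal := Subgroup.NormalizerCondition.normal_of_coatom M Group.normalizerCondition_of_isNilpotent hM
  have hQ : IsPGroup p (S ⧸ M) := hS.to_quotient M
  have hsub : ∀ K : Subgroup (S ⧸ M), K = ⊥ ∨ K = ⊤ := by
    intro K
    have hle : M ≤ K.comap (QuotientGroup.mk' M) := by
      intro m hm
      simp [(QuotientGroup.eq_one_iff m).mpr hm, K.one_mem]
    rcases eq_or_lt_of_le hle with h | h
    · left
      rw [eq_bot_iff]
      intro q hq
      obtain ⟨x, rfl⟩ := QuotientGroup.mk'_surjective M q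
      have : x ∈ M := by rw [h]; exact hq
      simpa using this
    · right
      have := hM.2 _ h
      rw [eq_top_iff]
      intro q _
      obtain ⟨x, rfl⟩ := QuotientGroup.mk'_surjective M q
      have : x ∈ K.comap (QuotientGroup.mk' M) := this ▸ Subgroup.mem_top x
      exact this
  have hnt : Nontrivial (S ⧸ M) := by
    rw [QuotientGroup.nontrivial_iff]
    exact hM.1
  have hcomm : ∀ a b : S ⧸ M, a * b = b * a := by
    have := hQ.center_nontrivial
    rcases hsub (Subgroup.center (S ⧸ M)) with h | h
    · exact absurd h ((Subgroup.nontrivial_iff_ne_bot _).mp this)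
    · intro a b
      have : b ∈ Subgroup.center (S ⧸ M) := h ▸ Subgroup.mem_top b
      exact Subgroup.mem_center_iff.mp this a
  have hpow : ∀ a : S ⧸ M, a ^ p = 1 := by
    obtain ⟨k, hk⟩ := IsPGroup.iff_card.mp hQ
    have hdvd : p ∣ Nat.card (S ⧸ M) := by
      rw [hk]
      refine dvd_pow_self p fun h0 => ?_
      rw [h0, pow_zero] at hk
      exact absurd hk (Finite.one_lt_card).ne'
    obtain ⟨b, hb⟩ := exists_prime_orderOf_dvd_card' p hdvd
    rcases hsub (Subgroup.zpowers b) with h | h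
    · rw [Subgroup.zpowers_eq_bot] at h
      rw [h, orderOf_one] at hb
      exact absurd hb (Fact.out : p.Prime).one_lt.ne
    · intro a
      obtain ⟨k, rfl⟩ := Subgroup.mem_zpowers_iff.mp (h ▸ Subgroup.mem_top a :
        a ∈ Subgroup.zpowers b)
      rw [← zpow_natCast, ← zpow_mul, mul_comm, zpow_mul, zpow_natCast, ← hb, pow_orderOf_eq_one,
        one_zpow]
  constructor
  · intro x y
    rw [← QuotientGroup.eq_one_iff]
    have := hcomm (x : S ⧸ M) y
    rw [QuotientGroup.mk_mul, QuotientGroup.mk_mul, QuotientGroup.mk_mul, this]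
    simp
  · intro x
    rw [← QuotientGroup.eq_one_iff]
    exact hpow x

/-- A finite `p`-group all of whose elementary abelian quotients have order at most `p ^ n` is
generated by `n` elements. -/
theorem genBy_of_index_le {S : Type*} [Group S] [Finite S] {p : ℕ} [Fact p.Prime]
    (hS : IsPGroup p S) (n : ℕ)
    (h : ∀ F : Subgroup S, F.Normal → (∀ x y : S, x * y * x⁻¹ * y⁻¹ ∈ F) → (∀ x : S, x ^ p ∈ F) →
      F.index ≤ p ^ n) : GenBy S n := by
  have hmem : ∀ x : S, (∀ M : Subgroup S, IsCoatom M → x ∈ M) → x ∈ frattini S := by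
    intro x hx
    simpa [Subgroup.mem_iInf, frattini, Order.radical] using hx
  obtain ⟨y, hy⟩ := hS.exists_tuple_sup_eq_top n (frattini S) (h (frattini S) inferInstance
    (fun x y => hmem _ fun M hM => (hS.commutator_mem_and_pow_mem_of_isCoatom M hM).1 x y)
    (fun x => hmem _ fun M hM => (hS.commutator_mem_and_pow_mem_of_isCoatom M hM).2 x))
  exact ⟨y, frattini_nongenerating (by rwa [sup_comm])⟩

/-- The sections of `X → X ⧸ N` that are homomorphisms. -/
abbrev Section {X : Type*} [Group X] (N : Subgroup X) [N.Normal] : Type _ :=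
  {σ : X ⧸ N →* X // ∀ q, (σ q : X ⧸ N) = q}

theorem mul_inv_mem_of_mk_eq {X : Type*} [Group X] {N : Subgroup X} [N.Normal] {a b : X}
    (h : (a : X ⧸ N) = b) : a * b⁻¹ ∈ N := by
  rw [← QuotientGroup.eq_one_iff]
  simp [h]

/-- If two sections agree on a subgroup of index prime to the exponent of `N`, they are determined
by one element of `N`. -/
theorem exists_injOn_sections {X : Type*} [Group X] [Finite X] (N : Subgroup X) [N.Normal]
    (hcomm : ∀ a ∈ N, ∀ b ∈ N, a * b = b * a) {p : ℕ} (hp : p.Prime)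
    (hexp : ∀ a ∈ N, a ^ p = 1) (P : Subgroup (X ⧸ N)) (hP : ¬ p ∣ P.index) (σ₀ : Section N) :
    ∃ ν : Section N → N, ∀ σ τ : Section N, (∀ q ∈ P, σ.1 q = σ₀.1 q) →
      (∀ q ∈ P, τ.1 q = σ₀.1 q) → ν σ = ν τ → σ = τ := by
  classical
  let _ : CommGroup N := { (inferInstance : Group N) with
    mul_comm := fun a b => Subtype.ext (hcomm a a.2 b b.2) }
  have : Fintype ((X ⧸ N) ⧸ P) := Fintype.ofFinite _
  let δ : Section N → X ⧸ N → N := fun σ q =>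
    ⟨σ.1 q * (σ₀.1 q)⁻¹, mul_inv_mem_of_mk_eq ((σ.2 q).trans (σ₀.2 q).symm)⟩
  let c : X → N →* N := fun x => (MulAut.conjNormal x : N ≃* N).toMonoidHom
  have hδ : ∀ σ q r, δ σ (q * r) = c (σ₀.1 q) (δ σ r) * δ σ q := by
    intro σ q r
    have h1 := hcomm (σ.1 q * (σ₀.1 q)⁻¹) (δ σ q).2
      (σ₀.1 q * (σ.1 r * (σ₀.1 r)⁻¹) * (σ₀.1 q)⁻¹) (c (σ₀.1 q) (δ σ r)).2
    apply Subtype.ext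
    simp only [δ, c, map_mul, Subgroup.coe_mul, MulEquiv.toMonoidHom_eq_coe, MonoidHom.coe_coe,
      MulAut.conjNormal_apply]
    rw [← h1]
    group
  refine ⟨fun σ => ∏ q : (X ⧸ N) ⧸ P, δ σ q.out, fun σ τ hσ hτ hν => ?_⟩
  have key : ∀ σ : Section N, (∀ q ∈ P, σ.1 q = σ₀.1 q) → ∀ y : X ⧸ N,
      (∏ q : (X ⧸ N) ⧸ P, δ σ q.out) =
        c (σ₀.1 y) (∏ q : (X ⧸ N) ⧸ P, δ σ q.out) * δ σ y ^ P.index := by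
    intro σ hσ y
    have hout : ∀ q : X ⧸ N, δ σ ((q : (X ⧸ N) ⧸ P).out) = δ σ q := by
      intro q
      obtain ⟨r, hr⟩ := QuotientGroup.mk_out_eq_mul P q
      rw [hr, hδ]
      have : δ σ r = 1 := Subtype.ext (by simp [δ, hσ r r.2])
      rw [this, map_one, one_mul]
    have hact : ∀ q : (X ⧸ N) ⧸ P, δ σ ((y • q).out) = c (σ₀.1 y) (δ σ q.out) * δ σ y := by
      intro q
      rw [← hδ, ← hout (y * q.out)]
      congr 2
      conv_lhs => rw [← QuotientGroup.out_eq' q]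
      rfl
    calc ∏ q : (X ⧸ N) ⧸ P, δ σ q.out = ∏ q : (X ⧸ N) ⧸ P, δ σ (y • q).out :=
          (Equiv.prod_comp (MulAction.toPerm y) fun q : (X ⧸ N) ⧸ P => δ σ q.out).symm
      _ = _ := by
          simp_rw [hact]
          rw [Finset.prod_mul_distrib, map_prod, Finset.prod_const, Finset.card_univ,
            ← Nat.card_eq_fintype_card]
          rfl
  apply Subtype.ext
  ext y
  have h1 := key σ hσ y
  have h2 := key τ hτ y
  have hν' : ∏ q : (X ⧸ N) ⧸ P, δ σ q.out = ∏ q : (X ⧸ N) ⧸ P, δ τ q.out := hν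
  have h3 : δ τ y ^ P.index = δ σ y ^ P.index := by
    rw [hν'] at h1
    exact mul_left_cancel (h2.symm.trans h1)
  have hcop : P.index.Coprime p := ((Nat.Prime.coprime_iff_not_dvd hp).mpr hP).symm
  have h5 : (δ σ y * (δ τ y)⁻¹) = 1 := by
    rw [← orderOf_eq_one_iff]
    refine Nat.eq_one_of_dvd_coprimes hcop (orderOf_dvd_of_pow_eq_one ?_)
      (orderOf_dvd_of_pow_eq_one (Subtype.ext (hexp _ (δ σ y * (δ τ y)⁻¹).2)))
    rw [mul_pow, inv_pow, h3, mul_inv_cancel]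
  have h6 := congrArg Subtype.val h5
  simp only [δ, Subgroup.coe_mul, Subgroup.coe_inv, Subgroup.coe_one] at h6
  have h7 : σ.1 y * (τ.1 y)⁻¹ = 1 := by rw [← h6]; group
  exact mul_inv_eq_one.mp h7

theorem card_sections_le {X : Type*} [Group X] [Finite X] (N : Subgroup X) [N.Normal]
    (hN : N ≠ ⊥)
    (hcomm : ∀ a ∈ N, ∀ b ∈ N, a * b = b * a) {p : ℕ} (hp : p.Prime)
    (hexp : ∀ a ∈ N, a ^ p = 1) {n : ℕ}
    (hS : ∀ S : Subgroup X, IsPGroup p S → GenBy S n) :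
    Nat.card (Section N) ≤ Nat.card N * (Nat.card N ^ n - 1) := by
  classical
  rcases isEmpty_or_nonempty (Section N) with hE | hE
  · simp
  have : Fact p.Prime := ⟨hp⟩
  have hNp : IsPGroup p N := fun a => ⟨1, Subtype.ext (by simpa using hexp a a.2)⟩
  obtain ⟨S, hNS⟩ := hNp.exists_le_sylow
  obtain ⟨s, hs⟩ := hS S S.isPGroup'
  have hs' : Subgroup.closure (Set.range fun i => (s i : X)) = S := by
    have := congrArg (Subgroup.map (S : Subgroup X).subtype) hs
    rw [MonoidHom.map_closure, ← MonoidHom.range_eq_map, Subgroup.range_subtype,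
      ← Set.range_comp] at this
    exact this
  let P : Subgroup (X ⧸ N) := (S : Subgroup X).map (QuotientGroup.mk' N)
  have hPcl : P = Subgroup.closure (Set.range fun i => ((s i : X) : X ⧸ N)) := by
    change Subgroup.map _ _ = _
    conv_lhs => rw [← hs', MonoidHom.map_closure, ← Set.range_comp]
    rfl
  have hP : ¬ p ∣ P.index := fun h => S.not_dvd_index
    (h.trans (Subgroup.index_map_dvd _ (QuotientGroup.mk'_surjective N)))
  let F : Section N → Fin n → N := fun σ i =>
    ⟨σ.1 (s i : X) * (s i : X)⁻¹, mul_inv_mem_of_mk_eq (σ.2 _)⟩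
  have hF1 : ∀ σ, F σ ≠ 1 := by
    intro σ h1
    apply hN
    have hmem : (S : Subgroup X) ≤ σ.1.range := by
      rw [← hs', Subgroup.closure_le]
      rintro _ ⟨i, rfl⟩
      have := congrArg Subtype.val (congrFun h1 i)
      exact ⟨_, mul_inv_eq_one.mp this⟩
    rw [eq_bot_iff]
    intro a ha
    obtain ⟨q, rfl⟩ := hmem (hNS ha)
    have : q = 1 := by rw [← σ.2 q]; exact (QuotientGroup.eq_one_iff _).mpr ha
    simp [this]
  have hFP : ∀ σ τ, F σ = F τ → ∀ q ∈ P, σ.1 q = τ.1 q := by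
    intro σ τ h
    have : P ≤ MonoidHom.eqLocus σ.1 τ.1 := by
      rw [hPcl, Subgroup.closure_le]
      rintro _ ⟨i, rfl⟩
      have := congrArg Subtype.val (congrFun h i)
      exact mul_right_cancel this
    exact this
  choose ν hν using exists_injOn_sections N hcomm hp hexp P hP
  let base : (Fin n → N) → Section N := Function.invFun F
  have hbase : ∀ σ, F (base (F σ)) = F σ := fun σ => Function.invFun_eq ⟨σ, rfl⟩
  let Ψ : Section N → N × {v : Fin n → N // v ≠ 1} := fun σ => (ν (base (F σ)) σ, ⟨F σ, hF1 σ⟩)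
  have hΨ : Function.Injective Ψ := by
    intro σ τ h
    simp only [Ψ, Prod.mk.injEq, Subtype.mk.injEq] at h
    obtain ⟨h1, h2⟩ := h
    rw [← h2] at h1
    exact hν _ σ τ (hFP _ _ (hbase σ).symm) (hFP _ _ (by rw [hbase, h2])) h1
  refine (Nat.card_le_card_of_injective Ψ hΨ).trans ?_
  rw [Nat.card_prod]
  have : Fintype N := Fintype.ofFinite _
  simp [Nat.card_eq_fintype_card, Fintype.card_subtype_compl]

theorem normal_inf_of_sup_eq_top {X : Type*} [Group X] (N H : Subgroup X) [N.Normal]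
    (hcomm : ∀ a ∈ N, ∀ b ∈ N, a * b = b * a) (h : H ⊔ N = ⊤) : (H ⊓ N).Normal := by
  constructor
  intro a ha g
  obtain ⟨x, hx, y, hy, rfl⟩ := Subgroup.mem_sup_of_normal_right.mp (h ▸ Subgroup.mem_top g : g ∈ H ⊔ N)
  have : x * y * a * (x * y)⁻¹ = x * a * x⁻¹ := by
    rw [mul_assoc x y a, hcomm y hy a ha.2]; group
  rw [this]
  exact ⟨H.mul_mem (H.mul_mem hx ha.1) (H.inv_mem hx), ‹N.Normal›.conj_mem a ha.2 x⟩

/-- Lifting generators along an abelian minimal normal subgroup. -/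
theorem GenBy.of_quotient_abelian {X : Type*} [Group X] [Finite X] (N : Subgroup X) [N.Normal]
    (hmin : ∀ K : Subgroup X, K.Normal → K ≤ N → K = ⊥ ∨ K = N) (hN : N ≠ ⊥)
    (hcomm : ∀ a ∈ N, ∀ b ∈ N, a * b = b * a) {n t : ℕ}
    (hS : ∀ p : ℕ, p.Prime → ∀ S : Subgroup X, IsPGroup p S → GenBy S n) (hnt : n + 1 ≤ t)
    (hQ : GenBy (X ⧸ N) t) : GenBy X t := by
  classical
  obtain ⟨p, hp, hpN⟩ := Nat.exists_prime_and_dvd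
    (n := Nat.card N) (by rwa [Ne, Subgroup.card_eq_one])
  have hexp : ∀ a ∈ N, a ^ p = 1 := by
    let K : Subgroup X :=
      { carrier := {a | a ∈ N ∧ a ^ p = 1}
        one_mem' := ⟨N.one_mem, one_pow p⟩
        mul_mem' := fun {a b} ha hb => ⟨N.mul_mem ha.1 hb.1, by
          rw [(show Commute a b from hcomm a ha.1 b hb.1).mul_pow, ha.2, hb.2, one_mul]⟩
        inv_mem' := fun {a} ha => ⟨N.inv_mem ha.1, by rw [inv_pow, ha.2, inv_one]⟩ }
    have hK : K.Normal := ⟨fun a ha g => ⟨‹N.Normal›.conj_mem a ha.1 g, by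
      rw [conj_pow, ha.2, mul_one, mul_inv_cancel]⟩⟩
    rcases hmin K hK (fun a ha => ha.1) with h | h
    · have : Fact p.Prime := ⟨hp⟩
      obtain ⟨b, hb⟩ := exists_prime_orderOf_dvd_card' p hpN
      have hbK : (b : X) ∈ K := ⟨b.2, by
        have := pow_orderOf_eq_one b
        rw [hb] at this
        exact congrArg Subtype.val this⟩
      rw [h, Subgroup.mem_bot] at hbK
      have : b = 1 := Subtype.ext hbK
      rw [this, orderOf_one] at hb
      exact absurd hb hp.one_lt.ne
    · intro a ha
      have : a ∈ K := h ▸ ha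
      exact this.2
  by_contra hX
  obtain ⟨g, hg⟩ := hQ
  choose a ha using fun i => QuotientGroup.mk_surjective (g i)
  have hsec : ∀ v : Fin t → N, ∃ σ : Section N, ∀ i, σ.1 (g i) = a i * v i := by
    intro v
    let H := Subgroup.closure (Set.range fun i => a i * v i)
    have hHN : H ⊔ N = ⊤ := by
      have h1 : H.map (QuotientGroup.mk' N) = ⊤ := by
        rw [MonoidHom.map_closure, ← Set.range_comp, ← hg]
        congr 2
        funext i
        simp [ha]
      have h2 := Subgroup.comap_map_eq (QuotientGroup.mk' N) H
      rwa [h1, Subgroup.comap_top, QuotientGroup.ker_mk', eq_comm] at h2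
    have hHtop : H ≠ ⊤ := fun h => hX ⟨_, h⟩
    have hbot : H ⊓ N = ⊥ := by
      rcases hmin _ (normal_inf_of_sup_eq_top N H hcomm hHN) inf_le_right with h | h
      · exact h
      · exact absurd (by rw [← hHN, sup_eq_left.mpr (inf_eq_right.mp h)]) hHtop
    let f : H →* X ⧸ N := (QuotientGroup.mk' N).comp H.subtype
    have hf : Function.Bijective f := by
      constructor
      · rw [injective_iff_map_eq_one]
        intro x hx
        have : (x : X) ∈ H ⊓ N := ⟨x.2, (QuotientGroup.eq_one_iff _).mp hx⟩
        rw [hbot] at this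
        exact Subtype.ext this
      · intro q
        obtain ⟨x, rfl⟩ := QuotientGroup.mk_surjective q
        obtain ⟨y, hy, z, hz, rfl⟩ :=
          Subgroup.mem_sup_of_normal_right.mp (hHN ▸ Subgroup.mem_top x : x ∈ H ⊔ N)
        exact ⟨⟨y, hy⟩, by simp [f, (QuotientGroup.eq_one_iff z).mpr hz]⟩
    let e := MulEquiv.ofBijective f hf
    refine ⟨⟨H.subtype.comp e.symm.toMonoidHom, fun q => e.apply_symm_apply q⟩, fun i => ?_⟩
    have hmem : a i * v i ∈ H := Subgroup.subset_closure ⟨i, rfl⟩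
    have : e ⟨a i * v i, hmem⟩ = g i := by
      change ((a i * v i : X) : X ⧸ N) = g i
      simp [ha]
    rw [← this]
    simp
  choose σ hσ using hsec
  have hinj : Function.Injective σ := by
    intro v w h
    funext i
    have := hσ v i
    rw [h, hσ w i] at this
    exact Subtype.ext (mul_left_cancel this).symm
  have : Finite (X ⧸ N →* X) := Finite.of_injective _ DFunLike.coe_injective
  have h1 := Nat.card_le_card_of_injective σ hinj
  have h2 := card_sections_le N hN hcomm hp hexp (hS p hp)
  have h3 : Nat.card (Fin t → N) = Nat.card N ^ t := by
    rw [Nat.card_fun, Nat.card_fin]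
  have hpos : 0 < Nat.card N := Nat.card_pos
  have h4 : Nat.card N ^ (n + 1) ≤ Nat.card N ^ t := Nat.pow_le_pow_right hpos hnt
  have h5 : 0 < Nat.card N ^ n := pow_pos hpos n
  have h6 : Nat.card N * (Nat.card N ^ n - 1) < Nat.card N ^ (n + 1) := by
    rw [pow_succ']
    exact Nat.mul_lt_mul_of_pos_left (by omega) hpos
  omega

/-- `D` is the kernel of a surjective homomorphism `Q → L` over `Y`. -/
def IsLiftKernel {Q L Y : Type*} [Group Q] [Group L] [Group Y] (ρ : Q →* Y) (σ : L →* Y)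
    (D : Subgroup Q) : Prop :=
  ∃ θ : Q →* L, Function.Surjective θ ∧ σ.comp θ = ρ ∧ θ.ker = D

theorem map_ker_eq_of_comp_eq {Q L Y : Type*} [Group Q] [Group L] [Group Y] {ρ : Q →* Y}
    {σ : L →* Y} {θ : Q →* L} (hθ : Function.Surjective θ) (h : σ.comp θ = ρ) :
    ρ.ker.map θ = σ.ker := by
  ext l
  constructor
  · rintro ⟨q, hq, rfl⟩
    rw [← h] at hq
    exact hq
  · intro hl
    obtain ⟨q, rfl⟩ := hθ l
    exact ⟨q, by rw [← h]; exact hl, rfl⟩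

section

variable {Q L Y : Type*} [Group Q] [Group L] [Group Y] {ρ : Q →* Y} {σ : L →* Y}
    {D : Subgroup Q}

theorem IsLiftKernel.normal (hD : IsLiftKernel ρ σ D) : D.Normal := by
  obtain ⟨θ, -, -, rfl⟩ := hD
  infer_instance

theorem IsLiftKernel.le_ker (hD : IsLiftKernel ρ σ D) : D ≤ ρ.ker := by
  obtain ⟨θ, -, rfl, rfl⟩ := hD
  intro q hq
  have : θ q = 1 := hq
  simp [MonoidHom.mem_ker, this]

theorem IsLiftKernel.relIndex (hD : IsLiftKernel ρ σ D) :
    D.relIndex ρ.ker = Nat.card σ.ker := by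
  obtain ⟨θ, h1, h2, rfl⟩ := hD
  rw [Subgroup.relIndex_ker, map_ker_eq_of_comp_eq h1 h2]

theorem IsLiftKernel.eq_or_eq
    (hmin : ∀ K : Subgroup L, K.Normal → K ≤ σ.ker → K = ⊥ ∨ K = σ.ker)
    (hD : IsLiftKernel ρ σ D) {A : Subgroup Q} (hA : A.Normal) (hAR : A ≤ ρ.ker) :
    A ≤ D ∨ A ⊔ D = ρ.ker := by
  have hDR := hD.le_ker
  obtain ⟨θ, h1, h2, rfl⟩ := hD
  have hle : A.map θ ≤ σ.ker := by
    rw [← map_ker_eq_of_comp_eq h1 h2]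
    exact Subgroup.map_mono hAR
  rcases hmin (A.map θ) (hA.map θ h1) hle with h | h
  · left
    exact (Subgroup.map_eq_bot_iff A).mp h
  · right
    rw [← Subgroup.comap_map_eq, h, ← map_ker_eq_of_comp_eq h1 h2, Subgroup.comap_map_eq]
    exact sup_eq_left.mpr hDR

theorem IsLiftKernel.not_inf_le
    (hmin : ∀ K : Subgroup L, K.Normal → K ≤ σ.ker → K = ⊥ ∨ K = σ.ker)
    (hnc : ∃ a ∈ σ.ker, ∃ b ∈ σ.ker, a * b ≠ b * a)
    (hD : IsLiftKernel ρ σ D) {A B : Subgroup Q} (hA : A.Normal) (hB : B.Normal)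
    (hAR : A ≤ ρ.ker) (hBR : B ≤ ρ.ker) (hAD : ¬ A ≤ D) (hBD : ¬ B ≤ D) : ¬ A ⊓ B ≤ D := by
  intro hle
  obtain ⟨θ, h1, h2, rfl⟩ := hD
  have key : ∀ C : Subgroup Q, C.Normal → C ≤ ρ.ker → ¬ C ≤ θ.ker → C.map θ = σ.ker := by
    intro C hC hCR hCD
    have hle : C.map θ ≤ σ.ker := by
      rw [← map_ker_eq_of_comp_eq h1 h2]
      exact Subgroup.map_mono hCR
    rcases hmin (C.map θ) (hC.map θ h1) hle with h | h
    · exact absurd ((Subgroup.map_eq_bot_iff C).mp h) hCD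
    · exact h
  obtain ⟨a, ha, b, hb, hab⟩ := hnc
  rw [← key A hA hAR hAD] at ha
  rw [← key B hB hBR hBD] at hb
  obtain ⟨x, hx, rfl⟩ := ha
  obtain ⟨y, hy, rfl⟩ := hb
  apply hab
  have h3 : x * y * x⁻¹ * y⁻¹ ∈ A ⊓ B := by
    constructor
    · have := A.mul_mem hx (hA.conj_mem _ (A.inv_mem hx) y)
      simpa [mul_assoc] using this
    · exact B.mul_mem (hB.conj_mem _ hy x) (B.inv_mem hy)
  have h4 : θ (x * y * x⁻¹ * y⁻¹) = 1 := hle h3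
  simp only [map_mul, map_inv] at h4
  rw [mul_inv_eq_one, mul_inv_eq_iff_eq_mul] at h4
  exact h4

/-- Distinct kernels of surjections `Q → L` over `Y` intersect as independently as possible. -/
theorem relIndex_inf_liftKernels [Finite Q]
    (hmin : ∀ K : Subgroup L, K.Normal → K ≤ σ.ker → K = ⊥ ∨ K = σ.ker)
    (hnc : ∃ a ∈ σ.ker, ∃ b ∈ σ.ker, a * b ≠ b * a)
    (S : Finset (Subgroup Q)) (hS : ∀ D ∈ S, IsLiftKernel ρ σ D) :
    (ρ.ker ⊓ S.inf id).Normal ∧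
      (∀ D, IsLiftKernel ρ σ D → D ∉ S → ¬ ρ.ker ⊓ S.inf id ≤ D) ∧
      (ρ.ker ⊓ S.inf id).relIndex ρ.ker = Nat.card σ.ker ^ S.card := by
  classical
  induction S using Finset.induction_on with
  | empty =>
    refine ⟨by simpa using (inferInstance : ρ.ker.Normal), fun D hD _ hle => ?_, by simp⟩
    obtain ⟨a, ha, b, hb, hab⟩ := hnc
    simp only [Finset.inf_empty, inf_top_eq] at hle
    obtain ⟨θ, h1, h2, rfl⟩ := hD
    have h3 := map_ker_eq_of_comp_eq h1 h2
    rw [(Subgroup.map_eq_bot_iff _).mpr hle] at h3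
    rw [← h3, Subgroup.mem_bot] at ha
    simp [ha] at hab
  | insert E S hES ih =>
    obtain ⟨ih1, ih2, ih3⟩ := ih fun D hD => hS D (Finset.mem_insert_of_mem hD)
    have hE := hS E (Finset.mem_insert_self _ _)
    have heq : ρ.ker ⊓ (insert E S).inf id = E ⊓ (ρ.ker ⊓ S.inf id) := by
      rw [Finset.inf_insert, id, inf_left_comm]
    have hnE := hE.normal
    rw [heq]
    refine ⟨inferInstance, fun D hD hDS => ?_, ?_⟩
    · refine hD.not_inf_le hmin hnc hnE ih1 hE.le_ker inf_le_left (fun hle => ?_)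
        (ih2 D hD fun h => hDS (Finset.mem_insert_of_mem h))
      apply hDS
      have h1 := Subgroup.relIndex_mul_relIndex E D ρ.ker hle hD.le_ker
      rw [hE.relIndex, hD.relIndex] at h1
      have hpos : Nat.card σ.ker ≠ 0 := by
        rw [← hE.relIndex, Subgroup.relIndex]; exact Subgroup.index_ne_zero_of_finite
      have h2 : E.relIndex D = 1 := by
        have : E.relIndex D * Nat.card σ.ker = 1 * Nat.card σ.ker := by rw [h1, one_mul]
        exact Nat.eq_of_mul_eq_mul_right (Nat.pos_of_ne_zero hpos) this
      have : D = E := le_antisymm (Subgroup.relIndex_eq_one.mp h2) hle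
      exact this ▸ Finset.mem_insert_self _ _
    · rcases hE.eq_or_eq hmin ih1 inf_le_left with h | h
      · exact absurd h (ih2 E hE hES)
      · rw [← Subgroup.relIndex_mul_relIndex (E ⊓ (ρ.ker ⊓ S.inf id)) E ρ.ker inf_le_left
          hE.le_ker, Subgroup.inf_relIndex_left, ← Subgroup.relIndex_sup_left E, h, ih3,
          hE.relIndex, Finset.card_insert_of_notMem hES, pow_succ]

/-- The number of kernels of surjections over `Y` is bounded by the odd prime valuations of the
index of a normal abelian subgroup. -/
theorem card_liftKernels_le [Finite Q]
    (hmin : ∀ K : Subgroup L, K.Normal → K ≤ σ.ker → K = ⊥ ∨ K = σ.ker)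
    (hnc : ∃ a ∈ σ.ker, ∃ b ∈ σ.ker, a * b ≠ b * a)
    (hcent : ∀ x : L, (∀ a ∈ σ.ker, x * a = a * x) → x = 1)
    (b : Subgroup Q) (hb : b.Normal) (hbcomm : ∀ x ∈ b, ∀ y ∈ b, x * y = y * x)
    {p n : ℕ} (hp : p ∣ Nat.card σ.ker) (hbn : ∀ k, p ^ k ∣ b.index → k ≤ n)
    (S : Finset (Subgroup Q)) (hS : ∀ D ∈ S, IsLiftKernel ρ σ D) : S.card ≤ n := by
  have hbD : ∀ D, IsLiftKernel ρ σ D → b ≤ D := by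
    rintro D ⟨θ, h1, h2, rfl⟩
    have hb' := hb.map θ h1
    have hcap : b.map θ ⊓ σ.ker = ⊥ := by
      rcases hmin (b.map θ ⊓ σ.ker) inferInstance inf_le_right with h | h
      · exact h
      · exfalso
        obtain ⟨a, ha, c, hc, hac⟩ := hnc
        have hle : σ.ker ≤ b.map θ := inf_eq_right.mp h
        obtain ⟨x, hx, rfl⟩ := hle ha
        obtain ⟨y, hy, rfl⟩ := hle hc
        apply hac
        rw [← map_mul, hbcomm x hx y hy, map_mul]
    intro q hq
    refine hcent (θ q) fun a ha => ?_
    have h3 : θ q * a * (θ q)⁻¹ * a⁻¹ ∈ b.map θ ⊓ σ.ker := by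
      constructor
      · have := (b.map θ).mul_mem (Subgroup.mem_map_of_mem θ hq)
          (hb'.conj_mem _ ((b.map θ).inv_mem (Subgroup.mem_map_of_mem θ hq)) a)
        simpa [mul_assoc] using this
      · exact σ.ker.mul_mem ((inferInstance : σ.ker.Normal).conj_mem _ ha _) (σ.ker.inv_mem ha)
    rw [hcap, Subgroup.mem_bot, mul_inv_eq_one, mul_inv_eq_iff_eq_mul] at h3
    exact h3
  rcases S.eq_empty_or_nonempty with rfl | ⟨D, hD⟩
  · simp
  apply hbn
  obtain ⟨h1, -, h3⟩ := relIndex_inf_liftKernels hmin hnc S hS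
  refine (pow_dvd_pow_of_dvd hp S.card).trans ?_
  rw [← h3]
  refine (Subgroup.relIndex_dvd_index_of_le inf_le_left).trans (Subgroup.index_dvd_of_le ?_)
  refine le_inf ((hbD D (hS D hD)).trans (hS D hD).le_ker) (Finset.le_inf fun E hE => ?_)
  exact hbD E (hS E hE)

end

theorem card_surjective_lifts_le {Q L Y ι : Type*} [Group Q] [Group L] [Group Y] [Finite Q]
    [Finite L] [Finite ι] (ρ : Q →* Y) (σ : L →* Y) {n : ℕ}
    (hn : ∀ S : Finset (Subgroup Q), (∀ D ∈ S, IsLiftKernel ρ σ D) → S.card ≤ n)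
    (z : ι → L) (hz : Subgroup.closure (Set.range z) = ⊤) :
    Nat.card {θ : Q →* L // Function.Surjective θ ∧ σ.comp θ = ρ} ≤
      n * Nat.card (genLifts σ ⊤ (σ ∘ z)) := by
  classical
  let K := {D : Subgroup Q // IsLiftKernel ρ σ D}
  have hK : Nat.card K ≤ n := by
    have h := hn (Set.toFinite {D : Subgroup Q | IsLiftKernel ρ σ D}).toFinset (by simp)
    rwa [← Set.ncard_eq_toFinset_card _ (Set.toFinite _), ← Nat.card_coe_set_eq] at h
  choose θ₀ hθ₀ using fun D : K => D.2
  choose q hq using fun (D : K) (i : ι) => (hθ₀ D).1 (z i)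
  have hgen : ∀ (D : K) (x : Q), ∃ y ∈ Subgroup.closure (Set.range (q D)), x * y⁻¹ ∈ D.1 := by
    intro D x
    have h1 : (Subgroup.closure (Set.range (q D))).map (θ₀ D) = ⊤ := by
      rw [MonoidHom.map_closure, ← Set.range_comp, ← hz]
      congr 2
      exact funext (hq D)
    obtain ⟨y, hy, hxy⟩ := (h1 ▸ Subgroup.mem_top (θ₀ D x) :
      θ₀ D x ∈ (Subgroup.closure (Set.range (q D))).map (θ₀ D))
    refine ⟨y, hy, ?_⟩
    rw [← (hθ₀ D).2.2, MonoidHom.mem_ker, map_mul, map_inv, hxy, mul_inv_cancel]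
  let kern : {θ : Q →* L // Function.Surjective θ ∧ σ.comp θ = ρ} → K :=
    fun θ => ⟨θ.1.ker, θ.1, θ.2.1, θ.2.2, rfl⟩
  let Ψ : {θ : Q →* L // Function.Surjective θ ∧ σ.comp θ = ρ} →
      K × genLifts σ ⊤ (σ ∘ z) := fun θ => (kern θ, ⟨θ.1 ∘ q (kern θ), by
    refine ⟨fun i => ?_, ?_⟩
    · have h1 := DFunLike.congr_fun θ.2.2 (q (kern θ) i)
      have h2 := DFunLike.congr_fun (hθ₀ (kern θ)).2.1 (q (kern θ) i)
      simp only [MonoidHom.comp_apply] at h1 h2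
      simp only [Function.comp_apply]
      rw [h1, ← h2, hq]
    · rw [Set.range_comp, ← MonoidHom.map_closure, eq_top_iff]
      intro l _
      obtain ⟨x, rfl⟩ := θ.2.1 l
      obtain ⟨y, hy, hxy⟩ := hgen (kern θ) x
      refine ⟨y, hy, ?_⟩
      have : θ.1 (x * y⁻¹) = 1 := hxy
      rw [map_mul, map_inv, mul_inv_eq_one] at this
      exact this.symm⟩)
  have hΨ : Function.Injective Ψ := by
    intro θ τ h
    have h1 : kern θ = kern τ := congrArg Prod.fst h
    have h2 : θ.1 ∘ q (kern θ) = τ.1 ∘ q (kern τ) := congrArg (fun a => a.2.1) h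
    rw [← h1] at h2
    have hle : Subgroup.closure (Set.range (q (kern θ))) ≤ MonoidHom.eqLocus θ.1 τ.1 := by
      rw [Subgroup.closure_le]
      rintro _ ⟨i, rfl⟩
      exact congrFun h2 i
    apply Subtype.ext
    ext x
    obtain ⟨y, hy, hxy⟩ := hgen (kern θ) x
    have e1 : θ.1 (x * y⁻¹) = 1 := hxy
    have e2 : τ.1 (x * y⁻¹) = 1 := by
      rw [h1] at hxy
      exact hxy
    have e3 : θ.1 y = τ.1 y := hle hy
    rw [map_mul, map_inv, mul_inv_eq_one] at e1 e2
    rw [e1, e2, e3]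
  have : Finite K := Subtype.finite
  calc _ ≤ Nat.card (K × genLifts σ ⊤ (σ ∘ z)) := Nat.card_le_card_of_injective Ψ hΨ
    _ = Nat.card K * Nat.card (genLifts σ ⊤ (σ ∘ z)) := Nat.card_prod _ _
    _ ≤ _ := Nat.mul_le_mul_right _ hK

theorem card_genLifts_mul_le {L Y : Type*} [Group L] [Group Y] [Finite L] (σ : L →* Y) {s r : ℕ}
    (w : Fin s → Y) :
    Nat.card (genLifts σ ⊤ w) * Nat.card σ.ker ^ r ≤
      Nat.card (genLifts σ ⊤ (Fin.append w (fun _ : Fin r => 1))) := by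
  have : Nat.card (genLifts σ ⊤ w) * Nat.card σ.ker ^ r =
      Nat.card (genLifts σ ⊤ w × (Fin r → σ.ker)) := by
    rw [Nat.card_prod, Nat.card_fun, Nat.card_fin]
  rw [this]
  refine Nat.card_le_card_of_injective
    (fun x => ⟨Fin.append x.1.1 (fun i => (x.2 i : L)), fun i => ?_, ?_⟩) fun x y h => ?_
  · refine Fin.addCases (fun i => ?_) (fun i => ?_) i
    · simp [x.1.2.1 i]
    · rw [Fin.append_right, Fin.append_right]
      exact (x.2 i).2
  · rw [eq_top_iff]
    refine x.1.2.2.ge.trans (Subgroup.closure_mono ?_)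
    rintro _ ⟨i, rfl⟩
    exact ⟨Fin.castAdd r i, by simp⟩
  · have h := congrArg Subtype.val h
    simp only at h
    refine Prod.ext (Subtype.ext (funext fun i => ?_)) (funext fun i => Subtype.ext ?_)
    · simpa using congrFun h (Fin.castAdd r i)
    · simpa using congrFun h (Fin.natAdd s i)

/-- A counting criterion for lifting generators along the projection of a fibre product
`X = Q ×_Y L`. -/
theorem GenBy.of_fiberProduct {X Q L Y : Type*} [Group X] [Group Q] [Group L] [Group Y] [Finite X]
    [Finite Q] [Finite L] (π : X →* Q) (κ : X →* L) (ρ : Q →* Y) (σ : L →* Y)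
    (hσ : Function.Surjective σ)
    (hρ : Function.Surjective ρ) (hcomm : ρ.comp π = σ.comp κ)
    (hfib : ∀ q l, ρ q = σ l → ∃ x, π x = q ∧ κ x = l)
    (hdisj : π.ker ⊓ κ.ker = ⊥)
    (hmin : ∀ K : Subgroup X, K.Normal → K ≤ π.ker → K = ⊥ ∨ K = π.ker)
    {n s t : ℕ} (hn : ∀ S : Finset (Subgroup Q), (∀ D ∈ S, IsLiftKernel ρ σ D) → S.card ≤ n)
    (hL : GenBy L s) (hst : s ≤ t) (hcard : n < Nat.card σ.ker ^ (t - s)) (hQ : GenBy Q t) :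
    GenBy X t := by
  by_contra hX
  obtain ⟨r, rfl⟩ := Nat.exists_eq_add_of_le hst
  rw [Nat.add_sub_cancel_left] at hcard
  obtain ⟨g, hg⟩ := hQ
  obtain ⟨z, hz⟩ := hL
  have key : ∀ y ∈ genLifts σ ⊤ (ρ ∘ g),
      ∃ θ : {θ : Q →* L // Function.Surjective θ ∧ σ.comp θ = ρ}, θ.1 ∘ g = y := by
    rintro y ⟨hy1, hy2⟩
    choose x hx1 hx2 using fun i => hfib (g i) (y i) (hy1 i).symm
    let H := Subgroup.closure (Set.range x)
    have hHtop : H ≠ ⊤ := fun h => hX ⟨x, h⟩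
    have hHπ : H.map π = ⊤ := by
      rw [MonoidHom.map_closure, ← Set.range_comp, ← hg]
      congr 2
      exact funext hx1
    have hHκ : H.map κ = ⊤ := by
      rw [MonoidHom.map_closure, ← Set.range_comp, ← hy2]
      congr 2
      exact funext hx2
    have hNC : ∀ a ∈ π.ker, ∀ c ∈ κ.ker, a * c = c * a := by
      intro a ha c hc
      have : a * c * a⁻¹ * c⁻¹ ∈ π.ker ⊓ κ.ker := by
        constructor
        · have := π.ker.mul_mem ha
            ((inferInstance : π.ker.Normal).conj_mem _ (π.ker.inv_mem ha) c)
          simpa [mul_assoc] using this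
        · exact κ.ker.mul_mem ((inferInstance : κ.ker.Normal).conj_mem _ hc a) (κ.ker.inv_mem hc)
      rw [hdisj, Subgroup.mem_bot, mul_inv_eq_one, mul_inv_eq_iff_eq_mul] at this
      exact this
    have hnor : (H ⊓ π.ker).Normal := by
      constructor
      intro a ha u
      obtain ⟨h, hh, hhu⟩ := (hHκ ▸ Subgroup.mem_top (κ u) : κ u ∈ H.map κ)
      have hc : h⁻¹ * u ∈ κ.ker := by
        rw [MonoidHom.mem_ker, map_mul, map_inv, hhu, inv_mul_cancel]
      have h1 : u * a * u⁻¹ = h * a * h⁻¹ := by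
        calc u * a * u⁻¹ = h * (h⁻¹ * u * a) * u⁻¹ := by group
          _ = h * (a * (h⁻¹ * u)) * u⁻¹ := by rw [hNC a ha.2 _ hc]
          _ = h * a * h⁻¹ := by group
      rw [h1]
      exact ⟨H.mul_mem (H.mul_mem hh ha.1) (H.inv_mem hh),
        (inferInstance : π.ker.Normal).conj_mem a ha.2 h⟩
    have hbot : H ⊓ π.ker = ⊥ := by
      rcases hmin _ hnor inf_le_right with h | h
      · exact h
      · exfalso
        apply hHtop
        have h2 := Subgroup.comap_map_eq π H
        rw [hHπ, Subgroup.comap_top, sup_eq_left.mpr (inf_eq_right.mp h)] at h2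
        exact h2.symm
    let f : H →* Q := π.comp H.subtype
    have hf : Function.Bijective f := by
      constructor
      · rw [injective_iff_map_eq_one]
        intro a ha
        have : (a : X) ∈ H ⊓ π.ker := ⟨a.2, ha⟩
        rw [hbot] at this
        exact Subtype.ext this
      · intro q
        obtain ⟨a, ha, rfl⟩ := (hHπ ▸ Subgroup.mem_top q : q ∈ H.map π)
        exact ⟨⟨a, ha⟩, rfl⟩
    let e := MulEquiv.ofBijective f hf
    have hπe : ∀ q, π (e.symm q) = q := fun q => e.apply_symm_apply q
    have heg : ∀ i, (e.symm (g i) : X) = x i := by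
      intro i
      have : e ⟨x i, Subgroup.subset_closure ⟨i, rfl⟩⟩ = g i := hx1 i
      rw [← this]
      simp
    refine ⟨⟨(κ.comp H.subtype).comp e.symm.toMonoidHom, ?_, ?_⟩, ?_⟩
    · intro l
      obtain ⟨h, hh, rfl⟩ := (hHκ ▸ Subgroup.mem_top l : l ∈ H.map κ)
      exact ⟨e ⟨h, hh⟩, by simp⟩
    · ext q
      have := DFunLike.congr_fun hcomm (e.symm q : X)
      simp only [MonoidHom.comp_apply] at this
      rw [hπe] at this
      exact this.symm
    · funext i
      change κ (e.symm (g i)) = y i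
      rw [heg, hx2]
  have hsurj : Function.Surjective σ := hσ
  choose τ hτ using fun y : genLifts σ ⊤ (ρ ∘ g) => key y.1 y.2
  have hτinj : Function.Injective τ := fun y y' h => Subtype.ext (by rw [← hτ y, h, hτ])
  have : Finite (Q →* L) := Finite.of_injective _ DFunLike.coe_injective
  have h1 := Nat.card_le_card_of_injective τ hτinj
  have h2 := card_surjective_lifts_le ρ σ hn z hz
  have h3 := card_genLifts_mul_le (r := r) σ (σ ∘ z)
  have hgY : Subgroup.closure (Set.range (ρ ∘ g)) = ⊤ := by
    rw [Set.range_comp, ← MonoidHom.map_closure, hg, ← MonoidHom.range_eq_map,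
      MonoidHom.range_eq_top.mpr hρ]
  have hzY : Subgroup.closure (Set.range (Fin.append (σ ∘ z) (fun _ : Fin r => (1 : Y)))) = ⊤ := by
    have h4 : Subgroup.closure (Set.range (σ ∘ z)) = ⊤ := by
      rw [Set.range_comp, ← MonoidHom.map_closure, hz, ← MonoidHom.range_eq_map,
        MonoidHom.range_eq_top.mpr hσ]
    rw [eq_top_iff, ← h4]
    apply Subgroup.closure_mono
    rintro _ ⟨i, rfl⟩
    exact ⟨Fin.castAdd r i, by simp⟩
  have h5 := card_genLifts_eq σ (ρ ∘ g) _ hgY hzY ⊤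
  have hpos : 0 < Nat.card (genLifts σ ⊤ (σ ∘ z)) := by
    have : Nonempty (genLifts σ ⊤ (σ ∘ z)) := ⟨z, fun _ => rfl, hz⟩
    exact Nat.card_pos
  rw [h5] at h1
  have h6 := h3.trans (h1.trans h2)
  rw [mul_comm n] at h6
  exact absurd (Nat.le_of_mul_le_mul_left h6 hpos) (by omega)

/-- A nonabelian minimal normal subgroup is not a `p`-group. -/
theorem not_isPGroup_of_minimal {X : Type*} [Group X] [Finite X] (N : Subgroup X) [N.Normal]
    (hmin : ∀ K : Subgroup X, K.Normal → K ≤ N → K = ⊥ ∨ K = N)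
    (hnc : ∃ a ∈ N, ∃ b ∈ N, a * b ≠ b * a) (p : ℕ) [Fact p.Prime] : ¬ IsPGroup p N := by
  intro hNp
  have hnt : Nontrivial N := by
    obtain ⟨a, ha, b, hb, hab⟩ := hnc
    refine ⟨⟨⟨a, ha⟩, 1, fun h => hab ?_⟩⟩
    have : a = 1 := congrArg Subtype.val h
    simp [this]
  have hc := hNp.center_nontrivial
  have hnor : ((Subgroup.center N).map N.subtype).Normal := inferInstance
  rcases hmin _ hnor (Subgroup.map_subtype_le _) with h | h
  · rw [Subgroup.map_eq_bot_iff_of_injective _ N.subtype_injective] at h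
    exact (Subgroup.nontrivial_iff_ne_bot _).mp hc h
  · obtain ⟨a, ha, b, hb, hab⟩ := hnc
    obtain ⟨c, hc, rfl⟩ := h ▸ ha
    have h2 := Subgroup.mem_center_iff.mp hc ⟨b, hb⟩
    exact hab (congrArg Subtype.val h2).symm

/-- A nonabelian minimal normal subgroup has order divisible by an odd prime. -/
theorem exists_odd_prime_dvd_card {X : Type*} [Group X] [Finite X] (N : Subgroup X) [N.Normal]
    (hmin : ∀ K : Subgroup X, K.Normal → K ≤ N → K = ⊥ ∨ K = N)
    (hnc : ∃ a ∈ N, ∃ b ∈ N, a * b ≠ b * a) :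
    ∃ p : ℕ, p.Prime ∧ p ≠ 2 ∧ p ∣ Nat.card N := by
  by_contra! hall
  have hpow : Nat.card N = 2 ^ (Nat.card N).primeFactorsList.length :=
    Nat.eq_prime_pow_of_unique_prime_dvd Nat.card_pos.ne' fun {d} hd hdvd => by
      by_contra h
      exact hall d hd h hdvd
  exact not_isPGroup_of_minimal N hmin hnc 2 (IsPGroup.of_card hpow)

theorem index_eq_relIndex_of_sup_eq_top {X : Type*} [Group X] [Finite X] (M N : Subgroup X)
    [N.Normal] (h : M ⊔ N = ⊤) : M.index = M.relIndex N := by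
  have h1 := Subgroup.relIndex_mul_index (inf_le_left : M ⊓ N ≤ M)
  have h2 := Subgroup.relIndex_mul_index (inf_le_right : M ⊓ N ≤ N)
  have h3 : N.relIndex M = N.index := by
    rw [← Subgroup.relIndex_sup_right, h, Subgroup.relIndex_top_right]
  rw [Subgroup.inf_relIndex_left, h3] at h1
  rw [Subgroup.inf_relIndex_right, ← h1, mul_comm] at h2
  exact (Nat.eq_of_mul_eq_mul_left (Nat.pos_of_ne_zero Subgroup.index_ne_zero_of_finite) h2).symm

/-- Lifting generators along a nonabelian minimal normal subgroup that has a supplement of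
small index. -/
theorem GenBy.of_quotient_nonabelian {X : Type*} [Group X] [Finite X] (N : Subgroup X) [N.Normal]
    (hmin : ∀ K : Subgroup X, K.Normal → K ≤ N → K = ⊥ ∨ K = N)
    (hnc : ∃ a ∈ N, ∃ b ∈ N, a * b ≠ b * a) (M : Subgroup X) (hM : M ≠ ⊤) (hMN : M ⊔ N = ⊤)
    (hCM : Subgroup.centralizer (N : Set X) ≤ M) {n t : ℕ} (hnt : n + 1 ≤ t) (hMt : M.index ≤ t)
    (B : Subgroup X) (hB : B.Normal) (hBcomm : ∀ x ∈ B, ∀ y ∈ B, x * y = y * x)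
    (hBn : ∀ p : ℕ, p.Prime → p ≠ 2 → ∀ k, p ^ k ∣ B.index → k ≤ n)
    (hQ : GenBy (X ⧸ N) t) : GenBy X t := by
  classical
  set C := Subgroup.centralizer (N : Set X) with hC
  have hCnor : C.Normal := Subgroup.normal_centralizer
  have hNC : N ⊓ C = ⊥ := by
    rcases hmin (N ⊓ C) inferInstance inf_le_left with h | h
    · exact h
    · obtain ⟨a, ha, b, hb, hab⟩ := hnc
      have hbC : b ∈ C := inf_eq_left.mp h hb
      exact absurd (Subgroup.mem_centralizer_iff.mp hbC a ha) hab
  let κ := QuotientGroup.mk' C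
  let π := QuotientGroup.mk' N
  let ρ : X ⧸ N →* X ⧸ (N ⊔ C) := QuotientGroup.map N (N ⊔ C) (MonoidHom.id X) le_sup_left
  let σ : X ⧸ C →* X ⧸ (N ⊔ C) := QuotientGroup.map C (N ⊔ C) (MonoidHom.id X) le_sup_right
  have hκ : Function.Surjective κ := QuotientGroup.mk'_surjective C
  have hπ : Function.Surjective π := QuotientGroup.mk'_surjective N
  have hρ : Function.Surjective ρ := fun y => by
    obtain ⟨x, rfl⟩ := QuotientGroup.mk_surjective y
    exact ⟨π x, rfl⟩
  have hσ : Function.Surjective σ := fun y => by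
    obtain ⟨x, rfl⟩ := QuotientGroup.mk_surjective y
    exact ⟨κ x, rfl⟩
  have hσker : σ.ker = N.map κ := by
    ext l
    obtain ⟨x, rfl⟩ := hκ l
    have h1 : κ x ∈ σ.ker ↔ x ∈ N ⊔ C := QuotientGroup.eq_one_iff x
    rw [h1, ← Subgroup.mem_comap, Subgroup.comap_map_eq, QuotientGroup.ker_mk']
  have hσcard : Nat.card σ.ker = Nat.card N := by
    rw [hσker, ← Subgroup.relIndex_ker, QuotientGroup.ker_mk', ← Subgroup.inf_relIndex_right,
      inf_comm, hNC, Subgroup.relIndex_bot_left]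
  have hminσ : ∀ K : Subgroup (X ⧸ C), K.Normal → K ≤ σ.ker → K = ⊥ ∨ K = σ.ker := by
    intro K hK hKσ
    rcases hmin (K.comap κ ⊓ N) inferInstance inf_le_right with h | h
    · left
      rw [eq_bot_iff]
      intro l hl
      obtain ⟨a, ha, rfl⟩ := hσker ▸ hKσ hl
      have : a ∈ K.comap κ ⊓ N := ⟨hl, ha⟩
      rw [h, Subgroup.mem_bot] at this
      simp [this]
    · right
      refine le_antisymm hKσ ?_
      rw [hσker, Subgroup.map_le_iff_le_comap]
      exact inf_eq_right.mp h
  have hncσ : ∃ a ∈ σ.ker, ∃ b ∈ σ.ker, a * b ≠ b * a := by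
    obtain ⟨a, ha, b, hb, hab⟩ := hnc
    rw [hσker]
    refine ⟨κ a, Subgroup.mem_map_of_mem κ ha, κ b, Subgroup.mem_map_of_mem κ hb, fun h => hab ?_⟩
    have h1 : a * b * a⁻¹ * b⁻¹ ∈ N ⊓ C := by
      constructor
      · exact N.mul_mem (N.mul_mem (N.mul_mem ha hb) (N.inv_mem ha)) (N.inv_mem hb)
      · refine (QuotientGroup.eq_one_iff _).mp ?_
        change κ (a * b * a⁻¹ * b⁻¹) = 1
        rw [map_mul, map_mul, map_mul, h, map_inv, map_inv]
        group
    rw [hNC, Subgroup.mem_bot, mul_inv_eq_one, mul_inv_eq_iff_eq_mul] at h1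
    exact h1
  have hcentσ : ∀ l : X ⧸ C, (∀ a ∈ σ.ker, l * a = a * l) → l = 1 := by
    intro l hl
    obtain ⟨x, rfl⟩ := hκ l
    refine (QuotientGroup.eq_one_iff x).mpr (Subgroup.mem_centralizer_iff.mpr fun a ha => ?_)
    have h := hl (κ a) (hσker ▸ Subgroup.mem_map_of_mem κ ha)
    have h1 : x * a * x⁻¹ * a⁻¹ ∈ N ⊓ C := by
      constructor
      · exact N.mul_mem (‹N.Normal›.conj_mem a ha x) (N.inv_mem ha)
      · refine (QuotientGroup.eq_one_iff _).mp ?_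
        change κ (x * a * x⁻¹ * a⁻¹) = 1
        rw [map_mul, map_mul, map_mul, h, map_inv, map_inv]
        group
    rw [hNC, Subgroup.mem_bot, mul_inv_eq_one, mul_inv_eq_iff_eq_mul] at h1
    exact h1.symm
  have hfib : ∀ q l, ρ q = σ l → ∃ x, π x = q ∧ κ x = l := by
    intro q l h
    obtain ⟨x, rfl⟩ := hπ q
    obtain ⟨y, rfl⟩ := hκ l
    have h1 : x⁻¹ * y ∈ N ⊔ C := QuotientGroup.eq.mp h
    obtain ⟨a, ha, c, hc, hac⟩ := Subgroup.mem_sup_of_normal_right.mp h1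
    refine ⟨x * a, ?_, ?_⟩
    · rw [map_mul, (QuotientGroup.eq_one_iff a).mpr ha |> (show π a = 1 from ·), mul_one]
    · have h2 : x * a = y * c⁻¹ := by
        rw [eq_mul_inv_iff_mul_eq, mul_assoc, hac, mul_inv_cancel_left]
      rw [h2, map_mul, map_inv, (QuotientGroup.eq_one_iff c).mpr hc |> (show κ c = 1 from ·),
        inv_one, mul_one]
  have hcore : M.normalCore ≤ C := by
    have h1 : N ⊓ M.normalCore = ⊥ := by
      rcases hmin (N ⊓ M.normalCore) inferInstance inf_le_left with h | h
      · exact h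
      · exfalso
        apply hM
        rw [← hMN, eq_comm, sup_eq_left]
        exact (inf_eq_left.mp h).trans M.normalCore_le
    intro x hx
    refine Subgroup.mem_centralizer_iff.mpr fun a ha => ?_
    have h2 : x * a * x⁻¹ * a⁻¹ ∈ N ⊓ M.normalCore := by
      constructor
      · exact N.mul_mem (‹N.Normal›.conj_mem a ha x) (N.inv_mem ha)
      · have := M.normalCore.mul_mem hx
          (M.normalCore_normal.conj_mem _ (M.normalCore.inv_mem hx) a)
        simpa [mul_assoc] using this
    rw [h1, Subgroup.mem_bot, mul_inv_eq_one, mul_inv_eq_iff_eq_mul] at h2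
    exact h2.symm
  have hkerκ : κ.ker = C := QuotientGroup.ker_mk' C
  have hkerπ : π.ker = N := QuotientGroup.ker_mk' N
  have hL : GenBy (X ⧸ C) (M.index - 1) := by
    have h1 : (M.map κ).index = M.index := Subgroup.index_map_eq M hκ (by rw [hkerκ]; exact hCM)
    rw [← h1]
    apply genBy_index_sub_one
    rw [eq_bot_iff]
    intro l hl
    obtain ⟨x, rfl⟩ := hκ l
    have hnor : ((M.map κ).normalCore.comap κ).Normal := inferInstance
    have hle : (M.map κ).normalCore.comap κ ≤ M := by
      refine (Subgroup.comap_mono (Subgroup.normalCore_le _)).trans ?_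
      rw [Subgroup.comap_map_eq, hkerκ]
      exact sup_le le_rfl hCM
    have h2 : x ∈ M.normalCore := Subgroup.normal_le_normalCore.mpr hle hl
    exact (QuotientGroup.eq_one_iff x).mpr (hcore h2)
  obtain ⟨p, hp, hp2, hpN⟩ := exists_odd_prime_dvd_card N hmin hnc
  have hidx : M.index ≠ 0 := Subgroup.index_ne_zero_of_finite
  have hidx1 : M.index ≠ 1 := fun h => hM (Subgroup.index_eq_one.mp h)
  have hle : M.index ≤ Nat.card N := by
    rw [index_eq_relIndex_of_sup_eq_top M N hMN]
    exact Nat.le_of_dvd Nat.card_pos (Subgroup.relIndex_dvd_card M N)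
  refine GenBy.of_fiberProduct π κ ρ σ hσ hρ rfl hfib (by rw [hkerκ, hkerπ, hNC])
    (by rw [hkerπ]; exact hmin) (n := n) (s := M.index - 1) (fun S hS => ?_) hL (by omega) ?_ hQ
  · refine card_liftKernels_le hminσ hncσ hcentσ (B.map π) (hB.map π hπ) ?_
      (hσcard ▸ hpN) (fun k hk => hBn p hp hp2 k (hk.trans (Subgroup.index_map_dvd B hπ))) S hS
    rintro _ ⟨x, hx, rfl⟩ _ ⟨y, hy, rfl⟩
    rw [← map_mul, hBcomm x hx y hy, map_mul]
  · rw [hσcard]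
    obtain ⟨m, hm⟩ : ∃ m, M.index = m + 2 := ⟨M.index - 2, by omega⟩
    obtain ⟨r, hr⟩ : ∃ r, t = m + 2 + r := ⟨t - (m + 2), by omega⟩
    have e : t - (M.index - 1) = r + 1 := by omega
    rw [e]
    have h1 : 1 + (r + 1) * (m + 1) ≤ (1 + (m + 1)) ^ (r + 1) := by
      have := one_add_mul_le_pow_of_sq_nonneg (a := m + 1) (Nat.zero_le _) (Nat.zero_le _)
        (Nat.zero_le _) (r + 1)
      simpa using this
    have h2 : (1 + (m + 1)) ^ (r + 1) ≤ Nat.card N ^ (r + 1) :=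
      Nat.pow_le_pow_left (by omega) _
    have h3 : 1 + (r + 1) * (m + 1) = r * m + (m + 2 + r) := by ring
    have h4 : 0 ≤ r * m := Nat.zero_le _
    omega

/-- A nonabelian minimal normal subgroup has a proper supplement of odd index which contains
its centralizer. -/
theorem exists_supplement_odd_index {X : Type*} [Group X] [Finite X] (N : Subgroup X) [N.Normal]
    (hmin : ∀ K : Subgroup X, K.Normal → K ≤ N → K = ⊥ ∨ K = N)
    (hnc : ∃ a ∈ N, ∃ b ∈ N, a * b ≠ b * a) :
    ∃ M : Subgroup X, IsCoatom M ∧ M ⊔ N = ⊤ ∧ Subgroup.centralizer (N : Set X) ≤ M ∧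
      Odd M.index := by
  obtain ⟨q, hq, hqN, hodd⟩ : ∃ q : ℕ, q.Prime ∧ q ∣ Nat.card N ∧ (q ≠ 2 → Odd (Nat.card N)) := by
    by_cases h2 : 2 ∣ Nat.card N
    · exact ⟨2, Nat.prime_two, h2, fun h => absurd rfl h⟩
    · obtain ⟨q, hq, -, hqN⟩ := exists_odd_prime_dvd_card N hmin hnc
      exact ⟨q, hq, hqN, fun _ => Nat.not_even_iff_odd.mp fun h => h2 h.two_dvd⟩
  have : Fact q.Prime := ⟨hq⟩
  obtain ⟨T⟩ : Nonempty (Sylow q N) := inferInstance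
  set T' : Subgroup X := (T : Subgroup N).map N.subtype with hT'
  have hT'N : T' ≤ N := Subgroup.map_subtype_le _
  have hfr : Subgroup.normalizer (T' : Set X) ⊔ N = ⊤ := Sylow.normalizer_sup_eq_top T
  have hcen : Subgroup.centralizer (N : Set X) ≤ Subgroup.normalizer (T' : Set X) :=
    (Subgroup.centralizer_le hT'N).trans (Subgroup.centralizer_le_normalizer _)
  have hne : Subgroup.normalizer (T' : Set X) ≠ ⊤ := by
    intro h
    have hnor : T'.Normal := Subgroup.normalizer_eq_top_iff.mp h
    rcases hmin T' hnor hT'N with h | h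
    · rw [hT', Subgroup.map_eq_bot_iff_of_injective _ N.subtype_injective] at h
      have h1 := T.not_dvd_index
      rw [h, Subgroup.index_bot] at h1
      exact h1 hqN
    · have hP : IsPGroup q T' := T.isPGroup'.map _
      exact not_isPGroup_of_minimal N hmin hnc q (h ▸ hP)
  obtain ⟨M, hM, hle⟩ := (eq_top_or_exists_le_coatom _).resolve_left hne
  have hMN : M ⊔ N = ⊤ := top_le_iff.mp (hfr.symm.le.trans (sup_le_sup_right hle N))
  refine ⟨M, hM, hMN, hcen.trans hle, ?_⟩
  rw [index_eq_relIndex_of_sup_eq_top M N hMN]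
  have hTM : (T : Subgroup N) ≤ M.subgroupOf N := by
    rw [← Subgroup.map_subtype_le_map_subtype (G' := N)]
    rw [Subgroup.subgroupOf_map_subtype]
    exact le_inf (Subgroup.le_normalizer.trans hle) hT'N
  by_cases hq2 : q = 2
  · subst hq2
    have h1 := T.not_dvd_index
    have h2 : M.relIndex N ∣ (T : Subgroup N).index := Subgroup.index_dvd_of_le hTM
    exact Nat.not_even_iff_odd.mp fun h => h1 (h.two_dvd.trans h2)
  · exact (hodd hq2).of_dvd_nat (Subgroup.relIndex_dvd_card M N)

/-- Every `p`-subgroup of a quotient of a finite group is a quotient of a `p`-subgroup. -/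
theorem GenBy.of_isPGroup_of_surjective {Y X : Type*} [Group Y] [Group X] [Finite Y]
    (f : Y →* X) (hf : Function.Surjective f) {n : ℕ}
    (hS : ∀ p : ℕ, p.Prime → ∀ S : Subgroup Y, IsPGroup p S → GenBy S n)
    (p : ℕ) (hp : p.Prime) (R : Subgroup X) (hR : IsPGroup p R) : GenBy R n := by
  have : Fact p.Prime := ⟨hp⟩
  let g : R.comap f →* R := f.subgroupComap R
  have hg : Function.Surjective g := fun r => by
    obtain ⟨y, hy⟩ := hf r
    exact ⟨⟨y, by simp [hy]⟩, Subtype.ext hy⟩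
  obtain ⟨P⟩ : Nonempty (Sylow p (R.comap f)) := inferInstance
  have htop : (P : Subgroup (R.comap f)).map g = ⊤ := by
    rw [← Sylow.coe_mapSurjective hg P]
    exact ((Sylow.mapSurjective hg P).is_maximal'
      (hR.of_equiv (Subgroup.topEquiv (G := R)).symm) le_top).symm
  have hP := hS p hp _ (P.isPGroup'.map (R.comap f).subtype)
  have hP' : GenBy (P : Subgroup (R.comap f)) n :=
    hP.map ((P : Subgroup (R.comap f)).equivMapOfInjective _
      (R.comap f).subtype_injective).symm.toMonoidHom (MulEquiv.surjective _)
  refine hP'.map (g.comp (P : Subgroup (R.comap f)).subtype) fun r => ?_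
  obtain ⟨x, hx, hxr⟩ := htop.symm.le (Subgroup.mem_top r)
  exact ⟨⟨x, hx⟩, hxr⟩

open Nat in
theorem genBy_of_surjective {E : Type*} [Group E] [Finite E] (B : Subgroup E) [B.Normal]
    (hBcomm : ∀ x ∈ B, ∀ y ∈ B, x * y = y * x) {n : ℕ}
    (hS : ∀ p : ℕ, p.Prime → ∀ S : Subgroup E, IsPGroup p S → GenBy S n)
    (hBn : ∀ p : ℕ, p.Prime → p ≠ 2 → ∀ k, p ^ k ∣ B.index → k ≤ n)
    (Y : Subgroup E) (hBY : B ≤ Y) {t : ℕ} (hnt : n + 1 ≤ t)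
    (hodd : ∀ d, Odd d → d ∣ B.relIndex Y → d * (n + 1)! < (t + 1)!)
    {X : Type*} [Group X] [Finite X] (f : Y →* X) (hf : Function.Surjective f) : GenBy X t := by
  induction hk : Nat.card Y + Nat.card X using Nat.strong_induction_on generalizing Y t X with
  | _ k ih =>
  subst hk
  rcases subsingleton_or_nontrivial X with hX | hX
  · exact genBy_of_subsingleton t
  obtain ⟨N, hNnor, hN, hmin⟩ : ∃ N : Subgroup X, N.Normal ∧ N ≠ ⊥ ∧
      ∀ K : Subgroup X, K.Normal → K ≤ N → K = ⊥ ∨ K = N := by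
    obtain ⟨N, hN, hmin⟩ := (Set.toFinite {N : Subgroup X | N.Normal ∧ N ≠ ⊥}).exists_minimal
      ⟨⊤, inferInstance, top_ne_bot⟩
    refine ⟨N, hN.1, hN.2, fun K hK hle => ?_⟩
    by_cases hK' : K = ⊥
    · exact Or.inl hK'
    · exact Or.inr (le_antisymm hle (hmin ⟨hK, hK'⟩ hle))
  have hQlt : Nat.card (X ⧸ N) < Nat.card X := by
    rw [Subgroup.card_eq_card_quotient_mul_card_subgroup N]
    have : 1 < Nat.card N := (Subgroup.one_lt_card_iff_ne_bot N).mpr hN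
    exact lt_mul_of_one_lt_right Nat.card_pos this
  have hQ : GenBy (X ⧸ N) t :=
    ih _ (Nat.add_lt_add_left hQlt _) Y hBY hnt hodd ((QuotientGroup.mk' N).comp f)
      ((QuotientGroup.mk'_surjective N).comp hf) rfl
  by_cases hcomm : ∀ a ∈ N, ∀ b ∈ N, a * b = b * a
  · refine GenBy.of_quotient_abelian N hmin hN hcomm
      (GenBy.of_isPGroup_of_surjective f hf fun p hp S hSp => ?_) hnt hQ
    exact (hS p hp _ (hSp.map Y.subtype)).map
      (S.equivMapOfInjective _ Y.subtype_injective).symm.toMonoidHom (MulEquiv.surjective _)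
  push Not at hcomm
  obtain ⟨M, hM, hMN, hCM, hMo⟩ := exists_supplement_odd_index N hmin hcomm
  set B' : Subgroup X := (B.subgroupOf Y).map f with hB'
  have hB'nor : B'.Normal := Subgroup.Normal.map inferInstance f hf
  have hB'comm : ∀ x ∈ B', ∀ y ∈ B', x * y = y * x := by
    rintro _ ⟨x, hx, rfl⟩ _ ⟨y, hy, rfl⟩
    rw [← map_mul, ← map_mul]
    exact congrArg f (Subtype.ext (hBcomm _ hx _ hy))
  by_cases hMt : M.index ≤ t
  · refine GenBy.of_quotient_nonabelian N hmin hcomm M hM.1 hMN hCM hnt hMt B' hB'nor hB'comm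
      (fun p hp hp2 k hk => hBn p hp hp2 k ?_) hQ
    exact (hk.trans (Subgroup.index_map_dvd _ hf)).trans (Subgroup.relIndex_dvd_index_of_normal B Y)
  have hB'N : B' ≤ M := by
    refine le_trans (fun b hb => ?_) hCM
    have hbot : N ⊓ B' = ⊥ := by
      rcases hmin (N ⊓ B') inferInstance inf_le_left with h | h
      · exact h
      · obtain ⟨a, ha, b, hb, hab⟩ := hcomm
        exact absurd (hB'comm a (inf_eq_left.mp h ha) b (inf_eq_left.mp h hb)) hab
    refine Subgroup.mem_centralizer_iff.mpr fun a ha => ?_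
    exact (Subgroup.commute_of_normal_of_disjoint N B' hNnor hB'nor
      (disjoint_iff.mpr hbot) a b ha hb)
  set Z : Subgroup E := (M.comap f).map Y.subtype with hZ
  have hZY : Z ≤ Y := Subgroup.map_subtype_le _
  have hBZ : B ≤ Z := fun b hb =>
    ⟨⟨b, hBY hb⟩, hB'N ⟨_, hb, rfl⟩, rfl⟩
  have hZidx : Z.relIndex Y = M.index := by
    rw [hZ, Subgroup.relIndex, Subgroup.subgroupOf, Subgroup.comap_map_eq_self_of_injective
      Y.subtype_injective, Subgroup.index_comap_of_surjective _ hf]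
  have hmul : B.relIndex Z * M.index = B.relIndex Y := by
    rw [← hZidx]; exact Subgroup.relIndex_mul_relIndex B Z Y hBZ hZY
  have hlarge : ∀ d, Odd d → d ∣ B.relIndex Z → d * M.index * (n + 1)! < (t + 1)! := fun d hd hdvd =>
    hodd _ (hd.mul hMo) (hmul ▸ mul_dvd_mul_right hdvd _)
  obtain ⟨s, rfl⟩ : ∃ s, t = s + 1 := ⟨t - 1, by omega⟩
  have hns : n + 1 ≤ s := by
    by_contra hcon
    obtain rfl : s = n := by omega
    have := hlarge 1 odd_one (one_dvd _)
    rw [one_mul, Nat.factorial_succ (s + 1)] at this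
    have := Nat.lt_of_mul_lt_mul_right this
    omega
  let e : M.comap f ≃* Z := (M.comap f).equivMapOfInjective _ Y.subtype_injective
  let g : Z →* M := (f.subgroupComap M).comp e.symm.toMonoidHom
  have hg : Function.Surjective g := fun r => by
    obtain ⟨y, hy⟩ := hf r
    refine ⟨e ⟨y, by simp [hy]⟩, ?_⟩
    simpa [g] using Subtype.ext hy
  have hMlt : Nat.card M < Nat.card X := by
    rw [← M.card_mul_index]
    exact lt_mul_of_one_lt_right Nat.card_pos (by omega)
  have hZle : Nat.card Z ≤ Nat.card Y := Subgroup.card_le_of_le hZY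
  have hgen : GenBy M s := by
    refine ih _ (by omega) Z hBZ hns (fun d hd hdvd => ?_) g hg rfl
    have h1 := hlarge d hd hdvd
    rw [Nat.factorial_succ (s + 1)] at h1
    have h2 : (s + 1 + 1) * (d * (n + 1)!) ≤ d * M.index * (n + 1)! := by
      have : s + 1 + 1 ≤ M.index := by omega
      calc (s + 1 + 1) * (d * (n + 1)!) ≤ M.index * (d * (n + 1)!) := Nat.mul_le_mul_right _ this
        _ = _ := by ring
    exact Nat.lt_of_mul_lt_mul_left (h2.trans_lt h1)
  obtain ⟨y, hy⟩ : ∃ y, y ∉ M := by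
    by_contra! h
    exact hM.1 ((Subgroup.eq_top_iff' M).mpr h)
  refine hgen.sup (fun _ : Fin 1 => y) ?_
  refine hM.2 _ (lt_of_le_of_ne le_sup_left fun h => hy ?_)
  rw [h]
  exact (le_sup_right : _ ≤ M ⊔ _) (Subgroup.subset_closure ⟨0, rfl⟩)

section PowClosure

variable {Γ : Type*} [Group Γ]

/-- The subgroup generated by the `p`-th powers of the elements of `L`. -/
def powClosure (p : ℕ) (L : Subgroup Γ) : Subgroup Γ :=
  Subgroup.closure ((fun x => x ^ p) '' (L : Set Γ))

theorem pow_mem_powClosure (p : ℕ) {L : Subgroup Γ} {x : Γ} (hx : x ∈ L) :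
    x ^ p ∈ powClosure p L :=
  Subgroup.subset_closure ⟨x, hx, rfl⟩

theorem powClosure_le (p : ℕ) (L : Subgroup Γ) : powClosure p L ≤ L := by
  rw [powClosure, Subgroup.closure_le]
  rintro _ ⟨x, hx, rfl⟩
  exact L.pow_mem hx p

theorem map_powClosure (p : ℕ) (L : Subgroup Γ) {Γ' : Type*} [Group Γ'] (f : Γ →* Γ') :
    (powClosure p L).map f = powClosure p (L.map f) := by
  rw [powClosure, powClosure, MonoidHom.map_closure, Set.image_image, Subgroup.coe_map,
    Set.image_image]
  simp only [map_pow]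

theorem exists_pow_eq_of_mem_powClosure {p : ℕ} {L : Subgroup Γ}
    (hL : ∀ x ∈ L, ∀ y ∈ L, x * y = y * x) {x : Γ} (hx : x ∈ powClosure p L) :
    ∃ y ∈ L, y ^ p = x := by
  induction hx using Subgroup.closure_induction with
  | mem x h => obtain ⟨y, hy, rfl⟩ := h; exact ⟨y, hy, rfl⟩
  | one => exact ⟨1, L.one_mem, one_pow p⟩
  | mul x y _ _ hx hy =>
    obtain ⟨a, ha, rfl⟩ := hx
    obtain ⟨b, hb, rfl⟩ := hy
    exact ⟨a * b, L.mul_mem ha hb, (show Commute a b from hL a ha b hb).mul_pow p⟩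
  | inv x _ hx =>
    obtain ⟨a, ha, rfl⟩ := hx
    exact ⟨a⁻¹, L.inv_mem ha, inv_pow a p⟩

theorem relIndex_map_dvd {Γ' : Type*} [Group Γ'] (f : Γ →* Γ') (H K : Subgroup Γ) :
    (H.map f).relIndex (K.map f) ∣ H.relIndex K := by
  have h1 : ((H.subgroupOf K).map (f.subgroupMap K)).index ∣ (H.subgroupOf K).index :=
    Subgroup.index_map_dvd _ (f.subgroupMap_surjective K)
  refine dvd_trans (Subgroup.index_dvd_of_le ?_) h1
  rintro _ ⟨x, hx, rfl⟩
  exact ⟨x, hx, rfl⟩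

/-- In a torsion-free abelian group, the index of the `p`-th powers does not change when passing
to a subgroup of finite index. -/
theorem relIndex_powClosure_eq {p : ℕ} (hp : 0 < p) {H L : Subgroup Γ} (hHL : H ≤ L)
    (hL : ∀ x ∈ L, ∀ y ∈ L, x * y = y * x) (htf : ∀ x ∈ L, IsOfFinOrder x → x = 1)
    (hfin : H.relIndex L ≠ 0) :
    (powClosure p L).relIndex L = (powClosure p H).relIndex H := by
  let _ : CommGroup L := { mul_comm := fun a b => Subtype.ext (hL a a.2 b b.2) }
  let ψ : L →* Γ := L.subtype.comp (powMonoidHom p)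
  have hψ : Function.Injective ψ := by
    refine (injective_iff_map_eq_one ψ).mpr fun a ha => Subtype.ext (htf a a.2 ?_)
    exact isOfFinOrder_iff_pow_eq_one.mpr ⟨p, hp, ha⟩
  have h1 : ∀ J : Subgroup Γ, J ≤ L → powClosure p J = (J.subgroupOf L).map ψ := fun J hJ => by
    ext x
    constructor
    · intro hx
      obtain ⟨y, hy, rfl⟩ := exists_pow_eq_of_mem_powClosure
        (fun x hx y hy => hL x (hJ hx) y (hJ hy)) hx
      exact ⟨⟨y, hJ hy⟩, hy, rfl⟩
    · rintro ⟨y, hy, rfl⟩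
      exact pow_mem_powClosure p (L := J) hy
  have h2 : (powClosure p H).relIndex (powClosure p L) = H.relIndex L := by
    rw [h1 H hHL, h1 L le_rfl, Subgroup.relIndex_map_map_of_injective _ _ hψ,
      Subgroup.subgroupOf_self, Subgroup.relIndex_top_right]
    rfl
  have h3 := Subgroup.relIndex_mul_relIndex (powClosure p H) (powClosure p L) L
    (by rw [h1 H hHL, h1 L le_rfl]; exact Subgroup.map_mono (Subgroup.comap_mono hHL))
    (powClosure_le p L)
  have h4 := Subgroup.relIndex_mul_relIndex (powClosure p H) H L (powClosure_le p H) hHL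
  rw [h2, ← h4, mul_comm] at h3
  exact Nat.eq_of_mul_eq_mul_right (Nat.pos_of_ne_zero hfin) h3

end PowClosure

/-- `HasElementaryBound p Γ q` says that modulo a torsion subgroup the elementary abelian
`p`-quotients of `Γ` have order at most `q`. -/
def HasElementaryBound (p : ℕ) (Γ : Type*) [Group Γ] (q : ℕ) : Prop :=
  ∃ A : Subgroup Γ, (∀ a ∈ A, IsOfFinOrder a) ∧ ∀ Φ : Subgroup Γ, Φ.Normal → A ≤ Φ →
    (∀ x y, x * y * x⁻¹ * y⁻¹ ∈ Φ) → (∀ x, x ^ p ∈ Φ) → Φ.index ≤ q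

theorem HasElementaryBound.of_quotient {p : ℕ} {Γ : Type*} [Group Γ] {q : ℕ} (T : Subgroup Γ)
    [T.Normal] (hT : ∀ a ∈ T, IsOfFinOrder a) (h : HasElementaryBound p (Γ ⧸ T) q) :
    HasElementaryBound p Γ q := by
  obtain ⟨A, hA, hb⟩ := h
  let f := QuotientGroup.mk' T
  have hf : Function.Surjective f := QuotientGroup.mk'_surjective T
  refine ⟨A.comap f, fun a ha => ?_, fun Φ hΦ hAΦ hc hp => ?_⟩
  · obtain ⟨k, hk, h1⟩ := isOfFinOrder_iff_pow_eq_one.mp (hA _ ha)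
    have h2 : a ^ k ∈ T := (QuotientGroup.eq_one_iff _).mp h1
    exact (isOfFinOrder_pow.mp (hT _ h2)).resolve_right hk.ne'
  · have hker : f.ker ≤ Φ := le_trans (fun x hx => by
      show f x ∈ A
      rw [MonoidHom.mem_ker.mp hx]; exact A.one_mem) hAΦ
    rw [← Subgroup.index_map_eq Φ hf hker]
    refine hb _ (hΦ.map f hf) ?_ ?_ ?_
    · rw [← Subgroup.map_comap_eq_self_of_surjective hf A]
      exact Subgroup.map_mono hAΦ
    · intro x y
      obtain ⟨x, rfl⟩ := hf x
      obtain ⟨y, rfl⟩ := hf y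
      exact ⟨_, hc x y, by simp⟩
    · intro x
      obtain ⟨x, rfl⟩ := hf x
      exact ⟨_, hp x, by simp⟩

theorem hasElementaryBound_of_eq_top {p : ℕ} {Γ : Type*} [Group Γ] {L : Subgroup Γ}
    (hL : L = ⊤) (hq : (powClosure p L).relIndex L ≠ 0) :
    HasElementaryBound p Γ ((powClosure p L).relIndex L) := by
  subst hL
  rw [Subgroup.relIndex_top_right] at hq ⊢
  refine ⟨⊥, fun a ha => ?_, fun Φ _ _ _ hp => ?_⟩
  · rw [Subgroup.mem_bot.mp ha]; exact IsOfFinOrder.one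
  · refine Nat.le_of_dvd (Nat.pos_of_ne_zero hq) (Subgroup.index_dvd_of_le ?_)
    rw [powClosure, Subgroup.closure_le]
    rintro _ ⟨x, -, rfl⟩
    exact hp x

section CentralizerStep

variable {Γ : Type*} [Group Γ] (L : Subgroup Γ) [L.Normal]

/-- If `z` is central modulo the abelian normal subgroup `L`, then its centralizer in `L` is
normal. -/
theorem normal_inf_centralizer_of_central_mod (hL : ∀ x ∈ L, ∀ y ∈ L, x * y = y * x) {z : Γ}
    (hz : ∀ γ, γ * z * γ⁻¹ * z⁻¹ ∈ L) : (L ⊓ Subgroup.centralizer {z}).Normal := by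
  refine ⟨fun k hk γ => ⟨‹L.Normal›.conj_mem k hk.1 γ, ?_⟩⟩
  have hkz : Commute z k := Subgroup.mem_centralizer_iff.mp hk.2 z rfl
  have h1 : Commute (γ * z * γ⁻¹) (γ * k * γ⁻¹) := by
    have := hkz.map (MulAut.conj γ)
    simpa only [MulAut.conj_apply] using this
  have h2 : Commute (γ * z * γ⁻¹ * z⁻¹) (γ * k * γ⁻¹) :=
    hL _ (hz γ) _ (‹L.Normal›.conj_mem k hk.1 γ)
  have h3 := h2.inv_left.mul_left h1
  refine Subgroup.mem_centralizer_iff.mpr fun w hw => ?_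
  obtain rfl : w = z := hw
  have e : (γ * w * γ⁻¹ * w⁻¹)⁻¹ * (γ * w * γ⁻¹) = w := by group
  rw [e] at h3
  exact h3

/-- The subgroup of all commutators `z * l * z⁻¹ * l⁻¹` with `l` in an abelian normal subgroup. -/
theorem exists_subgroup_commutators (hL : ∀ x ∈ L, ∀ y ∈ L, x * y = y * x) {z : Γ}
    (hz : ∀ γ, γ * z * γ⁻¹ * z⁻¹ ∈ L) :
    ∃ D : Subgroup Γ, D.Normal ∧ ∀ x, x ∈ D ↔ ∃ l ∈ L, z * l * z⁻¹ * l⁻¹ = x := by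
  have hc : ∀ γ : Γ, ∀ l ∈ L, γ * l * γ⁻¹ ∈ L := fun γ l hl => ‹L.Normal›.conj_mem l hl γ
  let D : Subgroup Γ :=
    { carrier := {x | ∃ l ∈ L, z * l * z⁻¹ * l⁻¹ = x}
      one_mem' := ⟨1, L.one_mem, by group⟩
      mul_mem' := by
        rintro _ _ ⟨a, ha, rfl⟩ ⟨b, hb, rfl⟩
        refine ⟨a * b, L.mul_mem ha hb, ?_⟩
        have h1 : Commute (z * b * z⁻¹) a⁻¹ := hL _ (hc z b hb) _ (L.inv_mem ha)
        have h2 : Commute b⁻¹ a⁻¹ := hL _ (L.inv_mem hb) _ (L.inv_mem ha)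
        calc z * (a * b) * z⁻¹ * (a * b)⁻¹
            = z * a * z⁻¹ * (z * b * z⁻¹ * (b⁻¹ * a⁻¹)) := by group
          _ = z * a * z⁻¹ * (a⁻¹ * (z * b * z⁻¹) * b⁻¹) := by
            rw [h2.eq, ← mul_assoc (z * b * z⁻¹), h1.eq]
          _ = _ := by group
      inv_mem' := by
        rintro _ ⟨a, ha, rfl⟩
        refine ⟨a⁻¹, L.inv_mem ha, ?_⟩
        have h1 : Commute (z * a⁻¹ * z⁻¹) a := hL _ (hc z _ (L.inv_mem ha)) _ ha
        rw [inv_inv, h1.eq]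
        group }
  refine ⟨D, ⟨?_⟩, fun x => Iff.rfl⟩
  rintro _ ⟨l, hl, rfl⟩ γ
  refine ⟨γ * l * γ⁻¹, hc γ l hl, ?_⟩
  have h1 : Commute (γ * z * γ⁻¹ * z⁻¹) (z * (γ * l * γ⁻¹) * z⁻¹) :=
    hL _ (hz γ) _ (hc z _ (hc γ l hl))
  calc z * (γ * l * γ⁻¹) * z⁻¹ * (γ * l * γ⁻¹)⁻¹
      = (z * (γ * l * γ⁻¹) * z⁻¹) * (γ * z * γ⁻¹ * z⁻¹) * (γ * z * γ⁻¹ * z⁻¹)⁻¹ *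
        (γ * l * γ⁻¹)⁻¹ := by group
    _ = (γ * z * γ⁻¹ * z⁻¹) * (z * (γ * l * γ⁻¹) * z⁻¹) * (γ * z * γ⁻¹ * z⁻¹)⁻¹ *
        (γ * l * γ⁻¹)⁻¹ := by rw [h1.eq]
    _ = _ := by group

variable {L}

/-- The `p`-th powers of `L` are products of commutators with `z` and elements centralizing `z`. -/
theorem pow_mem_sup_of_central_mod {p : ℕ} (hL : ∀ x ∈ L, ∀ y ∈ L, x * y = y * x) {z : Γ}
    (hzp : z ^ p ∈ L) {D : Subgroup Γ} [D.Normal]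
    (hD : ∀ x, x ∈ D ↔ ∃ l ∈ L, z * l * z⁻¹ * l⁻¹ = x) {l : Γ} (hl : l ∈ L) :
    l ^ p ∈ D ⊔ (L ⊓ Subgroup.centralizer {z}) := by
  have hlzp : (l * z) ^ p ∈ L := by
    rw [← QuotientGroup.eq_one_iff] at hzp ⊢
    have hl' : ((l : Γ) : Γ ⧸ L) = 1 := (QuotientGroup.eq_one_iff l).mpr hl
    rw [QuotientGroup.mk_pow] at hzp ⊢
    rw [QuotientGroup.mk_mul, hl', one_mul, hzp]
  set N := (l * z) ^ p * (z ^ p)⁻¹ with hN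
  have h1 : Commute ((l * z) ^ p) l := hL _ hlzp _ hl
  have h2 : Commute ((l * z) ^ p) z := by
    have := h1.inv_right.mul_right ((Commute.refl (l * z)).pow_left p)
    rwa [inv_mul_cancel_left] at this
  have hNz : N ∈ L ⊓ Subgroup.centralizer {z} := by
    refine ⟨L.mul_mem hlzp (L.inv_mem hzp), Subgroup.mem_centralizer_iff.mpr fun w hw => ?_⟩
    obtain rfl : w = z := hw
    exact (h2.mul_left ((Commute.refl w).pow_left p).inv_left).symm.eq
  have hD' : l ^ p * N⁻¹ ∈ D := by
    refine (QuotientGroup.eq_one_iff _).mp ?_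
    have hc : Commute ((l : Γ) : Γ ⧸ D) (z : Γ ⧸ D) := by
      have : z * l * z⁻¹ * l⁻¹ ∈ D := (hD _).mpr ⟨l, hl, rfl⟩
      have := (QuotientGroup.eq_one_iff _).mpr this
      simp only [QuotientGroup.mk_mul, QuotientGroup.mk_inv] at this
      rw [mul_inv_eq_one, mul_inv_eq_iff_eq_mul] at this
      exact this.symm
    rw [hN]
    simp only [QuotientGroup.mk_mul, QuotientGroup.mk_inv, QuotientGroup.mk_pow]
    rw [hc.mul_pow]
    group
  have := Subgroup.mul_mem_sup hD' hNz
  rwa [inv_mul_cancel_right] at this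

/-- Reduction of the elementary bound for `Γ` to the subgroup centralizing `z` modulo its
centralizer in `L`. -/
theorem HasElementaryBound.of_centralizer {p : ℕ} (hp : 0 < p)
    (hL : ∀ x ∈ L, ∀ y ∈ L, x * y = y * x) (htf : ∀ x ∈ L, IsOfFinOrder x → x = 1)
    (hq : (powClosure p L).relIndex L ≠ 0) {z : Γ}
    (hz : ∀ γ, γ * z * γ⁻¹ * z⁻¹ ∈ L) (hzp : z ^ p ∈ L) {K C : Subgroup Γ}
    (hK : K = L ⊓ Subgroup.centralizer {z}) (hC : ∀ γ, γ ∈ C ↔ γ * z * γ⁻¹ * z⁻¹ ∈ K)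
    (h : (powClosure p K).relIndex K ≠ 0 →
      HasElementaryBound p C ((powClosure p K).relIndex K)) :
    HasElementaryBound p Γ ((powClosure p L).relIndex L) := by
  have hKn : K.Normal := hK ▸ normal_inf_centralizer_of_central_mod L hL hz
  have hKL : K ≤ L := hK ▸ inf_le_left
  obtain ⟨D, hDn, hD⟩ := exists_subgroup_commutators L hL hz
  have hJn : (D ⊔ K).Normal := Subgroup.sup_normal D K
  have hDL : D ≤ L := fun x hx => by
    obtain ⟨l, hl, rfl⟩ := (hD x).mp hx
    exact L.mul_mem (‹L.Normal›.conj_mem l hl z) (L.inv_mem hl)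
  have hKC : K ≤ C := fun k hk => by
    rw [hC]
    have : Commute z k := Subgroup.mem_centralizer_iff.mp (hK ▸ hk : k ∈ L ⊓ Subgroup.centralizer {z}).2 z rfl
    rw [← this.eq, mul_inv_cancel_right, mul_inv_cancel]
    exact K.one_mem
  have hpn : (powClosure p L).Normal := ⟨fun x hx γ => by
    obtain ⟨y, hy, rfl⟩ := exists_pow_eq_of_mem_powClosure hL hx
    rw [← conj_pow]
    exact pow_mem_powClosure p (‹L.Normal›.conj_mem y hy γ)⟩
  have hPK : powClosure p L ⊓ K = powClosure p K := by
    refine le_antisymm ?_ (le_inf (Subgroup.closure_mono (Set.image_mono hKL)) (powClosure_le p K))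
    rintro x ⟨hx, hxK⟩
    obtain ⟨y, hy, rfl⟩ := exists_pow_eq_of_mem_powClosure hL hx
    refine pow_mem_powClosure p ?_
    have hzy : Commute z (y ^ p) :=
      Subgroup.mem_centralizer_iff.mp (hK ▸ hxK : y ^ p ∈ L ⊓ Subgroup.centralizer {z}).2 z rfl
    have h1 : z * y * z⁻¹ * y⁻¹ = 1 := by
      refine htf _ (hDL ((hD _).mpr ⟨y, hy, rfl⟩)) (isOfFinOrder_iff_pow_eq_one.mpr ⟨p, hp, ?_⟩)
      have hcc : Commute (z * y * z⁻¹) y⁻¹ := hL _ (‹L.Normal›.conj_mem y hy z) _ (L.inv_mem hy)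
      rw [hcc.mul_pow, conj_pow, hzy.eq, mul_inv_cancel_right, inv_pow, mul_inv_cancel]
    rw [hK]
    refine ⟨hy, Subgroup.mem_centralizer_iff.mpr fun w hw => ?_⟩
    obtain rfl : w = z := hw
    rwa [mul_inv_eq_one, mul_inv_eq_iff_eq_mul] at h1
  set r := (powClosure p L ⊔ K).relIndex L with hr
  have hqr : (powClosure p K).relIndex K * r = (powClosure p L).relIndex L := by
    rw [← Subgroup.relIndex_mul_relIndex (powClosure p L) (powClosure p L ⊔ K) L le_sup_left
      (sup_le (powClosure_le p L) hKL), Subgroup.relIndex_sup_left, ← hPK,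
      Subgroup.inf_relIndex_right]
  rw [← hqr] at hq ⊢
  obtain ⟨A, hA, hb⟩ := h (left_ne_zero_of_mul hq)
  have hr0 : r ≠ 0 := right_ne_zero_of_mul hq
  have hJr : (D ⊔ K).relIndex L ∣ r := by
    refine Subgroup.relIndex_dvd_of_le_left L (sup_le ?_ le_sup_right)
    rw [powClosure, Subgroup.closure_le]
    rintro _ ⟨l, hl, rfl⟩
    exact hK ▸ pow_mem_sup_of_central_mod hL hzp hD hl
  have hJ0 : (D ⊔ K).relIndex L ≠ 0 := fun h0 => hr0 (Nat.eq_zero_of_zero_dvd (h0 ▸ hJr))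
  refine ⟨A.map C.subtype, ?_, fun Φ hΦ hAΦ hc hpow => ?_⟩
  · rintro _ ⟨a, ha, rfl⟩
    exact C.subtype.isOfFinOrder (hA a ha)
  have hcΨ : ∀ x y, x * y * x⁻¹ * y⁻¹ ∈ C ⊔ Φ := fun x y => (le_sup_right : Φ ≤ C ⊔ Φ) (hc x y)
  have hΨn : (C ⊔ Φ).Normal := ⟨fun x hx γ => by
    have := (C ⊔ Φ).mul_mem (hcΨ γ x) hx
    rwa [inv_mul_cancel_right] at this⟩
  have hJΨ : D ⊔ K ≤ (C ⊔ Φ) ⊓ L := by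
    refine sup_le (le_inf (fun x hx => ?_) hDL) (le_inf (hKC.trans le_sup_left) hKL)
    obtain ⟨l, hl, rfl⟩ := (hD x).mp hx
    exact hcΨ _ _
  have h1 : (D ⊔ K).relIndex ((C ⊔ Φ) ⊓ L) * (C ⊔ Φ).relIndex L = (D ⊔ K).relIndex L := by
    rw [← Subgroup.inf_relIndex_right (C ⊔ Φ) L]
    exact Subgroup.relIndex_mul_relIndex _ _ _ hJΨ inf_le_right
  have h2 : (L ⊔ (C ⊔ Φ)).index ≤ (D ⊔ K).relIndex ((C ⊔ Φ) ⊓ L) := by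
    have hfin : Finite (↥((C ⊔ Φ) ⊓ L) ⧸ (D ⊔ K).subgroupOf ((C ⊔ Φ) ⊓ L)) := by
      refine Nat.finite_of_card_ne_zero ?_
      exact fun h0 => hJ0 (by rw [← h1]; exact mul_eq_zero_of_left h0 _)
    let F : Γ ⧸ (L ⊔ (C ⊔ Φ)) → ↥((C ⊔ Φ) ⊓ L) ⧸ (D ⊔ K).subgroupOf ((C ⊔ Φ) ⊓ L) := fun x =>
      QuotientGroup.mk ⟨x.out * z * x.out⁻¹ * z⁻¹, hcΨ _ _, hz _⟩
    refine Nat.card_le_card_of_injective F fun x y hxy => ?_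
    have h3 := QuotientGroup.eq.mp hxy
    have h4 : (x.out * z * x.out⁻¹ * z⁻¹)⁻¹ * (y.out * z * y.out⁻¹ * z⁻¹) ∈ D ⊔ K := h3
    have h5 := hJn.conj_mem _ h4 (z * x.out⁻¹ * z⁻¹)
    rw [← QuotientGroup.out_eq' x, ← QuotientGroup.out_eq' y, QuotientGroup.eq]
    set g := x.out⁻¹ * y.out with hg
    have h6 : g * z * g⁻¹ * z⁻¹ ∈ D ⊔ K := by
      convert h5 using 1
      rw [hg]
      group
    obtain ⟨d, hd, k, hk, hdk⟩ := Subgroup.mem_sup_of_normal_right.mp h6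
    obtain ⟨l, hl, rfl⟩ := (hD d).mp hd
    have h7 : l * g ∈ C := by
      rw [hC]
      have hcom1 : Commute l (z * l * z⁻¹ * l⁻¹ * k) :=
        hL _ hl _ (L.mul_mem (hDL hd) (hKL hk))
      have hcom2 : Commute k (z * l⁻¹ * z⁻¹) :=
        hL _ (hKL hk) _ (‹L.Normal›.conj_mem _ (L.inv_mem hl) z)
      have e : l * g * z * (l * g)⁻¹ * z⁻¹ = k := by
        calc l * g * z * (l * g)⁻¹ * z⁻¹
            = l * (g * z * g⁻¹ * z⁻¹) * (z * l⁻¹ * z⁻¹) := by group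
          _ = (z * l * z⁻¹ * l⁻¹ * k) * l * (z * l⁻¹ * z⁻¹) := by rw [← hdk, hcom1.eq]
          _ = z * l * z⁻¹ * l⁻¹ * (k * l) * (z * l⁻¹ * z⁻¹) := by group
          _ = z * l * z⁻¹ * l⁻¹ * (l * k) * (z * l⁻¹ * z⁻¹) := by
            rw [hL k (hKL hk) l hl]
          _ = z * l * z⁻¹ * (k * (z * l⁻¹ * z⁻¹)) := by group
          _ = z * l * z⁻¹ * ((z * l⁻¹ * z⁻¹) * k) := by rw [hcom2.eq]
          _ = k := by group
      rw [e]
      exact hk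
    have h8 : l⁻¹ * (l * g) ∈ L ⊔ (C ⊔ Φ) := Subgroup.mul_mem_sup (L.inv_mem hl)
      ((le_sup_left : C ≤ C ⊔ Φ) h7)
    rwa [inv_mul_cancel_left] at h8
  have h3 : (C ⊔ Φ).index = (C ⊔ Φ).relIndex L * (L ⊔ (C ⊔ Φ)).index := by
    rw [← Subgroup.relIndex_mul_index (le_sup_right : C ⊔ Φ ≤ L ⊔ (C ⊔ Φ)),
      Subgroup.relIndex_sup_right]
  have h4 : (C ⊔ Φ).index ≤ r := by
    calc (C ⊔ Φ).index ≤ (C ⊔ Φ).relIndex L * (D ⊔ K).relIndex ((C ⊔ Φ) ⊓ L) :=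
          h3.trans_le (Nat.mul_le_mul_left _ h2)
      _ = (D ⊔ K).relIndex L := by rw [mul_comm, h1]
      _ ≤ r := Nat.le_of_dvd (Nat.pos_of_ne_zero hr0) hJr
  have h5 : Φ.relIndex C ≤ (powClosure p K).relIndex K := by
    refine hb (Φ.subgroupOf C) inferInstance (fun a ha => hAΦ ⟨a, ha, rfl⟩)
      (fun x y => hc x y) fun x => hpow x
  rw [← Subgroup.relIndex_mul_index (le_sup_right : Φ ≤ C ⊔ Φ), Subgroup.relIndex_sup_right]
  exact Nat.mul_le_mul h5 h4

end CentralizerStep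

theorem HasElementaryBound.mono {p : ℕ} {Γ : Type*} [Group Γ] {q r : ℕ}
    (h : HasElementaryBound p Γ q) (hqr : q ≤ r) : HasElementaryBound p Γ r := by
  obtain ⟨A, hA, hb⟩ := h
  exact ⟨A, hA, fun Φ h1 h2 h3 h4 => (hb Φ h1 h2 h3 h4).trans hqr⟩

/-- If `z` lies outside `L` but is central modulo `L`, then `L` and `z` generate modulo torsion
a larger torsion-free abelian normal subgroup, provided that `z` centralizes `L`. -/
theorem exists_quotient_of_central {p : ℕ} (hp : 0 < p) {Γ : Type*} [Group Γ] (L : Subgroup Γ)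
    [L.Normal] (hL : ∀ x ∈ L, ∀ y ∈ L, x * y = y * x) (hidx : L.index ≠ 0)
    {z : Γ}
    (hz : ∀ γ, γ * z * γ⁻¹ * z⁻¹ ∈ L) (hzL : z ∉ L) (hzc : ∀ x ∈ L, z * x = x * z) :
    ∃ (T : Subgroup Γ) (_ : T.Normal) (L' : Subgroup (Γ ⧸ T)), L'.Normal ∧
      (∀ a ∈ T, IsOfFinOrder a) ∧ (∀ x ∈ L', ∀ y ∈ L', x * y = y * x) ∧
      (∀ x ∈ L', IsOfFinOrder x → x = 1) ∧ L'.index ∣ L.index ∧ L'.index < L.index ∧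
      (powClosure p L').relIndex L' ∣ (powClosure p L).relIndex L := by
  have hzcen : ∀ γ : Γ ⧸ L, γ * (z : Γ ⧸ L) = z * γ := fun γ => by
    obtain ⟨γ, rfl⟩ := QuotientGroup.mk_surjective γ
    have := (QuotientGroup.eq_one_iff _).mpr (hz γ)
    simp only [QuotientGroup.mk_mul, QuotientGroup.mk_inv] at this
    rwa [mul_inv_eq_one, mul_inv_eq_iff_eq_mul] at this
  let Z : Subgroup (Γ ⧸ L) := Subgroup.zpowers (z : Γ ⧸ L)
  have hZn : Z.Normal := ⟨fun x hx γ => by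
    obtain ⟨i, rfl⟩ := Subgroup.mem_zpowers_iff.mp hx
    have : Commute γ ((z : Γ ⧸ L) ^ i) := (show Commute γ (z : Γ ⧸ L) from hzcen γ).zpow_right i
    rw [this.eq, mul_inv_cancel_right]
    exact hx⟩
  let K : Subgroup Γ := Z.comap (QuotientGroup.mk' L)
  have hKn : K.Normal := hZn.comap _
  have hLK : L ≤ K := fun x hx => by
    show (x : Γ ⧸ L) ∈ Z
    rw [(QuotientGroup.eq_one_iff x).mpr hx]
    exact Z.one_mem
  have hzK : z ∈ K := Subgroup.mem_zpowers _
  have hKform : ∀ x ∈ K, ∃ l ∈ L, ∃ i : ℤ, x = l * z ^ i := fun x hx => by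
    obtain ⟨i, hi⟩ := Subgroup.mem_zpowers_iff.mp (show (x : Γ ⧸ L) ∈ Z from hx)
    refine ⟨x * (z ^ i)⁻¹, ?_, i, by group⟩
    refine (QuotientGroup.eq_one_iff _).mp ?_
    simp only [QuotientGroup.mk_mul, QuotientGroup.mk_inv, QuotientGroup.mk_zpow]
    rw [hi, mul_inv_cancel]
  have hK : ∀ x ∈ K, ∀ y ∈ K, Commute x y := fun x hx y hy => by
    obtain ⟨a, ha, i, rfl⟩ := hKform x hx
    obtain ⟨b, hb, j, rfl⟩ := hKform y hy
    have h1 : ∀ l ∈ L, ∀ i : ℤ, Commute (z ^ i) l := fun l hl i =>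
      (show Commute z l from hzc l hl).zpow_left i
    have h2 : Commute a b := hL a ha b hb
    exact (h2.mul_right (h1 a ha j).symm).mul_left
      ((h1 b hb i).mul_right ((Commute.refl z).zpow_zpow i j))
  let T : Subgroup Γ :=
    { carrier := {x | x ∈ K ∧ IsOfFinOrder x}
      one_mem' := ⟨K.one_mem, IsOfFinOrder.one⟩
      mul_mem' := fun {a b} ha hb =>
        ⟨K.mul_mem ha.1 hb.1, (hK a ha.1 b hb.1).isOfFinOrder_mul ha.2 hb.2⟩
      inv_mem' := fun {a} ha => ⟨K.inv_mem ha.1, ha.2.inv⟩ }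
  have hTn : T.Normal := ⟨fun x hx γ => ⟨hKn.conj_mem x hx.1 γ, by
    have := (MulAut.conj γ).toMonoidHom.isOfFinOrder hx.2
    simpa using this⟩⟩
  let f := QuotientGroup.mk' T
  have hf : Function.Surjective f := QuotientGroup.mk'_surjective T
  have hcomm : ∀ x ∈ K.map f, ∀ y ∈ K.map f, x * y = y * x := by
    rintro _ ⟨x, hx, rfl⟩ _ ⟨y, hy, rfl⟩
    exact ((hK x hx y hy).map f).eq
  have htf : ∀ x ∈ K.map f, IsOfFinOrder x → x = 1 := by
    rintro _ ⟨x, hx, rfl⟩ h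
    obtain ⟨k, hk, h1⟩ := isOfFinOrder_iff_pow_eq_one.mp h
    have h2 : x ^ k ∈ T := (QuotientGroup.eq_one_iff (x ^ k)).mp h1
    exact (QuotientGroup.eq_one_iff x).mpr
      ⟨hx, (isOfFinOrder_pow.mp h2.2).resolve_right hk.ne'⟩
  have hmul := Subgroup.relIndex_mul_index hLK
  have hdvd : (K.map f).index ∣ K.index := Subgroup.index_map_dvd K hf
  have hK0 : K.index ≠ 0 := right_ne_zero_of_mul (hmul ▸ hidx)
  have hLK0 : L.relIndex K ≠ 0 := left_ne_zero_of_mul (hmul ▸ hidx)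
  refine ⟨T, hTn, K.map f, hKn.map f hf, fun a ha => ha.2, hcomm, htf,
    hdvd.trans (Dvd.intro_left _ hmul), ?_, ?_⟩
  · refine lt_of_le_of_lt (Nat.le_of_dvd (Nat.pos_of_ne_zero hK0) hdvd) ?_
    rw [← hmul]
    refine lt_mul_of_one_lt_left (Nat.pos_of_ne_zero hK0) ?_
    have : L.relIndex K ≠ 1 := fun h => hzL (Subgroup.relIndex_eq_one.mp h hzK)
    omega
  · rw [relIndex_powClosure_eq hp (Subgroup.map_mono hLK) hcomm htf
      (fun h => hLK0 (Nat.eq_zero_of_zero_dvd (h ▸ relIndex_map_dvd f L K))),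
      ← map_powClosure]
    exact relIndex_map_dvd f _ L

/-- A finite-index abelian normal torsion-free subgroup `L` of `p`-power index controls the
elementary abelian `p`-quotients of the whole group, up to torsion. -/
theorem hasElementaryBound {p : ℕ} [Fact p.Prime] {Γ : Type*} [Group Γ] (L : Subgroup Γ)
    [L.Normal] (hL : ∀ x ∈ L, ∀ y ∈ L, x * y = y * x) (htf : ∀ x ∈ L, IsOfFinOrder x → x = 1)
    {k : ℕ} (hidx : L.index ∣ p ^ k) (hq : (powClosure p L).relIndex L ≠ 0) :
    HasElementaryBound p Γ ((powClosure p L).relIndex L) := by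
  have hp : p.Prime := Fact.out
  induction hm : L.index using Nat.strong_induction_on generalizing Γ with
  | _ m ih =>
  subst hm
  by_cases htop : L = ⊤
  · exact hasElementaryBound_of_eq_top htop hq
  have hidx0 : L.index ≠ 0 := fun h => by
    rw [h] at hidx
    exact (pow_pos hp.pos k).ne' (Nat.eq_zero_of_zero_dvd hidx)
  have hfin : Finite (Γ ⧸ L) := Nat.finite_of_card_ne_zero hidx0
  obtain ⟨z, hz, hzL, hzp⟩ : ∃ z : Γ, (∀ γ, γ * z * γ⁻¹ * z⁻¹ ∈ L) ∧ z ∉ L ∧ z ^ p ∈ L := by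
    obtain ⟨j, -, hj⟩ := (Nat.dvd_prime_pow hp).mp hidx
    have hP : IsPGroup p (Γ ⧸ L) := IsPGroup.of_card hj
    have hnt : Nontrivial (Γ ⧸ L) := by
      rw [← Finite.one_lt_card_iff_nontrivial, ← Subgroup.index_eq_card]
      have : L.index ≠ 1 := fun h => htop (Subgroup.index_eq_one.mp h)
      omega
    have hcn := hP.center_nontrivial
    obtain ⟨i, hi0, hi⟩ := (hP.to_subgroup (Subgroup.center (Γ ⧸ L))).nontrivial_iff_card.mp hcn
    obtain ⟨c, hc⟩ := exists_prime_orderOf_dvd_card' (G := Subgroup.center (Γ ⧸ L)) p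
      (hi ▸ dvd_pow_self p hi0.ne')
    obtain ⟨z, hz⟩ := QuotientGroup.mk_surjective (c : Γ ⧸ L)
    refine ⟨z, fun γ => ?_, fun h => ?_, ?_⟩
    · refine (QuotientGroup.eq_one_iff _).mp ?_
      simp only [QuotientGroup.mk_mul, QuotientGroup.mk_inv]
      rw [mul_inv_eq_one, mul_inv_eq_iff_eq_mul, hz]
      exact Subgroup.mem_center_iff.mp c.2 _
    · rw [(QuotientGroup.eq_one_iff z).mpr h] at hz
      have : c = 1 := Subtype.ext hz.symm
      rw [this, orderOf_one] at hc
      exact hp.one_lt.ne hc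
    · refine (QuotientGroup.eq_one_iff _).mp ?_
      rw [QuotientGroup.mk_pow, hz, ← SubmonoidClass.coe_pow, ← hc, pow_orderOf_eq_one]
      rfl
  have hKn := normal_inf_centralizer_of_central_mod L hL hz
  set K := L ⊓ Subgroup.centralizer {z} with hK
  let C : Subgroup Γ := (Subgroup.centralizer {(z : Γ ⧸ K)}).comap (QuotientGroup.mk' K)
  have hC : ∀ γ, γ ∈ C ↔ γ * z * γ⁻¹ * z⁻¹ ∈ K := fun γ => by
    rw [← QuotientGroup.eq_one_iff (N := K)]
    simp only [QuotientGroup.mk_mul, QuotientGroup.mk_inv]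
    rw [mul_inv_eq_one, mul_inv_eq_iff_eq_mul]
    show (γ : Γ ⧸ K) ∈ Subgroup.centralizer _ ↔ _
    rw [Subgroup.mem_centralizer_singleton_iff]
  have hzK : ∀ x ∈ K, z * x = x * z := fun x hx =>
    Subgroup.mem_centralizer_iff.mp (show x ∈ L ⊓ Subgroup.centralizer {z} from hx).2 z rfl
  have hLC : L ⊓ C ≤ K := by
    rintro l ⟨hl, hlC⟩
    have hkK := (hC l).mp hlC
    set k := l * z * l⁻¹ * z⁻¹ with hk
    have h1 : Commute k z := (hzK k hkK).symm
    have h2 : k ^ p = 1 := by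
      have h3 : (k * z) ^ p = z ^ p := by
        rw [hk, inv_mul_cancel_right, conj_pow, hL l hl _ hzp, mul_inv_cancel_right]
      rwa [h1.mul_pow, mul_eq_right] at h3
    have h4 : k = 1 := htf k hkK.1 (isOfFinOrder_iff_pow_eq_one.mpr ⟨p, hp.pos, h2⟩)
    refine ⟨hl, Subgroup.mem_centralizer_iff.mpr fun w hw => ?_⟩
    obtain rfl : w = z := hw
    rw [hk, mul_inv_eq_one, mul_inv_eq_iff_eq_mul] at h4
    exact h4.symm
  have hKL : K ≤ L := inf_le_left
  have hKC : K ≤ C := fun x hx => by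
    rw [hC, ← hzK x hx, mul_inv_cancel_right, mul_inv_cancel]
    exact K.one_mem
  have hzC : z ∈ C := by
    rw [hC, mul_inv_cancel_right, mul_inv_cancel]
    exact K.one_mem
  refine HasElementaryBound.of_centralizer hp.pos hL htf hq hz hzp hK hC fun hqK => ?_
  have hmap : (K.subgroupOf C).map C.subtype = K := by
    rw [Subgroup.subgroupOf_map_subtype, inf_eq_left.mpr hKC]
  have hqe : (powClosure p (K.subgroupOf C)).relIndex (K.subgroupOf C) =
      (powClosure p K).relIndex K := by
    rw [← Subgroup.relIndex_map_map_of_injective _ _ C.subtype_injective, map_powClosure, hmap]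
  have hKi : (K.subgroupOf C).index ∣ L.index := by
    have : K.relIndex C = L.relIndex C := by
      rw [← Subgroup.inf_relIndex_right L C, le_antisymm hLC (le_inf hKL hKC)]
    exact (show (K.subgroupOf C).index = K.relIndex C from rfl) ▸ this ▸
      Subgroup.relIndex_dvd_index_of_normal L C
  have hKi0 : (K.subgroupOf C).index ≠ 0 := fun h => hidx0 (Nat.eq_zero_of_zero_dvd (h ▸ hKi))
  obtain ⟨T, hT, L', hL'n, hTt, hL', htf', hdvd, hlt, hqd⟩ :=
    exists_quotient_of_central hp.pos (K.subgroupOf C) (z := ⟨z, hzC⟩)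
      (fun x hx y hy => Subtype.ext (hL _ (hKL hx) _ (hKL hy))) hKi0
      (fun γ => (hC γ).mp γ.2) (fun h => hzL (hKL h)) (fun x hx => Subtype.ext (hzK _ hx))
  rw [hqe] at hqd
  have hq'0 : (powClosure p L').relIndex L' ≠ 0 := fun h =>
    hqK (Nat.eq_zero_of_zero_dvd (h ▸ hqd))
  refine ((ih _ (hlt.trans_le (Nat.le_of_dvd (Nat.pos_of_ne_zero hidx0) hKi)) L' hL' htf'
    (hdvd.trans (hKi.trans hidx)) hq'0 rfl).mono
    (Nat.le_of_dvd (Nat.pos_of_ne_zero hqK) hqd)).of_quotient T hTt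

section Numerics

open scoped Nat

theorem exists_prime_gt_primitive_root {p : ℕ} (hp : p.Prime) (hodd : Odd p) (N : ℕ) :
    ∃ q, q.Prime ∧ N < q ∧ ∀ e, p ^ 2 ∣ q ^ e - 1 ↔ (p - 1) * p ∣ e := by
  have : NeZero (p ^ 2) := ⟨pow_ne_zero _ hp.ne_zero⟩
  have hcyc : IsCyclic (ZMod (p ^ 2))ˣ := (ZMod.isCyclic_units_iff _).mpr
    (Or.inr <| Or.inr <| Or.inr <| Or.inr ⟨p, 2, hp, hodd, by norm_num, Or.inl rfl⟩)
  obtain ⟨g, hg⟩ := hcyc.exists_generator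
  have hord : orderOf g = (p - 1) * p := by
    rw [orderOf_eq_card_of_forall_mem_zpowers hg, Nat.card_eq_fintype_card,
      ZMod.card_units_eq_totient, Nat.totient_prime_pow hp (by norm_num)]
    simp [mul_comm]
  obtain ⟨q, ⟨hq, hqg⟩, hNq⟩ :=
    (Nat.infinite_setOfPred_prime_and_eq_mod (q := p ^ 2) g.isUnit).exists_gt N
  refine ⟨q, hq, hNq, fun e => ?_⟩
  rw [← hord, orderOf_dvd_iff_pow_eq_one, ← Units.val_inj, Units.val_pow_eq_pow_val, ← hqg,
    Units.val_one, ← Nat.modEq_iff_dvd' (Nat.one_le_pow _ _ hq.pos),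
    ← ZMod.natCast_eq_natCast_iff]
  push_cast
  exact eq_comm

theorem padicValNat_prod_pow_sub_one {p q : ℕ} [hp : Fact p.Prime] (hodd : Odd p) (hq : 1 < q)
    (hprim : ∀ e, p ^ 2 ∣ q ^ e - 1 ↔ (p - 1) * p ∣ e) (m : ℕ) :
    padicValNat p (∏ j ∈ Finset.range m, (q ^ (j + 1) - 1)) =
      padicValNat p (p * (m / (p - 1)))! := by
  have hp2 : 2 ≤ p := hp.out.two_le
  have hp3 : 3 ≤ p := by
    rcases hodd with ⟨k, hk⟩; omega
  have hpos : ∀ e, e ≠ 0 → 0 < q ^ e - 1 := fun e he => by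
    have := Nat.one_lt_pow he hq
    omega
  have hcop : ¬ p ∣ q := by
    intro h
    have h1 : p ^ 2 ∣ q ^ ((p - 1) * p) - 1 := (hprim _).mpr dvd_rfl
    have h2 : p ∣ q ^ ((p - 1) * p) - 1 := (dvd_pow_self p two_ne_zero).trans h1
    have h3 : p ∣ q ^ ((p - 1) * p) := dvd_pow h (by
      have : 0 < (p - 1) * p := Nat.mul_pos (by omega) (by omega)
      omega)
    have h4 := (Nat.dvd_sub h3 h2)
    rw [Nat.sub_sub_self (Nat.one_le_pow _ _ (by omega))] at h4
    exact hp.out.one_lt.ne' (Nat.dvd_one.mp h4)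
  have hdvd : ∀ e, p ∣ q ^ e - 1 → p - 1 ∣ e := by
    intro e he
    have h1 : (p : ℤ) ∣ (q : ℤ) ^ e - 1 := by
      have := Int.natCast_dvd_natCast.mpr he
      rwa [Nat.cast_sub (Nat.one_le_pow _ _ (by omega)), Nat.cast_pow, Nat.cast_one] at this
    have h2 := dvd_sub_pow_of_dvd_sub (R := ℤ) h1 1
    have h3 : p ^ 2 ∣ q ^ (e * p) - 1 := by
      rw [← Int.natCast_dvd_natCast, Nat.cast_sub (Nat.one_le_pow _ _ (by omega))]
      simpa [pow_mul] using h2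
    exact Nat.dvd_of_mul_dvd_mul_right (by omega) ((hprim _).mp h3)
  have hferm : p ∣ q ^ (p - 1) - 1 := by
    rw [← Nat.modEq_iff_dvd' (Nat.one_le_pow _ _ (by omega))]
    have := Nat.ModEq.pow_totient (n := p)
      ((Nat.coprime_comm.mp ((Nat.Prime.coprime_iff_not_dvd hp.out).mpr hcop)))
    rw [Nat.totient_prime hp.out] at this
    exact this.symm
  have hv1 : padicValNat p (q ^ (p - 1) - 1) = 1 := by
    have hne : q ^ (p - 1) - 1 ≠ 0 := (hpos _ (by omega)).ne'
    have h1 : 1 ≤ padicValNat p (q ^ (p - 1) - 1) :=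
      one_le_padicValNat_of_dvd hne hferm
    have h2 : ¬ 2 ≤ padicValNat p (q ^ (p - 1) - 1) := by
      intro h
      have h3 := (hprim _).mp ((padicValNat_dvd_iff_le hne).mpr h)
      have h4 := Nat.le_of_dvd (by omega) h3
      have : (p - 1) * 2 ≤ (p - 1) * p := Nat.mul_le_mul_left _ hp2
      omega
    omega
  induction m with
  | zero => simp
  | succ m ih =>
    rw [Finset.prod_range_succ, padicValNat.mul
      (Finset.prod_ne_zero_iff.mpr fun j _ => (hpos _ (by omega)).ne') (hpos _ (by omega)).ne', ih,
      Nat.succ_div]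
    split_ifs with h
    · obtain ⟨j, hj⟩ := h
      have hj0 : j ≠ 0 := by rintro rfl; omega
      have hdiv : m / (p - 1) + 1 = j := by
        have := Nat.succ_div (a := m) (b := p - 1)
        rw [if_pos ⟨j, hj⟩, hj, Nat.mul_div_cancel_left _ (by omega)] at this
        exact this.symm
      have hlt : 1 < q ^ (p - 1) := Nat.one_lt_pow (by omega) hq
      have hlte := padicValNat.pow_sub_pow (p := p) hodd hlt hferm
        (fun h => hcop (hp.out.dvd_of_dvd_pow h)) hj0
      rw [one_pow, hv1, ← pow_mul, ← hj] at hlte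
      rw [hlte, padicValNat_factorial_mul, padicValNat_factorial_mul, Nat.factorial_succ,
        padicValNat.mul (by omega) (Nat.factorial_ne_zero _), hdiv]
      omega
    · rw [padicValNat.eq_zero_of_not_dvd (fun hh => h (hdvd _ hh)), add_zero, add_zero]

/-- Minkowski's bound on the odd part of the order of a finite integral linear group. -/
theorem prime_pow_dvd_factorial_of_injective {G : Type*} [Group G] [Finite G] {m : ℕ}
    (ρ : G →* GL (Fin m) ℤ) (hρ : Function.Injective ρ) {p : ℕ} (hp : p.Prime) (hp2 : p ≠ 2)
    {k : ℕ} (hk : p ^ k ∣ Nat.card G) : p ^ k ∣ (p * (m / (p - 1)))! := by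
  have := Fact.mk hp
  have hodd := hp.odd_of_ne_two hp2
  cases nonempty_fintype G
  let N : ℕ := ∑ g : G, ∑ i, ∑ j, ((ρ g).1 i j - (1 : Matrix (Fin m) (Fin m) ℤ) i j).natAbs
  obtain ⟨q, hq, hNq, hprim⟩ := exists_prime_gt_primitive_root hp hodd N
  have := Fact.mk hq
  have hinj : Function.Injective
      ((Matrix.GeneralLinearGroup.map (Int.castRingHom (ZMod q))).comp ρ) := by
    rw [injective_iff_map_eq_one]
    intro g hg
    apply hρ
    rw [map_one]
    ext i j
    have h1 := congrArg (fun M : GL (Fin m) (ZMod q) => M.1 i j) hg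
    have h2 : (((ρ g).1 i j : ℤ) : ZMod q) = ((1 : Matrix (Fin m) (Fin m) ℤ) i j : ℤ) := by
      simpa [Matrix.one_apply, apply_ite] using h1
    rw [← sub_eq_zero, ← Int.cast_sub, ZMod.intCast_zmod_eq_zero_iff_dvd] at h2
    have h3 := Int.eq_zero_of_dvd_of_natAbs_lt_natAbs h2 (lt_of_le_of_lt ?_ (by simpa using hNq))
    · exact sub_eq_zero.mp h3
    · calc _ ≤ ∑ j, ((ρ g).1 i j - (1 : Matrix (Fin m) (Fin m) ℤ) i j).natAbs :=
            Finset.single_le_sum (f := fun j =>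
              ((ρ g).1 i j - (1 : Matrix (Fin m) (Fin m) ℤ) i j).natAbs)
              (fun _ _ => Nat.zero_le _) (Finset.mem_univ j)
        _ ≤ ∑ i, ∑ j, ((ρ g).1 i j - (1 : Matrix (Fin m) (Fin m) ℤ) i j).natAbs :=
            Finset.single_le_sum (f := fun i => ∑ j,
              ((ρ g).1 i j - (1 : Matrix (Fin m) (Fin m) ℤ) i j).natAbs)
              (fun _ _ => Nat.zero_le _) (Finset.mem_univ i)
        _ ≤ N := Finset.single_le_sum (f := fun g => ∑ i, ∑ j,
              ((ρ g).1 i j - (1 : Matrix (Fin m) (Fin m) ℤ) i j).natAbs)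
              (fun _ _ => Nat.zero_le _) (Finset.mem_univ g)
  have hcard := hk.trans (Subgroup.card_dvd_of_injective _ hinj)
  have hfac : Nat.card (GL (Fin m) (ZMod q)) =
      (∏ i : Fin m, q ^ (i : ℕ)) * ∏ j ∈ Finset.range m, (q ^ (j + 1) - 1) := by
    rw [Matrix.card_GL_field, ZMod.card, ← Finset.prod_range_reflect,
      ← Fin.prod_univ_eq_prod_range (fun j => q ^ (m - 1 - j + 1) - 1), ← Finset.prod_mul_distrib]
    refine Finset.prod_congr rfl fun i _ => ?_
    rw [Nat.mul_sub, mul_one, ← pow_add]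
    congr 2
    omega
  have hcop : (p ^ k).Coprime (∏ i : Fin m, q ^ (i : ℕ)) := by
    refine Nat.Coprime.prod_right fun i _ => Nat.Coprime.pow _ _ ?_
    refine (Nat.coprime_primes hp hq).mpr ?_
    rintro rfl
    have h1 := (hprim ((p - 1) * p)).mpr dvd_rfl
    have h2 : p ∣ p ^ ((p - 1) * p) - 1 := (dvd_pow_self p two_ne_zero).trans h1
    have h0 : 0 < (p - 1) * p := Nat.mul_pos (by have := hp.two_le; omega) hp.pos
    have h4 := Nat.dvd_sub (dvd_pow_self p h0.ne') h2
    rw [Nat.sub_sub_self (Nat.one_le_pow _ _ hp.pos)] at h4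
    exact hp.one_lt.ne' (Nat.dvd_one.mp h4)
  rw [hfac] at hcard
  have hdvd := hcop.dvd_of_dvd_mul_left hcard
  have hne : ∏ j ∈ Finset.range m, (q ^ (j + 1) - 1) ≠ 0 :=
    Finset.prod_ne_zero_iff.mpr fun j _ => by
      have := Nat.one_lt_pow (n := j + 1) (by omega) hq.one_lt
      omega
  rw [padicValNat_dvd_iff_le hne, padicValNat_prod_pow_sub_one hodd hq.one_lt hprim] at hdvd
  exact (padicValNat_dvd_iff_le (Nat.factorial_ne_zero _)).mpr hdvd

theorem le_of_prime_pow_dvd_factorial {p m k : ℕ} (hp : p.Prime) (hp2 : p ≠ 2)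
    (hk : p ^ k ∣ (p * (m / (p - 1)))!) : k ≤ m := by
  have := Fact.mk hp
  have hp3 : 3 ≤ p := by have := hp.two_le; omega
  rw [padicValNat_dvd_iff_le (Nat.factorial_ne_zero _), padicValNat_factorial_mul] at hk
  have h := sub_one_mul_padicValNat_factorial (p := p) (m / (p - 1))
  have h1 : padicValNat p (m / (p - 1))! ≤ m / (p - 1) := by
    have := Nat.mul_le_mul_right (padicValNat p (m / (p - 1))!) (show 1 ≤ p - 1 by omega)
    omega
  have h2 := Nat.div_mul_le_self m (p - 1)
  have h3 := Nat.mul_le_mul_left (m / (p - 1)) (show 2 ≤ p - 1 by omega)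
  omega

theorem factorization_factorial_mul_div_le {p m : ℕ} {N : ℕ}
    (hN : p * (m / (p - 1)) ≤ N) : (p * (m / (p - 1)))!.factorization p ≤ (N)!.factorization p :=
  (Nat.factorization_le_iff_dvd (Nat.factorial_ne_zero _) (Nat.factorial_ne_zero _)).mpr
    (Nat.factorial_dvd_factorial hN) p

theorem mul_div_pred_le {p m r : ℕ} (hr : r ≤ p - 1) (hp : 0 < p) (hr0 : 0 < r) :
    p * (m / (p - 1)) ≤ m + m / r := by
  have h1 := Nat.div_mul_le_self m (p - 1)
  have h2 := Nat.div_le_div_left (a := m) hr hr0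
  obtain ⟨s, rfl⟩ : ∃ s, p = s + 1 := ⟨p - 1, by omega⟩
  simp only [Nat.add_sub_cancel] at *
  linarith

theorem two_three_factorial_bound : ∀ m ∈ Finset.Ico 2 256,
    (m + m / 4)! * 3 ^ (3 * (m / 2) / 3 ^ 1 + 3 * (m / 2) / 3 ^ 2 + 3 * (m / 2) / 3 ^ 3 +
      3 * (m / 2) / 3 ^ 4 + 3 * (m / 2) / 3 ^ 5) * (m + 1)! <
    (2 * m)! * (2 ^ ((m + m / 4) / 2 ^ 1 + (m + m / 4) / 2 ^ 2 + (m + m / 4) / 2 ^ 3 +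
        (m + m / 4) / 2 ^ 4 + (m + m / 4) / 2 ^ 5 + (m + m / 4) / 2 ^ 6 + (m + m / 4) / 2 ^ 7 +
        (m + m / 4) / 2 ^ 8) *
      3 ^ ((m + m / 4) / 3 ^ 1 + (m + m / 4) / 3 ^ 2 + (m + m / 4) / 3 ^ 3 +
        (m + m / 4) / 3 ^ 4 + (m + m / 4) / 3 ^ 5)) := by
  decide +kernel

theorem odd_mul_factorial_lt_of_lt {m d : ℕ} (hm : 2 ≤ m) (hm' : m < 256) (hd : Odd d)
    (h : ∀ p, p.Prime → p ≠ 2 → d.factorization p ≤ (p * (m / (p - 1)))!.factorization p) :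
    d * (m + 1)! < (2 * m)! := by
  have hb := two_three_factorial_bound m (Finset.mem_Ico.mpr ⟨hm, hm'⟩)
  set N := m + m / 4 with hN
  have hN' : N < 320 := by omega
  have e2 : (N)!.factorization 2 = N / 2 ^ 1 + N / 2 ^ 2 + N / 2 ^ 3 + N / 2 ^ 4 + N / 2 ^ 5 +
      N / 2 ^ 6 + N / 2 ^ 7 + N / 2 ^ 8 := by
    rw [Nat.factorization_factorial Nat.prime_two (b := 9)
      (Nat.log_lt_of_lt_pow (by omega) (by norm_num; omega))]
    simp [Finset.sum_Ico_succ_top]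
  have e3 : ∀ M < 729, (M)!.factorization 3 = M / 3 ^ 1 + M / 3 ^ 2 + M / 3 ^ 3 + M / 3 ^ 4 +
      M / 3 ^ 5 := by
    intro M hM
    rw [Nat.factorization_factorial Nat.prime_three (b := 6)
      (by rcases Nat.eq_zero_or_pos M with rfl | h0
          · simp
          · exact Nat.log_lt_of_lt_pow (by omega) (by norm_num; omega))]
    simp [Finset.sum_Ico_succ_top]
  rw [← e2, ← e3 N (by omega), ← e3 (3 * (m / 2)) (by omega)] at hb
  have hd0 : d ≠ 0 := by rintro rfl; simp at hd
  have hdvd : d * (2 ^ (N)!.factorization 2 * 3 ^ (N)!.factorization 3) ∣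
      N ! * 3 ^ (3 * (m / 2))!.factorization 3 := by
    rw [← Nat.factorization_prime_le_iff_dvd (by positivity) (by positivity)]
    intro p hp
    rw [Nat.factorization_mul hd0 (by positivity), Nat.factorization_mul (by positivity)
      (by positivity), Nat.factorization_mul (by positivity) (by positivity),
      Nat.Prime.factorization_pow Nat.prime_two, Nat.Prime.factorization_pow Nat.prime_three,
      Nat.Prime.factorization_pow Nat.prime_three]
    simp only [Finsupp.add_apply, Finsupp.single_apply]
    by_cases h2 : p = 2
    · subst h2
      have : d.factorization 2 = 0 :=
        Nat.factorization_eq_zero_of_not_dvd (fun hh => by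
          exact (Nat.not_even_iff_odd.mpr hd) (even_iff_two_dvd.mpr hh))
      simp [this]
    by_cases h3 : p = 3
    · subst h3
      have := h 3 hp (by norm_num)
      simp at this ⊢
      omega
    have := (h p hp h2).trans (factorization_factorial_mul_div_le (N := N)
      (mul_div_pred_le (by
        have := hp.two_le
        have : p ≠ 4 := by rintro rfl; norm_num at hp
        omega) hp.pos (by norm_num)))
    simpa [Ne.symm h2, Ne.symm h3] using this
  have hle := Nat.le_of_dvd (by positivity) hdvd
  refine lt_of_mul_lt_mul_right ?_
    (Nat.zero_le (2 ^ (N)!.factorization 2 * 3 ^ (N)!.factorization 3))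
  calc _ = d * (2 ^ (N)!.factorization 2 * 3 ^ (N)!.factorization 3) * (m + 1)! := by ring
    _ ≤ _ := Nat.mul_le_mul_right _ hle
    _ < _ := hb

/-- Legendre's formula as a lower bound. -/
theorem le_sub_one_mul_factorization_factorial {p n : ℕ} (hp : p.Prime) (hn : n ≠ 0) :
    n ≤ (p - 1) * ((n)!.factorization p + (Nat.log p n + 1)) := by
  have h := Nat.sub_one_mul_factorization_factorial (n := n) hp
  have h1 : (p.digits n).sum ≤ (Nat.log p n + 1) * (p - 1) := by
    have := List.sum_le_card_nsmul (p.digits n) (p - 1) fun x hx =>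
      Nat.le_sub_one_of_lt (Nat.digits_lt_base hp.one_lt hx)
    rwa [Nat.length_digits p n hp.one_lt hn, smul_eq_mul] at this
  rw [mul_add, mul_comm (p - 1) (_ + 1)]
  omega

theorem factorization_factorial_mul_div_le_add {p n : ℕ} (hp : p.Prime) (hn : n ≠ 0) :
    (p * (n / (p - 1)))!.factorization p ≤
      (n)!.factorization p + (n / (p - 1) ^ 2 + (Nat.log p n + 1)) := by
  have hp1 : 0 < p - 1 := by have := hp.two_le; omega
  rw [Nat.factorization_factorial_mul hp]
  have h1 := Nat.factorization_factorial_le_div_pred hp (n / (p - 1))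
  rw [Nat.div_div_eq_div_mul, ← sq] at h1
  have h2 : n / (p - 1) ≤ (n)!.factorization p + (Nat.log p n + 1) :=
    Nat.div_le_of_le_mul (le_sub_one_mul_factorization_factorial hp hn)
  omega

theorem sum_log_div_sq_le (J : ℕ) :
    ∑ i ∈ Finset.Ico 1 (2 ^ J), ((Nat.log 2 i + 2 : ℕ) : ℚ) / (4 * (i : ℚ) ^ 2) ≤
      (3 : ℚ) / 2 - (J + 3) / 2 ^ (J + 1) := by
  induction J with
  | zero => norm_num
  | succ J ih =>
    rw [← Finset.sum_Ico_consecutive _ Nat.one_le_two_pow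
      (Nat.pow_le_pow_right two_pos (Nat.le_succ J))]
    have h1 : ∑ i ∈ Finset.Ico (2 ^ J) (2 ^ (J + 1)),
        ((Nat.log 2 i + 2 : ℕ) : ℚ) / (4 * (i : ℚ) ^ 2) ≤ (J + 2 : ℚ) / (4 * 2 ^ J) := by
      refine (Finset.sum_le_card_nsmul _ _ ((J + 2 : ℚ) / (4 * (2 ^ J) ^ 2)) fun i hi => ?_).trans ?_
      · rw [Finset.mem_Ico] at hi
        have hlog : Nat.log 2 i = J := Nat.log_eq_of_pow_le_of_lt_pow hi.1 hi.2
        rw [hlog]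
        push_cast
        have : (2 : ℚ) ^ J ≤ i := by exact_mod_cast hi.1
        gcongr
      · rw [Nat.card_Ico, pow_succ, mul_two, Nat.add_sub_cancel, nsmul_eq_mul]
        push_cast
        apply le_of_eq
        field_simp
    refine (add_le_add ih h1).trans (le_of_eq ?_)
    push_cast
    field_simp
    ring

theorem prod_odd_pow_le (n K : ℕ) :
    (∏ i ∈ Finset.Ico 1 K, (2 * i + 1) ^ (n / (2 * i) ^ 2)) ^ 2 ≤ 2 ^ (3 * n) := by
  have h1 : ∏ i ∈ Finset.Ico 1 K, (2 * i + 1) ^ (n / (2 * i) ^ 2) ≤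
      2 ^ ∑ i ∈ Finset.Ico 1 K, (Nat.log 2 i + 2) * (n / (2 * i) ^ 2) := by
    rw [← Finset.prod_pow_eq_pow_sum]
    refine Finset.prod_le_prod' fun i _ => ?_
    rw [pow_mul]
    refine Nat.pow_le_pow_left ?_ _
    have := Nat.lt_pow_succ_log_self (one_lt_two) i
    rw [pow_succ] at this
    have h2 : 2 ^ (Nat.log 2 i + 2) = 2 ^ Nat.log 2 i * 4 := by rw [pow_add]; norm_num
    omega
  have h2 : 2 * ∑ i ∈ Finset.Ico 1 K, (Nat.log 2 i + 2) * (n / (2 * i) ^ 2) ≤ 3 * n := by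
    have h3 : ∑ i ∈ Finset.Ico 1 K, ((Nat.log 2 i + 2 : ℕ) : ℚ) / (4 * (i : ℚ) ^ 2) ≤ 3 / 2 := by
      refine (Finset.sum_le_sum_of_subset_of_nonneg (Finset.Ico_subset_Ico_right
        (Nat.lt_two_pow_self (n := K)).le) fun _ _ _ => by positivity).trans
          ((sum_log_div_sq_le K).trans ?_)
      have : (0 : ℚ) ≤ (K + 3) / 2 ^ (K + 1) := by positivity
      linarith
    have h4 : ((∑ i ∈ Finset.Ico 1 K, (Nat.log 2 i + 2) * (n / (2 * i) ^ 2) : ℕ) : ℚ) ≤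
        n * ∑ i ∈ Finset.Ico 1 K, ((Nat.log 2 i + 2 : ℕ) : ℚ) / (4 * (i : ℚ) ^ 2) := by
      rw [Finset.mul_sum, Nat.cast_sum]
      refine Finset.sum_le_sum fun i _ => ?_
      rw [Nat.cast_mul]
      have h5 : ((n / (2 * i) ^ 2 : ℕ) : ℚ) ≤ n / (4 * (i : ℚ) ^ 2) := by
        refine Nat.cast_div_le.trans (le_of_eq ?_)
        push_cast
        ring
      calc _ ≤ ((Nat.log 2 i + 2 : ℕ) : ℚ) * (n / (4 * (i : ℚ) ^ 2)) := by gcongr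
        _ = _ := by ring
    have h6 : (n : ℚ) * ∑ i ∈ Finset.Ico 1 K, ((Nat.log 2 i + 2 : ℕ) : ℚ) / (4 * (i : ℚ) ^ 2) ≤
      n * (3 / 2) := by gcongr
    have h7 := h4.trans h6
    have h8 : (2 : ℚ) * ((∑ i ∈ Finset.Ico 1 K, (Nat.log 2 i + 2) * (n / (2 * i) ^ 2) : ℕ) : ℚ) ≤
      3 * n := by linarith
    exact_mod_cast h8
  calc _ ≤ (2 ^ ∑ i ∈ Finset.Ico 1 K, (Nat.log 2 i + 2) * (n / (2 * i) ^ 2)) ^ 2 :=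
        Nat.pow_le_pow_left h1 2
    _ ≤ _ := by
        rw [← pow_mul, mul_comm]
        exact Nat.pow_le_pow_right two_pos h2

theorem prod_odd_pow_log_le {n K : ℕ} (hK : 2 * K ≤ n + 1) :
    ∏ i ∈ Finset.Ico 1 K, (2 * i + 1) ^ (Nat.log (2 * i + 1) n + 1) ≤ n ^ (2 * (K - 1)) := by
  have : ∏ i ∈ Finset.Ico 1 K, (2 * i + 1) ^ (Nat.log (2 * i + 1) n + 1) ≤
      ∏ i ∈ Finset.Ico 1 K, n ^ 2 := by
    refine Finset.prod_le_prod' fun i hi => ?_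
    rw [Finset.mem_Ico] at hi
    rw [pow_succ, sq]
    exact Nat.mul_le_mul (Nat.pow_log_le_self _ (by omega)) (by omega)
  refine this.trans (le_of_eq ?_)
  rw [Finset.prod_const, Nat.card_Ico, ← pow_mul]

theorem pow_four_le_two_pow {r : ℕ} (hr : 16 ≤ r) : r ^ 4 ≤ 2 ^ r := by
  induction r, hr using Nat.le_induction with
  | base => norm_num
  | succ r hr ih =>
    rw [pow_succ 2 r]
    have h2 : 16 * (r * r * r) ≤ r * (r * r * r) := Nat.mul_le_mul_right _ hr
    have h3 : 16 * (r * r) ≤ r * (r * r) := Nat.mul_le_mul_right _ hr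
    have h4 : 16 * r ≤ r * r := Nat.mul_le_mul_right _ hr
    have : (r + 1) ^ 4 ≤ 2 * r ^ 4 := by ring_nf at *; nlinarith
    omega

theorem two_pow_le_factorization_factorial {n : ℕ} (hn : n ≠ 0) :
    2 ^ n ≤ 2 ^ (n)!.factorization 2 * (2 * n) := by
  have h := le_sub_one_mul_factorization_factorial Nat.prime_two hn
  rw [show 2 - 1 = 1 from rfl, one_mul] at h
  calc 2 ^ n ≤ 2 ^ ((n)!.factorization 2 + (Nat.log 2 n + 1)) := Nat.pow_le_pow_right two_pos h
    _ = 2 ^ (n)!.factorization 2 * (2 * 2 ^ Nat.log 2 n) := by ring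
    _ ≤ _ := by
      have := Nat.pow_log_le_self 2 hn
      gcongr

theorem odd_mul_two_pow_le {n r d : ℕ} (hn : n ≠ 0) (hr0 : 0 < r) (hr : n ≤ r ^ 2) (hd : Odd d)
    (h : ∀ p, p.Prime → p ≠ 2 → d.factorization p ≤ (p * (n / (p - 1)))!.factorization p) :
    d * 2 ^ (n)!.factorization 2 ≤ (n + r)! *
      ((∏ i ∈ Finset.Ico 1 ((r + 1) / 2), (2 * i + 1) ^ (n / (2 * i) ^ 2)) *
      ∏ i ∈ Finset.Ico 1 ((r + 1) / 2), (2 * i + 1) ^ (Nat.log (2 * i + 1) n + 1)) := by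
  have hd0 : d ≠ 0 := by rintro rfl; simp at hd
  rw [← Finset.prod_mul_distrib]
  have hpos : 0 < ∏ i ∈ Finset.Ico 1 ((r + 1) / 2), ((2 * i + 1) ^ (n / (2 * i) ^ 2) *
    (2 * i + 1) ^ (Nat.log (2 * i + 1) n + 1)) := Finset.prod_pos fun i _ => by positivity
  refine Nat.le_of_dvd (by positivity) ?_
  rw [← Nat.factorization_prime_le_iff_dvd (by positivity) (by positivity)]
  intro p hp
  rw [Nat.factorization_mul hd0 (by positivity), Nat.factorization_mul (by positivity)
    hpos.ne', Nat.Prime.factorization_pow Nat.prime_two]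
  simp only [Finsupp.add_apply, Finsupp.single_apply]
  have hmono : (n)!.factorization p ≤ (n + r)!.factorization p :=
    (Nat.factorization_le_iff_dvd (Nat.factorial_ne_zero _) (Nat.factorial_ne_zero _)).mpr
      (Nat.factorial_dvd_factorial (Nat.le_add_right _ _)) p
  by_cases h2 : p = 2
  · subst h2
    have : d.factorization 2 = 0 := Nat.factorization_eq_zero_of_not_dvd fun hh =>
      (Nat.not_even_iff_odd.mpr hd) (even_iff_two_dvd.mpr hh)
    simp only [this, if_true]
    omega
  rw [if_neg (Ne.symm h2), add_zero]
  refine (h p hp h2).trans ?_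
  rcases le_or_gt r (p - 1) with hpr | hpr
  · have h3 : p * (n / (p - 1)) ≤ n + r := by
      refine (mul_div_pred_le hpr hp.pos hr0).trans (Nat.add_le_add_left ?_ _)
      exact Nat.div_le_of_le_mul (by rwa [← sq])
    exact (factorization_factorial_mul_div_le h3).trans (Nat.le_add_right _ _)
  · obtain ⟨i, hi⟩ := hp.odd_of_ne_two h2
    have h3 := factorization_factorial_mul_div_le_add hp hn
    have hmem : i ∈ Finset.Ico 1 ((r + 1) / 2) := by
      have := hp.two_le
      rw [Finset.mem_Ico]
      omega
    have h4 := Finset.dvd_prod_of_mem (fun i => ((2 * i + 1) ^ (n / (2 * i) ^ 2) *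
      (2 * i + 1) ^ (Nat.log (2 * i + 1) n + 1))) hmem
    rw [← pow_add, ← hi, hp.pow_dvd_iff_le_factorization hpos.ne',
      show 2 * i = p - 1 by omega] at h4
    omega

theorem odd_mul_factorial_lt_of_le {n d : ℕ} (hn : 225 ≤ n) (hd : Odd d)
    (h : ∀ p, p.Prime → p ≠ 2 → d.factorization p ≤ (p * (n / (p - 1)))!.factorization p) :
    d * (n + 1)! < (2 * n)! := by
  obtain ⟨r, hr⟩ : ∃ r, r = n.sqrt + 1 := ⟨_, rfl⟩
  have hr1 : n ≤ r ^ 2 := by rw [hr]; exact (Nat.lt_succ_sqrt' n).le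
  have hr2 : (r - 1) ^ 2 ≤ n := by rw [hr]; exact Nat.sqrt_le' n
  have hr16 : 16 ≤ r := by
    have : 15 ≤ n.sqrt := Nat.le_sqrt'.mpr (by omega)
    omega
  have hrn : r ≤ n := by nlinarith [show r - 1 + 1 = r by omega]
  have hn0 : 0 < n := by omega
  set P := ∏ i ∈ Finset.Ico 1 ((r + 1) / 2), (2 * i + 1) ^ (n / (2 * i) ^ 2)
  have hP : P ^ 2 ≤ 2 ^ (3 * n) := prod_odd_pow_le n _
  have hfac : (n + r)! ≤ (n)! * (2 * n) ^ r := by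
    rw [← Nat.factorial_mul_ascFactorial]
    exact Nat.mul_le_mul_left _ ((Nat.ascFactorial_le_pow_add n r).trans
      (Nat.pow_le_pow_left (by omega) r))
  have hdv : d * 2 ^ (n)!.factorization 2 ≤ (n)! * (2 * n) ^ r * (P * n ^ r) := by
    refine (odd_mul_two_pow_le hn0.ne' (by omega) hr1 hd h).trans
      (Nat.mul_le_mul hfac (Nat.mul_le_mul_left _ ?_))
    exact (prod_odd_pow_log_le (by omega)).trans (Nat.pow_le_pow_right hn0 (by omega))
  have hX : 4 * n ^ 2 * (n + 1) * (2 * n * n) ^ r ≤ 2 ^ (r ^ 2 + 3 * r + 3) := by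
    calc 4 * n ^ 2 * (n + 1) * (2 * n * n) ^ r
        ≤ 4 * (r ^ 2) ^ 2 * (2 * r ^ 2) * (2 * r ^ 2 * r ^ 2) ^ r := by
          gcongr
          omega
      _ = 2 ^ (r + 3) * r ^ (4 * r + 6) := by
          rw [show 2 * r ^ 2 * r ^ 2 = 2 * r ^ 4 by ring, mul_pow, ← pow_mul]
          ring
      _ ≤ 2 ^ (r + 3) * r ^ (4 * (r + 2)) := by gcongr <;> omega
      _ ≤ 2 ^ (r + 3) * 2 ^ (r * (r + 2)) := by
          rw [pow_mul, pow_mul 2]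
          exact Nat.mul_le_mul_left _ (Nat.pow_le_pow_left (pow_four_le_two_pow hr16) _)
      _ = _ := by rw [← pow_add]; ring
  have hX2 : (4 * n ^ 2 * (n + 1) * (2 * n * n) ^ r) ^ 2 < 2 ^ (3 * n) := by
    refine (Nat.pow_le_pow_left hX 2).trans_lt ?_
    rw [← pow_mul]
    refine Nat.pow_lt_pow_right one_lt_two ?_
    obtain ⟨s, rfl⟩ : ∃ s, r = s + 1 := ⟨r - 1, by omega⟩
    simp only [Nat.add_sub_cancel] at hr2
    nlinarith
  have hcb : 4 ^ n * ((n)! * (n)!) ≤ 2 * n * (2 * n)! := by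
    have h1 := Nat.four_pow_le_two_mul_self_mul_centralBinom n hn0
    have h2 := Nat.add_choose_mul_factorial_mul_factorial n n
    rw [← two_mul, ← Nat.centralBinom_eq_two_mul_choose] at h2
    calc _ ≤ 2 * n * n.centralBinom * ((n)! * (n)!) := Nat.mul_le_mul_right _ h1
      _ = _ := by rw [← h2]; ring
  by_contra! hcon
  have h1 : 8 ^ n ≤ 4 * n ^ 2 * (n + 1) * (2 * n * n) ^ r * P := by
    have hpos : 0 < (n)! * (n)! := by positivity
    refine Nat.le_of_mul_le_mul_right ?_ hpos
    calc 8 ^ n * ((n)! * (n)!) = 2 ^ n * (4 ^ n * ((n)! * (n)!)) := by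
          rw [← mul_assoc (2 ^ n), ← mul_pow, show 2 * 4 = 8 from rfl]
      _ ≤ (2 ^ (n)!.factorization 2 * (2 * n)) * (2 * n * (d * (n + 1)!)) :=
          Nat.mul_le_mul (two_pow_le_factorization_factorial hn0.ne')
            (hcb.trans (Nat.mul_le_mul_left _ hcon))
      _ = 4 * n ^ 2 * (n + 1) * (n)! * (d * 2 ^ (n)!.factorization 2) := by
          rw [Nat.factorial_succ]; ring
      _ ≤ 4 * n ^ 2 * (n + 1) * (n)! * ((n)! * (2 * n) ^ r * (P * n ^ r)) :=
          Nat.mul_le_mul_left _ hdv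
      _ = _ := by rw [mul_pow (2 * n)]; ring
  have h2 := Nat.pow_le_pow_left h1 2
  rw [mul_pow] at h2
  have h3 := h2.trans (Nat.mul_le_mul_left _ hP)
  have h4 : (8 ^ n) ^ 2 = 2 ^ (3 * n) * 2 ^ (3 * n) := by
    rw [← sq, pow_mul 2 3 n]
    norm_num
  rw [h4] at h3
  exact absurd (Nat.le_of_mul_le_mul_right h3 (by positivity)) (not_le.mpr hX2)

theorem odd_mul_factorial_lt {m n d : ℕ} (hm : 2 ≤ m) (hmn : m ≤ n) (hd : Odd d)
    (h : ∀ p, p.Prime → p ≠ 2 → d.factorization p ≤ (p * (m / (p - 1)))!.factorization p) :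
    d * (n + 1)! < (n + m)! := by
  have hlt : d * (m + 1)! < (2 * m)! := by
    rcases lt_or_ge m 256 with h1 | h1
    · exact odd_mul_factorial_lt_of_lt hm h1 hd h
    · exact odd_mul_factorial_lt_of_le (by omega) hd h
  induction n, hmn using Nat.le_induction with
  | base => rwa [← two_mul]
  | succ n hmn ih =>
    rw [Nat.factorial_succ (n + 1), show n + 1 + m = n + m + 1 by ring, Nat.factorial_succ (n + m)]
    calc d * ((n + 1 + 1) * (n + 1)!) = (n + 1 + 1) * (d * (n + 1)!) := by ring
      _ < (n + 1 + 1) * (n + m)! := by gcongr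
      _ ≤ _ := by gcongr; omega

end Numerics

theorem genBy_lattice (n : ℕ) : GenBy (Multiplicative (Fin n → ℤ)) n := by
  refine ⟨fun i => Multiplicative.ofAdd (Pi.single i 1), ?_⟩
  rw [eq_top_iff]
  intro v _
  have hv : v = ∏ i, Multiplicative.ofAdd (Pi.single i (1 : ℤ) : Fin n → ℤ) ^ (v.toAdd i) := by
    apply Multiplicative.toAdd.injective
    rw [toAdd_prod]
    simp only [toAdd_zpow, toAdd_ofAdd]
    exact (Finset.univ_sum_single v.toAdd).symm.trans
      (Finset.sum_congr rfl fun i _ => by rw [← Pi.single_smul]; simp)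
  rw [hv]
  exact Subgroup.prod_mem _ fun i _ => Subgroup.zpow_mem _ (Subgroup.subset_closure (Set.mem_range_self i)) _

theorem index_powClosure_lattice (n : ℕ) {p : ℕ} (hp : p.Prime) :
    (powClosure p (⊤ : Subgroup (Multiplicative (Fin n → ℤ)))).index = p ^ n := by
  have : Fact p.Prime := ⟨hp⟩
  let f : Multiplicative (Fin n → ℤ) →* Multiplicative (Fin n → ZMod p) :=
    AddMonoidHom.toMultiplicative
      (((Int.castAddHom (ZMod p)).compLeft (Fin n)))
  have hf : Function.Surjective f := by
    intro w
    choose v hv using fun i => ZMod.intCast_surjective (w.toAdd i)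
    exact ⟨Multiplicative.ofAdd v, Multiplicative.toAdd.injective (funext hv)⟩
  have hker : f.ker = powClosure p ⊤ := by
    ext v
    constructor
    · intro hv
      have hv' : ∀ i, ((v.toAdd i : ℤ) : ZMod p) = 0 := fun i =>
        congrFun (congrArg Multiplicative.toAdd (MonoidHom.mem_ker.mp hv)) i
      choose w hw using fun i => (ZMod.intCast_zmod_eq_zero_iff_dvd _ _).mp (hv' i)
      have : v = (Multiplicative.ofAdd w) ^ p := by
        apply Multiplicative.toAdd.injective
        funext i
        rw [hw i]
        simp
      rw [this]
      exact pow_mem_powClosure p (Subgroup.mem_top _)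
    · intro hv
      refine (Subgroup.closure_le f.ker).mpr ?_ hv
      rintro _ ⟨x, -, rfl⟩
      rw [SetLike.mem_coe, MonoidHom.mem_ker, map_pow]
      apply Multiplicative.toAdd.injective
      funext i
      simp
  rw [← hker, Subgroup.index_ker, MonoidHom.range_eq_top.mpr hf, Subgroup.card_top]
  change Nat.card (Fin n → ZMod p) = _
  simp

theorem relIndex_powClosure_range {Γ : Type*} [Group Γ] {n : ℕ}
    (ι : Multiplicative (Fin n → ℤ) →* Γ) (hι : Function.Injective ι) {p : ℕ} (hp : p.Prime) :
    (powClosure p ι.range).relIndex ι.range = p ^ n := by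
  rw [MonoidHom.range_eq_map, ← map_powClosure, Subgroup.relIndex_map_map_of_injective _ _ hι,
    Subgroup.relIndex_top_right, index_powClosure_lattice n hp]

/-- A `p`-subgroup of the quotient of a torsion-free group by a sublattice of finite index in a
lattice of rank `n` is generated by `n` elements. -/
theorem genBy_of_isPGroup_quotient {Γ : Type*} [Group Γ] {n : ℕ}
    (ι : Multiplicative (Fin n → ℤ) →* Γ) (hι : Function.Injective ι)
    (htf : ∀ γ : Γ, IsOfFinOrder γ → γ = 1) (H : Subgroup Γ) [H.Normal] [Finite (Γ ⧸ H)]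
    (hH : H ≤ ι.range) (hidx : H.relIndex ι.range ≠ 0) {p : ℕ} (hp : p.Prime)
    (S : Subgroup (Γ ⧸ H)) (hS : IsPGroup p S) : GenBy S n := by
  have : Fact p.Prime := ⟨hp⟩
  have hcomm : ∀ x ∈ ι.range, ∀ y ∈ ι.range, x * y = y * x := by
    rintro _ ⟨x, rfl⟩ _ ⟨y, rfl⟩
    rw [← map_mul, mul_comm, map_mul]
  set T : Subgroup Γ := S.comap (QuotientGroup.mk' H) with hT
  have hHT : H ≤ T := fun x hx => by
    rw [hT, Subgroup.mem_comap, QuotientGroup.mk'_apply, (QuotientGroup.eq_one_iff x).mpr hx]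
    exact S.one_mem
  let f : T →* S := (QuotientGroup.mk' H).subgroupComap S
  have hf : Function.Surjective f :=
    MonoidHom.subgroupComap_surjective_of_surjective _ _ (QuotientGroup.mk'_surjective H)
  have hmap : (H.subgroupOf T).map T.subtype = H := by
    rw [Subgroup.subgroupOf_map_subtype, inf_eq_left.mpr hHT]
  have hq : (powClosure p (H.subgroupOf T)).relIndex (H.subgroupOf T) = p ^ n := by
    rw [← relIndex_powClosure_range ι hι hp, relIndex_powClosure_eq hp.pos hH hcomm
      (fun x _ => htf x) hidx, ← Subgroup.relIndex_map_map_of_injective _ _ T.subtype_injective,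
      map_powClosure, hmap]
  obtain ⟨k, hk⟩ := hS.exists_card_eq
  have hker : f.ker = H.subgroupOf T := by
    ext x
    rw [MonoidHom.mem_ker, ← Subtype.coe_inj, Subgroup.mem_subgroupOf]
    exact QuotientGroup.eq_one_iff (x : Γ)
  have hidx' : (H.subgroupOf T).index ∣ p ^ k := by
    rw [← hker, Subgroup.index_ker, MonoidHom.range_eq_top.mpr hf, Subgroup.card_top, hk]
  obtain ⟨A, hA, hb⟩ := hasElementaryBound (p := p) (H.subgroupOf T)
    (fun x hx y hy => Subtype.ext (hcomm _ (hH hx) _ (hH hy)))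
    (fun x _ hx => Subtype.ext (htf x (T.subtype.isOfFinOrder hx))) hidx'
    (by rw [hq]; exact pow_ne_zero _ hp.ne_zero)
  rw [hq] at hb
  refine genBy_of_index_le hS n fun F hF hc hpow => ?_
  rw [← Subgroup.index_comap_of_surjective F hf]
  refine hb _ (hF.comap f) (fun a ha => ?_) (fun x y => ?_) (fun x => ?_)
  · have : a = 1 := Subtype.ext (htf a (T.subtype.isOfFinOrder (hA a ha)))
    rw [this]
    exact Subgroup.one_mem _
  · simpa [Subgroup.mem_comap] using hc (f x) (f y)
  · simpa [Subgroup.mem_comap] using hpow (f x)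

theorem GenBy.of_quotient_normalClosure {Γ : Type*} [Group Γ] {L : Subgroup Γ} [L.Normal]
    (hL : ∀ x ∈ L, ∀ y ∈ L, x * y = y * x) {r : ℕ} (y : Fin r → Γ) (hy : ∀ i, y i ∈ L) {t : ℕ}
    (h : GenBy (Γ ⧸ Subgroup.normalClosure (Set.range y)) t) : GenBy Γ (t + r) := by
  set H := Subgroup.normalClosure (Set.range y) with hH
  have hHL : H ≤ L := Subgroup.normalClosure_le_normal (by rintro _ ⟨i, rfl⟩; exact hy i)
  obtain ⟨x, hx⟩ := h
  choose z hz using fun i => QuotientGroup.mk'_surjective H (x i)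
  have hgen : GenBy (Subgroup.closure (Set.range z)) t := by
    refine ⟨fun i => ⟨z i, Subgroup.subset_closure ⟨i, rfl⟩⟩, ?_⟩
    apply Subgroup.map_injective (Subgroup.closure (Set.range z)).subtype_injective
    rw [MonoidHom.map_closure, ← MonoidHom.range_eq_map, Subgroup.range_subtype, ← Set.range_comp]
    rfl
  refine hgen.sup y ?_
  set K := Subgroup.closure (Set.range z) ⊔ Subgroup.closure (Set.range y) with hK
  have hsup : Subgroup.closure (Set.range z) ⊔ H = ⊤ := by
    have h1 : (Subgroup.closure (Set.range z)).map (QuotientGroup.mk' H) = ⊤ := by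
      rw [MonoidHom.map_closure, ← Set.range_comp, ← hx]
      congr 2
      exact funext hz
    rw [← Subgroup.comap_top (QuotientGroup.mk' H), ← h1, Subgroup.comap_map_eq,
      QuotientGroup.ker_mk']
  have hHK : H ≤ K := by
    rw [hH, Subgroup.normalClosure, Subgroup.closure_le]
    intro g hg
    obtain ⟨_, ⟨i, rfl⟩, hconj⟩ := Group.mem_conjugatesOfSet_iff.mp hg
    obtain ⟨c, rfl⟩ := isConj_iff.mp hconj
    have hc : c ∈ Subgroup.closure (Set.range z) ⊔ H := by rw [hsup]; exact Subgroup.mem_top _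
    obtain ⟨a, ha, b, hb, rfl⟩ := Subgroup.mem_sup_of_normal_right.mp hc
    have hby := hL b (hHL hb) (y i) (hy i)
    have heq : a * b * y i * (a * b)⁻¹ = a * y i * a⁻¹ := by
      calc a * b * y i * (a * b)⁻¹ = a * (b * y i) * b⁻¹ * a⁻¹ := by group
        _ = _ := by rw [hby]; group
    rw [heq]
    have haK : a ∈ K := Subgroup.mem_sup_left ha
    exact K.mul_mem (K.mul_mem haK (Subgroup.mem_sup_right (Subgroup.subset_closure ⟨i, rfl⟩)))
      (K.inv_mem haK)
  rw [eq_top_iff, ← hsup]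
  exact sup_le le_sup_left hHK

theorem exists_conj_action {Γ : Type*} [Group Γ] {n : ℕ}
    (ι : Multiplicative (Fin n → ℤ) →* Γ) (hι : Function.Injective ι) [hn : ι.range.Normal] :
    ∃ σ : Γ →* Module.End ℤ (Fin n → ℤ), ∀ γ v,
      ι (Multiplicative.ofAdd (σ γ v)) = γ * ι (Multiplicative.ofAdd v) * γ⁻¹ := by
  have hex : ∀ (γ : Γ) (v : Fin n → ℤ), ∃ w : Fin n → ℤ,
      ι (Multiplicative.ofAdd w) = γ * ι (Multiplicative.ofAdd v) * γ⁻¹ := fun γ v =>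
    let ⟨w, hw⟩ := hn.conj_mem (ι (Multiplicative.ofAdd v)) ⟨_, rfl⟩ γ
    ⟨w.toAdd, hw⟩
  choose s hs using hex
  have hinj : ∀ {v w : Fin n → ℤ},
      ι (Multiplicative.ofAdd v) = ι (Multiplicative.ofAdd w) → v = w :=
    fun h => Multiplicative.ofAdd.injective (hι h)
  refine ⟨{ toFun := fun γ => ((AddMonoidHom.mk' (s γ) fun v w => hinj ?_).toIntLinearMap)
            map_one' := LinearMap.ext fun v => hinj ?_
            map_mul' := fun γ δ => LinearMap.ext fun v => hinj ?_ }, hs⟩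
  · rw [ofAdd_add, map_mul, hs, hs, hs, ofAdd_add, map_mul]
    group
  · change ι (Multiplicative.ofAdd (s 1 v)) = ι (Multiplicative.ofAdd v)
    rw [hs]
    group
  · change ι (Multiplicative.ofAdd (s (γ * δ) v)) = ι (Multiplicative.ofAdd (s γ (s δ v)))
    rw [hs, hs, hs]
    group

open scoped Pointwise in
/-- Finitely many nontrivial endomorphisms of a torsion-free abelian group have a common
non-fixed vector. -/
theorem exists_forall_apply_ne {V : Type*} [AddCommGroup V] [IsAddTorsionFree V]
    (s : Finset (Module.End ℤ V)) (hs : 1 ∉ s) : ∃ v, ∀ f ∈ s, f v ≠ v := by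
  by_contra! hcon
  have hcov : ⋃ f ∈ s, (0 : V) +ᵥ ((LinearMap.ker (f - 1)).toAddSubgroup : Set V) = Set.univ := by
    rw [Set.eq_univ_iff_forall]
    intro v
    obtain ⟨f, hf, hv⟩ := hcon v
    refine Set.mem_biUnion hf ?_
    rw [zero_vadd]
    simp [hv]
  obtain ⟨f, hf, hfin⟩ := AddSubgroup.exists_finiteIndex_of_leftCoset_cover hcov
  have h1 : f = 1 := by
    ext v
    have hmem := AddSubgroup.nsmul_index_mem (LinearMap.ker (f - 1)).toAddSubgroup v
    have h2 : (LinearMap.ker (f - 1)).toAddSubgroup.index • ((f - 1) v) = 0 := by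
      rw [← map_nsmul]
      exact hmem
    have h3 := (nsmul_eq_zero_iff_right hfin.index_ne_zero).mp h2
    exact sub_eq_zero.mp h3
  exact hs (h1 ▸ hf)

/-- A submodule of corank `k` is completed to a subgroup of finite index by `k` vectors. -/
theorem exists_complement_vectors {V : Type*} [AddCommGroup V] [Module.Finite ℤ V]
    (W : Submodule ℤ V) {k : ℕ} (hk : Module.finrank ℤ W + k = Module.finrank ℤ V) :
    ∃ y : Fin k → V, ∀ H : Subgroup (Multiplicative V),
      (∀ w ∈ W, Multiplicative.ofAdd w ∈ H) → (∀ i, Multiplicative.ofAdd (y i) ∈ H) →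
        H.index ≠ 0 := by
  have hQ := Submodule.finrank_quotient_add_finrank W
  obtain ⟨w, hw⟩ := exists_linearIndependent_of_le_finrank (R := ℤ) (M := V ⧸ W) (n := k) (by omega)
  set S := Submodule.span ℤ (Set.range w) with hS
  have hSr : Module.finrank ℤ S = k := by rw [finrank_span_eq_card hw, Fintype.card_fin]
  have hfin : Finite ((V ⧸ W) ⧸ S) := by
    refine Module.finite_of_fg_torsion _ (Module.finrank_eq_zero_iff_isTorsion.mp ?_)
    have := Submodule.finrank_quotient_add_finrank S
    omega
  choose y hy using fun i => W.mkQ_surjective (w i)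
  refine ⟨y, fun H hW hyH => ?_⟩
  let f : Multiplicative V →* Multiplicative ((V ⧸ W) ⧸ S) :=
    AddMonoidHom.toMultiplicative (S.mkQ ∘ₗ W.mkQ).toAddMonoidHom
  have : Finite (Multiplicative ((V ⧸ W) ⧸ S)) := hfin
  have hle : f.ker ≤ H := by
    intro v hv
    have h1 : W.mkQ v.toAdd ∈ S :=
      (Submodule.Quotient.mk_eq_zero S).mp (congrArg Multiplicative.toAdd (MonoidHom.mem_ker.mp hv))
    have h2 : S = (Submodule.span ℤ (Set.range y)).map W.mkQ := by
      rw [Submodule.map_span, ← Set.range_comp, hS]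
      congr 2
      exact (funext hy).symm
    have h3 : v.toAdd ∈ W ⊔ Submodule.span ℤ (Set.range y) := by
      rw [← Submodule.comap_map_mkQ, ← h2]
      exact h1
    have h4 : W ⊔ Submodule.span ℤ (Set.range y) ≤
        AddSubgroup.toIntSubmodule (Subgroup.toAddSubgroup' H) := by
      refine sup_le (fun x hx => hW x hx) (Submodule.span_le.mpr ?_)
      rintro _ ⟨i, rfl⟩
      exact hyH i
    exact h4 h3
  exact (Subgroup.finiteIndex_of_le hle).index_ne_zero

/-- The action of a group on an invariant submodule of finite rank, written as matrices. -/
theorem exists_matrix_action {Γ V : Type*} [Group Γ] [AddCommGroup V] [IsAddTorsionFree V]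
    [Module.Finite ℤ V] (σ : Γ →* Module.End ℤ V) (W : Submodule ℤ V)
    (hW : ∀ γ, ∀ w ∈ W, σ γ w ∈ W) :
    ∃ f : Γ →* GL (Fin (Module.finrank ℤ W)) ℤ, ∀ γ, f γ = 1 ↔ ∀ w ∈ W, σ γ w = w := by
  have : Module.Free ℤ W := Module.free_of_finite_type_torsion_free'
  let b := Module.finBasis ℤ W
  let τ : Γ →* Module.End ℤ W :=
    { toFun := fun γ => (σ γ).restrict (hW γ)
      map_one' := by ext w; simp
      map_mul' := fun γ δ => by ext w; simp }
  refine ⟨((LinearMap.toMatrixAlgEquiv b : _ ≃ₐ[ℤ] _).toMonoidHom.comp τ).toHomUnits,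
    fun γ => ⟨fun hγ w hw => ?_, fun hγ => Units.ext ?_⟩⟩
  · have h1 : LinearMap.toMatrixAlgEquiv b (τ γ) = LinearMap.toMatrixAlgEquiv b 1 := by
      rw [map_one]
      exact congrArg Units.val hγ
    have h2 := (LinearMap.toMatrixAlgEquiv b).injective h1
    exact congrArg Subtype.val (LinearMap.congr_fun h2 ⟨w, hw⟩)
  · have h1 : τ γ = 1 := LinearMap.ext fun w => Subtype.ext (hγ w w.2)
    change LinearMap.toMatrixAlgEquiv b (τ γ) = 1
    rw [h1, map_one]

theorem genBy_of_matrix_action_le_one {Γ : Type*} [Group Γ] {L : Subgroup Γ} {n : ℕ}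
    (hL : GenBy L n) {m : ℕ} (hm : m ≤ 1) (f : Γ →* GL (Fin m) ℤ) (hf : ∀ γ, f γ = 1 → γ ∈ L) :
    GenBy Γ (n + 1) := by
  have hdet : ∀ γ, Matrix.GeneralLinearGroup.det (f γ) = 1 → γ ∈ L := by
    intro γ hγ
    refine hf γ (Units.ext ?_)
    have h1 : (f γ).1.det = 1 := congrArg Units.val hγ
    have hsub : Subsingleton (Fin m) := Fin.subsingleton_iff_le_one.mpr hm
    refine Matrix.ext fun i j => ?_
    have hcard : Fintype.card (Fin m) = 1 := Fintype.card_eq_one_iff.mpr ⟨i, fun k => hsub.elim _ _⟩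
    obtain rfl : i = j := hsub.elim _ _
    rw [Matrix.det_eq_elem_of_card_eq_one hcard i] at h1
    exact h1.trans (Matrix.one_apply_eq i).symm
  obtain ⟨g, hg⟩ : ∃ g, ∀ γ, γ ∉ L → γ * g⁻¹ ∈ L := by
    by_cases h : ∃ g, g ∉ L
    · obtain ⟨g, hg⟩ := h
      refine ⟨g, fun γ hγ => hdet _ ?_⟩
      have h1 := (Int.units_eq_one_or (Matrix.GeneralLinearGroup.det (f g))).resolve_left
        (fun h => hg (hdet g h))
      have h2 := (Int.units_eq_one_or (Matrix.GeneralLinearGroup.det (f γ))).resolve_left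
        (fun h => hγ (hdet γ h))
      rw [map_mul, map_mul, map_inv, map_inv, h1, h2]
      simp
    · push Not at h
      exact ⟨1, fun γ hγ => absurd (h γ) hγ⟩
  refine hL.sup (fun _ => g) (eq_top_iff.mpr fun γ _ => ?_)
  by_cases hγ : γ ∈ L
  · exact Subgroup.mem_sup_left hγ
  · rw [← inv_mul_cancel_right γ g]
    exact Subgroup.mul_mem _ (Subgroup.mem_sup_left (hg γ hγ))
      (Subgroup.mem_sup_right (Subgroup.subset_closure ⟨0, rfl⟩))

open scoped Nat in
theorem genBy_quotient {Γ : Type*} [Group Γ] {n : ℕ} (ι : Multiplicative (Fin n → ℤ) →* Γ)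
    (hι : Function.Injective ι) [ι.range.Normal] (htf : ∀ γ : Γ, IsOfFinOrder γ → γ = 1)
    (H : Subgroup Γ) [H.Normal] [Finite (Γ ⧸ H)] (hH : H ≤ ι.range) {m : ℕ} (hm : 2 ≤ m)
    (hmn : m ≤ n) (f : Γ →* GL (Fin m) ℤ) (hf : f.ker = ι.range) : GenBy (Γ ⧸ H) (n + m - 1) := by
  have hHidx : H.index ≠ 0 := Subgroup.index_ne_zero_of_finite
  have hidx : H.relIndex ι.range ≠ 0 := fun h =>
    hHidx (by rw [← Subgroup.relIndex_mul_index hH, h, zero_mul])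
  have hLidx : ι.range.index ≠ 0 := fun h =>
    hHidx (by rw [← Subgroup.relIndex_mul_index hH, h, mul_zero])
  have : Finite (Γ ⧸ f.ker) := by
    rw [hf]
    have : ι.range.FiniteIndex := ⟨hLidx⟩
    infer_instance
  have hmink : ∀ p : ℕ, p.Prime → p ≠ 2 → ∀ k, p ^ k ∣ ι.range.index →
      p ^ k ∣ (p * (m / (p - 1)))! := fun p hp hp2 k hk =>
    prime_pow_dvd_factorial_of_injective (QuotientGroup.kerLift f)
      (QuotientGroup.kerLift_injective f) hp hp2 (by rwa [← Subgroup.index, hf])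
  set B := ι.range.map (QuotientGroup.mk' H) with hB
  have : B.Normal := Subgroup.Normal.map inferInstance _ (QuotientGroup.mk'_surjective H)
  have hBidx : B.index = ι.range.index :=
    Subgroup.index_map_eq _ (QuotientGroup.mk'_surjective H) (by rwa [QuotientGroup.ker_mk'])
  refine genBy_of_surjective B ?_ (n := n)
    (fun p hp S hS => genBy_of_isPGroup_quotient ι hι htf H hH hidx hp S hS)
    (fun p hp hp2 k hk => ?_) ⊤ le_top (by omega) (fun d hd hdB => ?_)
    (Subgroup.topEquiv : (⊤ : Subgroup (Γ ⧸ H)) ≃* Γ ⧸ H).toMonoidHom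
    (MulEquiv.surjective (Subgroup.topEquiv : (⊤ : Subgroup (Γ ⧸ H)) ≃* Γ ⧸ H))
  · rintro _ ⟨_, ⟨x, rfl⟩, rfl⟩ _ ⟨_, ⟨y, rfl⟩, rfl⟩
    rw [← map_mul, ← map_mul, mul_comm, map_mul, map_mul]
  · rw [hBidx] at hk
    exact (le_of_prime_pow_dvd_factorial hp hp2 (hmink p hp hp2 k hk)).trans hmn
  · rw [Subgroup.relIndex_top_right, hBidx] at hdB
    rw [show n + m - 1 + 1 = n + m by omega]
    have hd0 : d ≠ 0 := by rintro rfl; simp at hd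
    refine odd_mul_factorial_lt hm hmn hd fun p hp hp2 => ?_
    rw [← hp.pow_dvd_iff_le_factorization (Nat.factorial_ne_zero _)]
    exact hmink p hp hp2 _ ((Nat.ordProj_dvd d p).trans hdB)

theorem genBy_two_mul {Γ : Type*} [Group Γ] {n : ℕ} (ι : Multiplicative (Fin n → ℤ) →* Γ)
    (hι : Function.Injective ι) [ι.range.Normal] [Finite (Γ ⧸ ι.range)]
    (hfaithful : ∀ γ : Γ, (∀ x, γ * ι x * γ⁻¹ = ι x) → γ ∈ ι.range)
    (htf : ∀ γ : Γ, IsOfFinOrder γ → γ = 1) : GenBy Γ (2 * n) := by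
  classical
  rcases Nat.eq_zero_or_pos n with rfl | hn
  · have h1 : ∀ γ : Γ, γ = 1 := fun γ => by
      obtain ⟨x, hx⟩ := hfaithful γ fun x => by
        rw [Subsingleton.elim x 1]; simp
      rw [← hx, Subsingleton.elim x 1, map_one]
    have : Subsingleton Γ := ⟨fun a b => by rw [h1 a, h1 b]⟩
    exact genBy_of_subsingleton _
  obtain ⟨σ, hσ⟩ := exists_conj_action ι hι
  have hσ1 : ∀ γ, γ ∈ ι.range ↔ σ γ = 1 := by
    intro γ
    constructor
    · rintro ⟨x, rfl⟩
      refine LinearMap.ext fun v => Multiplicative.ofAdd.injective (hι ?_)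
      rw [hσ, ← map_inv, ← map_mul, ← map_mul, mul_right_comm, mul_inv_cancel, one_mul]
      rfl
    · intro h
      refine hfaithful γ fun x => ?_
      have := hσ γ x.toAdd
      rw [h] at this
      exact this.symm
  have hfin : (Set.range σ).Finite := by
    have : Set.range σ ⊆ Set.range fun q : Γ ⧸ ι.range => σ q.out := by
      rintro _ ⟨γ, rfl⟩
      refine ⟨QuotientGroup.mk γ, ?_⟩
      obtain ⟨h, hh⟩ := QuotientGroup.mk_out_eq_mul ι.range γ
      change σ _ = σ γ
      rw [hh, map_mul, (hσ1 _).mp h.2, mul_one]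
    exact (Set.finite_range _).subset this
  obtain ⟨v, hv⟩ := exists_forall_apply_ne (hfin.toFinset.erase 1) (Finset.notMem_erase _ _)
  have hv' : ∀ γ, σ γ v = v → γ ∈ ι.range := by
    intro γ hγ
    by_contra hcon
    refine hv (σ γ) ?_ hγ
    rw [Finset.mem_erase, Set.Finite.mem_toFinset]
    exact ⟨fun h => hcon ((hσ1 γ).mpr h), γ, rfl⟩
  set W : Submodule ℤ (Fin n → ℤ) := Submodule.span ℤ (Set.range fun γ => σ γ v) with hW
  have hvW : v ∈ W := Submodule.subset_span ⟨1, by simp⟩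
  have hWinv : ∀ γ, ∀ w ∈ W, σ γ w ∈ W := by
    intro γ
    change W ≤ W.comap (σ γ)
    rw [hW, Submodule.span_le]
    rintro _ ⟨δ, rfl⟩
    exact Submodule.subset_span ⟨γ * δ, by simp⟩
  obtain ⟨m, hm, f, hf⟩ : ∃ m, m = Module.finrank ℤ W ∧ ∃ f : Γ →* GL (Fin m) ℤ,
      ∀ γ, f γ = 1 ↔ ∀ w ∈ W, σ γ w = w := ⟨_, rfl, exists_matrix_action σ W hWinv⟩
  have hker : ∀ γ, f γ = 1 → γ ∈ ι.range := fun γ h => hv' γ ((hf γ).mp h v hvW)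
  have hLgen : GenBy ι.range n := (genBy_lattice n).map ι.rangeRestrict ι.rangeRestrict_surjective
  have hmn : m ≤ n := by
    simpa [hm] using Submodule.finrank_le W
  rcases le_or_gt m 1 with hm1 | hm1
  · exact (genBy_of_matrix_action_le_one hLgen hm1 f hker).mono (by omega)
  obtain ⟨y, hy⟩ := exists_complement_vectors W (k := n - m) (by simp; omega)
  let z : Fin (n - m + 1) → Γ := fun i =>
    ι (Multiplicative.ofAdd ((Fin.cons v y : Fin (n - m + 1) → Fin n → ℤ) i))
  set H := Subgroup.normalClosure (Set.range z) with hH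
  have hzL : ∀ i, z i ∈ ι.range := fun i => ⟨_, rfl⟩
  have hHL : H ≤ ι.range := Subgroup.normalClosure_le_normal (by rintro _ ⟨i, rfl⟩; exact hzL i)
  have hzH : ∀ i, z i ∈ H := fun i => Subgroup.subset_normalClosure ⟨i, rfl⟩
  have hidx : H.relIndex ι.range ≠ 0 := by
    rw [← Subgroup.index_comap]
    refine hy _ ?_ fun i => ?_
    · change W ≤ AddSubgroup.toIntSubmodule (Subgroup.toAddSubgroup' (H.comap ι))
      rw [hW, Submodule.span_le]
      rintro _ ⟨γ, rfl⟩
      change ι (Multiplicative.ofAdd (σ γ v)) ∈ H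
      rw [hσ]
      have hnor : H.Normal := inferInstance
      exact hnor.conj_mem _ (hzH 0) γ
    · simpa [z] using hzH i.succ
  have hHidx : H.index ≠ 0 := by
    rw [← Subgroup.relIndex_mul_index hHL]
    exact mul_ne_zero hidx Subgroup.index_ne_zero_of_finite
  have : H.FiniteIndex := ⟨hHidx⟩
  have hfker : f.ker = ι.range := by
    refine Subgroup.ext fun γ => ⟨fun h => hker γ h, fun h => (hf γ).mpr fun w _ => ?_⟩
    rw [(hσ1 γ).mp h]
    rfl
  have hE := genBy_quotient ι hι htf H hHL hm1 hmn f hfker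
  have hcomm : ∀ x ∈ ι.range, ∀ y ∈ ι.range, x * y = y * x := by
    rintro _ ⟨x, rfl⟩ _ ⟨y, rfl⟩
    rw [← map_mul, mul_comm, map_mul]
  have := GenBy.of_quotient_normalClosure hcomm z hzL hE
  rwa [show n + m - 1 + (n - m + 1) = 2 * n by omega] at this

end BieberbachRank

/-- Let `Γ` be an `n`-dimensional Bieberbach group (a torsion-free crystallographic
group). Then `d(Γ) ≤ 2n`.

The crystallographic structure is encoded by a short exact sequence
`0 → ℤⁿ →ι Γ →π G → 1` (with `G` finite, `ι` injective, `π` surjective and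
`ker π = range ι`), such that the induced conjugation representation `ρ : G → GL_n(ℤ)` is
faithful; faithfulness is equivalent to the requirement that every element of `Γ` that
centralizes the translation lattice `ι(ℤⁿ)` already lies in `ι(ℤⁿ)`. -/
theorem minGenerators_le_two_mul_of_bieberbach
    (n : ℕ) (Γ G : Type*) [Group Γ] [Group G] [Finite G]
    (ι : Multiplicative (Fin n → ℤ) →* Γ) (hι : Function.Injective ι)
    (π : Γ →* G) (hπ : Function.Surjective π)
    (hexact : ∀ γ : Γ, π γ = 1 ↔ γ ∈ ι.range)
    (hfaithful : ∀ γ : Γ, (∀ x, γ * ι x * γ⁻¹ = ι x) → γ ∈ ι.range)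
    (htf : ∀ γ : Γ, γ ≠ 1 → ¬ IsOfFinOrder γ) :
    minGenerators Γ ≤ 2 * n := by
  have hker : π.ker = ι.range := Subgroup.ext hexact
  have hnor : ι.range.Normal := hker ▸ (inferInstance : π.ker.Normal)
  have hfin : Finite (Γ ⧸ ι.range) :=
    hker ▸ Finite.of_injective _ (QuotientGroup.kerLift_injective π)
  exact (BieberbachRank.genBy_two_mul ι hι hfaithful
    fun γ h => by_contra fun h1 => htf γ h1 h).minGenerators_le
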